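/- arXiv:math/0701216 — 9 statements merged into one kernel-verified Lean document; each statement's English description precedes it below -/
import Mathlib

section
/- Let n ≥ 2 be an integer and A, G, P∞, M > 0 real constants, γ > 0. Assume one of the following holds: (i) γ > (2n−2)/n; (ii) γ = (2n−2)/n and G·n^((2−n)/n)·M^(2/n) < 2A; or (iii) 0 < γ < (2n−2)/n and P∞ + (G/2)·n^((2−n)/n)·M^(2/n)·δ₃^((2n−2)/n) ≤ A·δ₃^γ, where δ₃ = (A γ n^((2n−2)/n) / ((n−1) G M^(2/n)))^(n/(2n−2−nγ)). Then there exists a continuous function ρ∞ : [0,M] → ℝ with ρ∞(x) ≥ (P∞/A)^(1/γ) for all x ∈ [0,M], satisfying the integral equation A·ρ∞(x)^γ = P∞ + ∫_x^M G y / r∞(y)^(2n−2) dy for all x ∈ [0,M], where r∞(x) = (n ∫_0^x ρ∞(y)^(−1) dy)^(1/n). -/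
open MeasureTheory intervalIntegral Set

/-- δ₃ from the paper: `(Aγ n^((2n−2)/n) / ((n−1) G M^(2/n)))^(n/(2n−2−nγ))`. -/
noncomputable def delta3 (n : ℕ) (A G M γ : ℝ) : ℝ :=
  (A * γ * (n : ℝ) ^ ((2 * (n : ℝ) - 2) / (n : ℝ)) /
      (((n : ℝ) - 1) * G * M ^ ((2 : ℝ) / (n : ℝ)))) ^
    ((n : ℝ) / (2 * (n : ℝ) - 2 - (n : ℝ) * γ))

/-- The integrand `G y / r(y)^(2n-2)`, where `r(y)^n = n ∫_0^y u` and `u` is the specific volume. -/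
noncomputable def gravityIntegrand (n : ℕ) (G : ℝ) (u : ℝ → ℝ) (y : ℝ) : ℝ :=
  G * y / (((n : ℝ) * ∫ z in (0 : ℝ)..y, u z) ^ ((1 : ℝ) / (n : ℝ))) ^ (2 * n - 2)

lemma gravityIntegrand_anti {n : ℕ} (hn : 2 ≤ n) {G : ℝ} (hG : 0 < G) {u v : ℝ → ℝ}
    (hu : ∀ a b, IntervalIntegrable u volume a b) (hv : ∀ a b, IntervalIntegrable v volume a b)
    (hpos : ∀ z, 0 < u z) (huv : ∀ z, u z ≤ v z) {y : ℝ} (hy : 0 ≤ y) :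
    gravityIntegrand n G v y ≤ gravityIntegrand n G u y := by
  rcases hy.eq_or_lt with rfl | hy
  · simp [gravityIntegrand]
  have hn0 : (0 : ℝ) < n := by positivity
  have h1 : 0 < ∫ z in (0 : ℝ)..y, u z := intervalIntegral_pos_of_pos (hu 0 y) hpos hy
  have h2 : ∫ z in (0 : ℝ)..y, u z ≤ ∫ z in (0 : ℝ)..y, v z :=
    intervalIntegral.integral_mono hy.le (hu 0 y) (hv 0 y) huv
  unfold gravityIntegrand
  gcongr

lemma gravityIntegrand_nonneg {n : ℕ} {G : ℝ} (hG : 0 < G) {u : ℝ → ℝ} (hpos : ∀ z, 0 < u z)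
    {y : ℝ} (hy : 0 ≤ y) : 0 ≤ gravityIntegrand n G u y := by
  have h1 : 0 ≤ ∫ z in (0 : ℝ)..y, u z :=
    intervalIntegral.integral_nonneg hy fun z _ => (hpos z).le
  unfold gravityIntegrand
  positivity

lemma gravityIntegrand_const {n : ℕ} (hn : 2 ≤ n) (G : ℝ) {b : ℝ} (hb : 0 < b) {y : ℝ}
    (hy : 0 < y) :
    gravityIntegrand n G (fun _ => b) y =
      G * (n * b) ^ (-((2 * (n : ℝ) - 2) / n)) * y ^ ((2 - (n : ℝ)) / n) := by
  have hn0 : (0 : ℝ) < n := by positivity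
  have hnb : 0 < (n : ℝ) * b := by positivity
  have hpow : (((n : ℝ) * (y * b)) ^ ((1 : ℝ) / (n : ℝ))) ^ (2 * n - 2) =
      (n * b) ^ ((2 * (n : ℝ) - 2) / n) * y ^ ((2 * (n : ℝ) - 2) / n) := by
    rw [← Real.rpow_natCast, ← Real.rpow_mul (by positivity), ← Real.mul_rpow hnb.le hy.le]
    congr 1
    · ring
    · rw [Nat.cast_sub (by omega)]
      push_cast
      ring
  have hy' : y ^ ((2 - (n : ℝ)) / n) = y / y ^ ((2 * (n : ℝ) - 2) / n) := by
    rw [show (2 - (n : ℝ)) / n = 1 - (2 * (n : ℝ) - 2) / n by field_simp; ring,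
      Real.rpow_sub hy, Real.rpow_one]
  simp only [gravityIntegrand, intervalIntegral.integral_const, sub_zero, smul_eq_mul]
  rw [hpow, hy', Real.rpow_neg hnb.le]
  field_simp

lemma neg_one_lt_two_sub_div {n : ℕ} (hn : 2 ≤ n) : -1 < (2 - (n : ℝ)) / n := by
  have hn0 : (0 : ℝ) < n := by positivity
  rw [lt_div_iff₀ hn0]
  linarith

lemma intervalIntegrable_gravityIntegrand_const {n : ℕ} (hn : 2 ≤ n) (G : ℝ) {b : ℝ} (hb : 0 < b)
    {M : ℝ} (hM : 0 < M) :
    IntervalIntegrable (gravityIntegrand n G fun _ => b) volume 0 M := by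
  refine ((intervalIntegrable_rpow' (neg_one_lt_two_sub_div hn)).const_mul
    (G * (n * b) ^ (-((2 * (n : ℝ) - 2) / n)))).congr fun y hy => ?_
  rw [uIoc_of_le hM.le] at hy
  exact (gravityIntegrand_const hn G hb hy.1).symm

lemma integral_gravityIntegrand_const {n : ℕ} (hn : 2 ≤ n) (G : ℝ) {d : ℝ} (hd : 0 < d)
    {M : ℝ} (hM : 0 < M) :
    ∫ y in (0 : ℝ)..M, gravityIntegrand n G (fun _ => d⁻¹) y =
      G / 2 * (n : ℝ) ^ ((2 - (n : ℝ)) / n) * M ^ ((2 : ℝ) / n) *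
        d ^ ((2 * (n : ℝ) - 2) / n) := by
  have hn0 : (0 : ℝ) < n := by positivity
  have hexp : (2 - (n : ℝ)) / n + 1 = 2 / n := by field_simp; ring
  have hsplit : (2 - (n : ℝ)) / n = -((2 * (n : ℝ) - 2) / n) + 1 := by field_simp; ring
  have hcongr : ∫ y in (0 : ℝ)..M, gravityIntegrand n G (fun _ => d⁻¹) y =
      ∫ y in (0 : ℝ)..M,
        G * (n * d⁻¹) ^ (-((2 * (n : ℝ) - 2) / n)) * y ^ ((2 - (n : ℝ)) / n) := by
    refine intervalIntegral.integral_congr_ae (ae_of_all _ fun y hy => ?_)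
    rw [uIoc_of_le hM.le] at hy
    exact gravityIntegrand_const hn G (inv_pos.2 hd) hy.1
  have hnpow : (n : ℝ) ^ ((2 - (n : ℝ)) / n) = (n : ℝ) ^ (-((2 * (n : ℝ) - 2) / n)) * n := by
    rw [hsplit, Real.rpow_add hn0, Real.rpow_one]
  rw [hcongr, intervalIntegral.integral_const_mul,
    integral_rpow (Or.inl (neg_one_lt_two_sub_div hn)), hexp, Real.zero_rpow (by positivity),
    Real.mul_rpow hn0.le (by positivity), Real.inv_rpow hd.le,
    Real.rpow_neg hd.le, inv_inv, hnpow]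
  field_simp
  ring

lemma intervalIntegrable_gravityIntegrand {n : ℕ} (hn : 2 ≤ n) {G : ℝ} (hG : 0 < G) {b : ℝ}
    (hb : 0 < b) {u : ℝ → ℝ} (hu : ∀ a b, IntervalIntegrable u volume a b)
    (hbu : ∀ z, b ≤ u z) {M : ℝ} (hM : 0 < M) :
    IntervalIntegrable (gravityIntegrand n G u) volume 0 M := by
  refine (intervalIntegrable_gravityIntegrand_const hn G hb hM).mono_fun ?_ ?_
  · have := (intervalIntegral.continuous_primitive hu 0).measurable
    unfold gravityIntegrand
    exact Measurable.aestronglyMeasurable (by fun_prop)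
  · rw [Filter.EventuallyLE, ae_restrict_iff' measurableSet_uIoc]
    refine ae_of_all _ fun y hy => ?_
    rw [uIoc_of_le hM.le] at hy
    rw [Real.norm_of_nonneg (gravityIntegrand_nonneg hG (fun z => hb.trans_le (hbu z)) hy.1.le),
      Real.norm_of_nonneg (gravityIntegrand_nonneg hG (fun _ => hb) hy.1.le)]
    exact gravityIntegrand_anti hn hG (fun _ _ => intervalIntegrable_const) hu (fun _ => hb) hbu
      hy.1.le

/-- Under each of the assumptions on `γ` there is a constant supersolution. -/
lemma exists_constant_supersolution {A P K α γ : ℝ} (hA : 0 < A) (hP : 0 < P) (hK : 0 < K)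
    (hα : 0 < α) (hγ : 0 < γ) (h : α < γ ∨ γ = α ∧ K < A) :
    ∃ d : ℝ, 0 < d ∧ P + K * d ^ α ≤ A * d ^ γ := by
  rcases h with h | ⟨rfl, h⟩
  · have hq : 0 < (P + K) / A := by positivity
    refine ⟨max 1 (((P + K) / A) ^ (γ - α)⁻¹), by positivity, ?_⟩
    set d := max 1 (((P + K) / A) ^ (γ - α)⁻¹)
    have hd1 : 1 ≤ d := le_max_left _ _
    have hd0 : 0 < d := by positivity
    have h1 : (P + K) / A ≤ d ^ (γ - α) := by
      calc (P + K) / A = (((P + K) / A) ^ (γ - α)⁻¹) ^ (γ - α) :=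
            (Real.rpow_inv_rpow hq.le (sub_pos.2 h).ne').symm
        _ ≤ d ^ (γ - α) :=
            Real.rpow_le_rpow (by positivity) (le_max_right _ _) (sub_pos.2 h).le
    have h2 : 1 ≤ d ^ α := Real.one_le_rpow hd1 hα.le
    have h3 : d ^ γ = d ^ (γ - α) * d ^ α := by rw [← Real.rpow_add hd0]; ring_nf
    rw [div_le_iff₀ hA] at h1
    rw [h3]
    nlinarith [mul_le_mul_of_nonneg_right h1 (zero_le_one.trans h2)]
  · have hAK : 0 < A - K := sub_pos.2 h
    refine ⟨(P / (A - K)) ^ γ⁻¹, by positivity, ?_⟩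
    rw [Real.rpow_inv_rpow (by positivity) hγ.ne']
    have : (A - K) * (P / (A - K)) = P := by field_simp
    linarith

/-- A constant supersolution yields a solution, as a fixed point of a monotone operator on
the complete lattice of monotone specific volumes. -/
lemma exists_stationary_of_supersolution {n : ℕ} (hn : 2 ≤ n) {A G P M γ d : ℝ}
    (hA : 0 < A) (hG : 0 < G) (hP : 0 < P) (hM : 0 < M) (hγ : 0 < γ) (hd : 0 < d)
    (hsuper : P + G / 2 * (n : ℝ) ^ ((2 - (n : ℝ)) / n) * M ^ ((2 : ℝ) / n) *
      d ^ ((2 * (n : ℝ) - 2) / n) ≤ A * d ^ γ) :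
    ∃ ρ : ℝ → ℝ, ContinuousOn ρ (Icc 0 M) ∧ (∀ x ∈ Icc (0 : ℝ) M, (P / A) ^ (1 / γ) ≤ ρ x) ∧
      ∀ x ∈ Icc (0 : ℝ) M,
        A * ρ x ^ γ = P + ∫ y in x..M, gravityIntegrand n G (fun z => (ρ z)⁻¹) y := by
  set a := (P / A) ^ (1 / γ)
  have ha : 0 < a := by positivity
  have hdi : 0 < d⁻¹ := inv_pos.2 hd
  -- The density associated with a specific volume `u`.
  let R : (ℝ → ℝ) → ℝ → ℝ := fun u x =>
    ((P + ∫ y in x..M, gravityIntegrand n G u y) / A) ^ (1 / γ)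
  let c : ℝ → ℝ := fun x => projIcc 0 M hM.le x
  have hc : Monotone c := fun x y hxy => monotone_projIcc hM.le hxy
  have hcm : ∀ x, c x ∈ Icc 0 M := fun x => (projIcc 0 M hM.le x).2
  have hint : ∀ u : ℝ → ℝ, Monotone u → (∀ z, d⁻¹ ≤ u z) → ∀ x ∈ Icc 0 M, ∀ y ∈ Icc 0 M,
      IntervalIntegrable (gravityIntegrand n G u) volume x y := fun u hu hdu x hx y hy =>
    (intervalIntegrable_gravityIntegrand hn hG hdi (fun _ _ => hu.intervalIntegrable) hdu
      hM).mono_set (by rw [uIcc_of_le hM.le]; exact uIcc_subset_Icc hx hy)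
  have hMm : M ∈ Icc 0 M := ⟨hM.le, le_rfl⟩
  have h0m : (0 : ℝ) ∈ Icc 0 M := ⟨le_rfl, hM.le⟩
  have hnn : ∀ u : ℝ → ℝ, (∀ z, d⁻¹ ≤ u z) → ∀ y, 0 ≤ y → 0 ≤ gravityIntegrand n G u y :=
    fun u hdu y hy => gravityIntegrand_nonneg hG (fun z => hdi.trans_le (hdu z)) hy
  have hIpos : ∀ u : ℝ → ℝ, (∀ z, d⁻¹ ≤ u z) → ∀ x ∈ Icc 0 M,
      0 ≤ ∫ y in x..M, gravityIntegrand n G u y := fun u hdu x hx =>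
    intervalIntegral.integral_nonneg hx.2 fun y hy => hnn u hdu y (hx.1.trans hy.1)
  have hRlow : ∀ u : ℝ → ℝ, (∀ z, d⁻¹ ≤ u z) → ∀ x ∈ Icc 0 M, a ≤ R u x := by
    intro u hdu x hx
    have := hIpos u hdu x hx
    exact Real.rpow_le_rpow (by positivity) (by gcongr; linarith) (by positivity)
  have hRanti : ∀ u : ℝ → ℝ, Monotone u → (∀ z, d⁻¹ ≤ u z) → ∀ x ∈ Icc 0 M, ∀ y ∈ Icc 0 M,
      x ≤ y → R u y ≤ R u x := by
    intro u hu hdu x hx y hy hxy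
    have h1 := hIpos u hdu y hy
    have h2 : 0 ≤ ∫ z in x..y, gravityIntegrand n G u z :=
      intervalIntegral.integral_nonneg hxy fun z hz => hnn u hdu z (hx.1.trans hz.1)
    have h3 := intervalIntegral.integral_add_adjacent_intervals
      (hint u hu hdu x hx y hy) (hint u hu hdu y hy M hMm)
    exact Real.rpow_le_rpow (by positivity) (by gcongr ?_ / A; linarith) (by positivity)
  have hRmono : ∀ u v : ℝ → ℝ, Monotone u → Monotone v → (∀ z, d⁻¹ ≤ u z) → (∀ z, u z ≤ v z) →
      ∀ x ∈ Icc 0 M, R v x ≤ R u x := by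
    intro u v hu hv hdu huv x hx
    have hdv : ∀ z, d⁻¹ ≤ v z := fun z => (hdu z).trans (huv z)
    have h1 := hIpos v hdv x hx
    have h2 : ∫ y in x..M, gravityIntegrand n G v y ≤ ∫ y in x..M, gravityIntegrand n G u y :=
      intervalIntegral.integral_mono_on hx.2 (hint v hv hdv x hx M hMm) (hint u hu hdu x hx M hMm)
        fun y hy => gravityIntegrand_anti hn hG (fun _ _ => hu.intervalIntegrable)
          (fun _ _ => hv.intervalIntegrable) (fun z => hdi.trans_le (hdu z)) huv (hx.1.trans hy.1)
    exact Real.rpow_le_rpow (by positivity) (by gcongr) (by positivity)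
  have hRd : R (fun _ => d⁻¹) 0 ≤ d := by
    simp only [R]
    rw [integral_gravityIntegrand_const hn G hd hM, one_div,
      Real.rpow_inv_le_iff_of_pos (by positivity) hd.le hγ, div_le_iff₀ hA]
    linarith
  have hRup : ∀ u : ℝ → ℝ, Monotone u → (∀ z, d⁻¹ ≤ u z) → ∀ x ∈ Icc 0 M, R u x ≤ d :=
    fun u hu hdu x hx => (hRanti u hu hdu 0 h0m x hx hx.1).trans
      ((hRmono _ u monotone_const hu (fun _ => le_rfl) hdu 0 h0m).trans hRd)
  have hda : d⁻¹ ≤ a⁻¹ :=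
    inv_anti₀ ha ((hRlow _ (fun _ => le_rfl) 0 h0m).trans hRd)
  have : Fact (d⁻¹ ≤ a⁻¹) := ⟨hda⟩
  have hmono : ∀ f : ℝ →o Icc d⁻¹ a⁻¹, Monotone fun z => (f z : ℝ) := fun f x y h => f.monotone h
  have hlow : ∀ (f : ℝ →o Icc d⁻¹ a⁻¹) z, d⁻¹ ≤ (f z : ℝ) := fun f z => (f z).2.1
  have hRpos : ∀ (f : ℝ →o Icc d⁻¹ a⁻¹) x, 0 < R (fun z => f z) (c x) := fun f x =>
    ha.trans_le (hRlow _ (hlow f) _ (hcm x))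
  let T : (ℝ →o Icc d⁻¹ a⁻¹) → (ℝ →o Icc d⁻¹ a⁻¹) := fun f =>
    { toFun := fun x => ⟨(R (fun z => f z) (c x))⁻¹,
        inv_anti₀ (hRpos f x) (hRup _ (hmono f) (hlow f) _ (hcm x)),
        inv_anti₀ ha (hRlow _ (hlow f) _ (hcm x))⟩
      monotone' := fun x y h => inv_anti₀ (hRpos f y)
        (hRanti _ (hmono f) (hlow f) _ (hcm x) _ (hcm y) (hc h)) }
  have hT : Monotone T := fun f g h x => inv_anti₀ (hRpos g x)
    (hRmono _ _ (hmono f) (hmono g) (hlow f) (fun z => h z) _ (hcm x))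
  obtain ⟨f, hf⟩ : ∃ f, T f = f := ⟨OrderHom.lfp ⟨T, hT⟩, OrderHom.map_lfp ⟨T, hT⟩⟩
  have hfix : ∀ x ∈ Icc 0 M, (f x : ℝ)⁻¹ = R (fun z => f z) x := by
    intro x hx
    have h1 : (R (fun z => f z) (c x))⁻¹ = (f x : ℝ) := congrArg (fun g => (g x : ℝ)) hf
    have h2 : c x = x := congrArg Subtype.val (projIcc_of_mem hM.le hx)
    rw [← h1, inv_inv, h2]
  refine ⟨fun x => (f x : ℝ)⁻¹, ContinuousOn.congr ?_ hfix,
    fun x hx => (hRlow _ (hlow f) x hx).trans_eq (hfix x hx).symm, fun x hx => ?_⟩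
  · have hcont : ContinuousOn (fun x => ∫ y in x..M, gravityIntegrand n G (fun z => f z) y)
        (Icc 0 M) := by
      rw [← uIcc_of_le hM.le]
      refine intervalIntegral.continuousOn_primitive_interval_left ?_
      rw [uIcc_of_le hM.le, ← intervalIntegrable_iff_integrableOn_Icc_of_le hM.le]
      exact hint _ (hmono f) (hlow f) 0 h0m M hMm
    exact ((continuousOn_const.add hcont).div_const A).rpow_const
      fun x _ => Or.inr (by positivity)
  · have h1 := hIpos _ (hlow f) x hx
    simp only [inv_inv]
    rw [hfix x hx]
    simp only [R]
    rw [one_div, Real.rpow_inv_rpow (by positivity) hγ.ne']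
    field_simp

/-- Existence of a positive solution of the Lagrangian stationary problem
`A ρ∞(x)^γ = P∞ + ∫_x^M G y / r∞(y)^(2n−2) dy`,
`r∞(x) = (n ∫_0^x ρ∞(y)⁻¹ dy)^(1/n)`, under the three alternative assumptions on `γ`. -/
theorem stationary_existence
    (n : ℕ) (hn : 2 ≤ n) (A G Pinf M γ : ℝ)
    (hA : 0 < A) (hG : 0 < G) (hPinf : 0 < Pinf) (hM : 0 < M) (hγ : 0 < γ)
    (hcond :
      ((2 * (n : ℝ) - 2) / (n : ℝ) < γ) ∨
      (γ = (2 * (n : ℝ) - 2) / (n : ℝ) ∧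
        G * (n : ℝ) ^ ((2 - (n : ℝ)) / (n : ℝ)) * M ^ ((2 : ℝ) / (n : ℝ)) < 2 * A) ∨
      (γ < (2 * (n : ℝ) - 2) / (n : ℝ) ∧
        Pinf + G / 2 * (n : ℝ) ^ ((2 - (n : ℝ)) / (n : ℝ)) * M ^ ((2 : ℝ) / (n : ℝ)) *
            (delta3 n A G M γ) ^ ((2 * (n : ℝ) - 2) / (n : ℝ))
          ≤ A * (delta3 n A G M γ) ^ γ)) :
    ∃ ρ : ℝ → ℝ, ContinuousOn ρ (Set.Icc 0 M) ∧
      (∀ x ∈ Set.Icc (0 : ℝ) M, (Pinf / A) ^ (1 / γ) ≤ ρ x) ∧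
      (∀ x ∈ Set.Icc (0 : ℝ) M,
        A * ρ x ^ γ = Pinf +
          ∫ y in x..M,
            G * y / (((n : ℝ) * ∫ z in (0 : ℝ)..y, (ρ z)⁻¹) ^ ((1 : ℝ) / (n : ℝ))) ^
              (2 * n - 2)) := by
  have hn0 : (0 : ℝ) < n := by positivity
  have hn2 : (2 : ℝ) ≤ n := by exact_mod_cast hn
  have hn1 : (0 : ℝ) < 2 * (n : ℝ) - 2 := by linarith
  obtain ⟨d, hd, hsuper⟩ : ∃ d : ℝ, 0 < d ∧
      Pinf + G / 2 * (n : ℝ) ^ ((2 - (n : ℝ)) / n) * M ^ ((2 : ℝ) / n) *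
        d ^ ((2 * (n : ℝ) - 2) / n) ≤ A * d ^ γ := by
    rcases hcond with h | ⟨h, hK⟩ | ⟨-, h⟩
    · exact exists_constant_supersolution hA hPinf (by positivity) (by positivity) hγ (Or.inl h)
    · exact exists_constant_supersolution hA hPinf (by positivity) (by positivity) hγ
        (Or.inr ⟨h, by linarith⟩)
    · refine ⟨_, ?_, h⟩
      have : (0 : ℝ) < (n : ℝ) - 1 := by linarith
      unfold delta3
      positivity
  exact exists_stationary_of_supersolution hn hA hG hPinf hM hγ hd hsuper
end

section
/- Let n ≥ 2 be an integer, A, G, P∞, M > 0, γ > 1. A function V in K₂ = {f ∈ C¹([0,M]) : f(0) = 0, min f_x > 0} is a point of local quadratic minimum of the static potential energy S if and only if V solves the boundary-value problem (A V_x^(−γ))_x = −G x n^((2−2n)/n) V^((2−2n)/n) on (0,M) with V(0) = 0 and V_x(M) = (A/P∞)^(1/γ), and V satisfies the static stability condition, i.e. there exists δ₃ > 0 such that J_V[W] ≥ δ₃(‖W_x‖²_{L²(0,M)} + ‖x^(−1)W‖²_{L²(0,M)}) for all W ∈ K₁. -/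
open MeasureTheory intervalIntegral Set

/-- `f` is `C¹` on `[0,M]` with derivative `f'`. -/
def IsC1On (f f' : ℝ → ℝ) (M : ℝ) : Prop :=
  (∀ x ∈ Set.Icc (0 : ℝ) M, HasDerivWithinAt f (f' x) (Set.Icc 0 M) x) ∧
    ContinuousOn f' (Set.Icc (0 : ℝ) M)

/-- The static potential energy
`S[V] = ∫_0^M [ (A/(γ−1)) V_x^(1−γ) + P∞ V_x + ∫_1^V G x (nh)^((2−2n)/n) dh ] dx`,
written as a functional of `V` and its derivative `V'`. -/
noncomputable def Sfun (n : ℕ) (A G Pinf M γ : ℝ) (V V' : ℝ → ℝ) : ℝ :=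
  ∫ x in (0 : ℝ)..M,
    (A / (γ - 1) * (V' x) ^ (1 - γ) + Pinf * V' x +
      ∫ h in (1 : ℝ)..(V x), G * x * ((n : ℝ) * h) ^ ((2 - 2 * (n : ℝ)) / (n : ℝ)))

/-- The second-variation functional
`J_V[W] = ∫_0^M [ γ A V_x^(−1−γ) W_x² − (2n−2) G x (nV)^((2−3n)/n) W² ] dx`. -/
noncomputable def Jfun (n : ℕ) (A G M γ : ℝ) (V V' W W' : ℝ → ℝ) : ℝ :=
  ∫ x in (0 : ℝ)..M,
    (γ * A * (V' x) ^ (-(1 + γ)) * (W' x) ^ 2 -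
      (2 * (n : ℝ) - 2) * G * x * ((n : ℝ) * V x) ^ ((2 - 3 * (n : ℝ)) / (n : ℝ)) * (W x) ^ 2)

/-- The weighted quadratic norm `‖W_x‖²_{L²(0,M)} + ‖x⁻¹ W‖²_{L²(0,M)}`. -/
noncomputable def Qnorm (M : ℝ) (W W' : ℝ → ℝ) : ℝ :=
  (∫ x in (0 : ℝ)..M, (W' x) ^ 2) + ∫ x in (0 : ℝ)..M, (W x / x) ^ 2

/-- A function vanishing at `0` whose derivative is `O(|u|^k)` is `O(|u|^(k+1))`. -/
lemma abs_le_mul_pow_succ {F F' : ℝ → ℝ} {r C : ℝ} {k : ℕ} (hC : 0 ≤ C) (h0 : F 0 = 0)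
    (hd : ∀ u, |u| ≤ r → HasDerivAt F (F' u) u)
    (hb : ∀ u, |u| ≤ r → |F' u| ≤ C * |u| ^ k) :
    ∀ u, |u| ≤ r → |F u| ≤ C * |u| ^ (k + 1) := by
  intro u hu
  have key : ∀ y ∈ Set.uIcc 0 u, |y| ≤ |u| := fun y hy => by
    simpa using Set.abs_sub_left_of_mem_uIcc hy
  have := (convex_uIcc (0 : ℝ) u).norm_image_sub_le_of_norm_hasDerivWithin_le (f := F) (f' := F')
    (C := C * |u| ^ k)
    (fun y hy => (hd y ((key y hy).trans hu)).hasDerivWithinAt)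
    (fun y hy => (hb y ((key y hy).trans hu)).trans 
      (mul_le_mul_of_nonneg_left (pow_le_pow_left₀ (abs_nonneg _) (key y hy) k) hC))
    Set.left_mem_uIcc Set.right_mem_uIcc
  simpa [h0, pow_succ, mul_assoc] using this

/-- Second-order Taylor expansion of a primitive of `h ^ s`, with homogeneous remainder. -/
lemma abs_primitive_rpow_taylor {P : ℝ → ℝ} {s v w : ℝ} (hs : s ≤ 0)
    (hP : ∀ h, 0 < h → HasDerivAt P (h ^ s) h) (hv : 0 < v) (hw : |w| ≤ v / 2) :
    |P (v + w) - P v - v ^ s * w - s / 2 * v ^ (s - 1) * w ^ 2| ≤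
      |s * (s - 1)| * (v / 2) ^ (s - 2) * |w| ^ 3 := by
  have hpos : ∀ u, |u| ≤ v / 2 → v / 2 ≤ v + u := fun u hu => by
    have := (abs_le.1 hu).1
    linarith
  have hpos' : ∀ u, |u| ≤ v / 2 → 0 < v + u := fun u hu => by
    have := hpos u hu
    linarith
  have hC : 0 ≤ |s * (s - 1)| * (v / 2) ^ (s - 2) := by positivity
  have hadd : ∀ u, HasDerivAt (fun u : ℝ => v + u) 1 u := fun u => (hasDerivAt_id u).const_add v
  have h2 : ∀ u, |u| ≤ v / 2 → |s * ((v + u) ^ (s - 1) - v ^ (s - 1))| ≤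
      |s * (s - 1)| * (v / 2) ^ (s - 2) * |u| ^ 1 := by
    refine abs_le_mul_pow_succ (F' := fun u => s * (s - 1) * (v + u) ^ (s - 2)) (k := 0) hC
      (by simp) ?_ ?_
    · intro u hu
      have := (((hadd u).rpow_const (p := s - 1) (Or.inl (hpos' u hu).ne')).sub_const
        (v ^ (s - 1))).const_mul s
      refine this.congr_deriv ?_
      rw [show s - 1 - 1 = s - 2 by ring]
      ring
    · intro u hu
      rw [abs_mul, abs_of_pos (Real.rpow_pos_of_pos (hpos' u hu) _), pow_zero, mul_one]
      exact mul_le_mul_of_nonneg_left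
        (Real.rpow_le_rpow_of_nonpos (by positivity) (hpos u hu) (by linarith)) (abs_nonneg _)
  have h1 : ∀ u, |u| ≤ v / 2 → |(v + u) ^ s - v ^ s - s * v ^ (s - 1) * u| ≤
      |s * (s - 1)| * (v / 2) ^ (s - 2) * |u| ^ 2 := by
    refine abs_le_mul_pow_succ (F' := fun u => s * ((v + u) ^ (s - 1) - v ^ (s - 1))) hC
      (by simp) ?_ h2
    intro u hu
    have := (((hadd u).rpow_const (p := s) (Or.inl (hpos' u hu).ne')).sub_const (v ^ s)).sub
      ((hasDerivAt_id u).const_mul (s * v ^ (s - 1)))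
    refine this.congr_deriv ?_
    ring
  refine abs_le_mul_pow_succ
    (F := fun w => P (v + w) - P v - v ^ s * w - s / 2 * v ^ (s - 1) * w ^ 2)
    (F' := fun u => (v + u) ^ s - v ^ s - s * v ^ (s - 1) * u) hC (by simp) ?_ h1 w hw
  intro u hu
  have := ((((hP _ (hpos' u hu)).comp u (hadd u)).sub_const (P v)).sub
    ((hasDerivAt_id u).const_mul (v ^ s))).sub
    (((hasDerivAt_id u).pow 2).const_mul (s / 2 * v ^ (s - 1)))
  refine this.congr_deriv ?_
  simp
  ring

lemma hasDerivAt_integral_rpow (s : ℝ) {v : ℝ} (hv : 0 < v) :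
    HasDerivAt (fun y => ∫ h in (1 : ℝ)..y, h ^ s) (v ^ s) v := by
  have hc : ContinuousOn (fun h : ℝ => h ^ s) (Set.Ioi 0) := fun x hx =>
    (Real.continuousAt_rpow_const x s (Or.inl (ne_of_gt hx))).continuousWithinAt
  refine intervalIntegral.integral_hasDerivAt_right ?_ ?_ ?_
  · refine (hc.mono fun x hx => ?_).intervalIntegrable
    exact lt_of_lt_of_le (lt_min one_pos hv) hx.1
  · exact hc.stronglyMeasurableAtFilter isOpen_Ioi v hv
  · exact Real.continuousAt_rpow_const v s (Or.inl hv.ne')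

lemma abs_integral_rpow_le {s v : ℝ} (hs : s ≤ 0) (hv : 0 < v) :
    |∫ h in (1 : ℝ)..v, h ^ s| ≤ v ^ s + v := by
  have hvs := Real.rpow_pos_of_pos hv s
  rcases le_total v 1 with h | h
  · have := intervalIntegral.norm_integral_le_of_norm_le_const (a := 1) (b := v) (C := v ^ s)
      (f := fun h : ℝ => h ^ s) (fun t ht => by
        rw [Set.uIoc_of_ge h] at ht
        rw [Real.norm_of_nonneg (Real.rpow_nonneg (hv.trans ht.1).le _)]
        exact Real.rpow_le_rpow_of_nonpos hv ht.1.le hs)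
    rw [Real.norm_eq_abs, abs_of_nonpos (by linarith : v - 1 ≤ 0)] at this
    nlinarith
  · have := intervalIntegral.norm_integral_le_of_norm_le_const (a := 1) (b := v) (C := 1)
      (f := fun h : ℝ => h ^ s) (fun t ht => by
        rw [Set.uIoc_of_le h] at ht
        rw [Real.norm_of_nonneg (Real.rpow_nonneg (by linarith [ht.1]) _)]
        exact Real.rpow_le_one_of_one_le_of_nonpos ht.1.le hs)
    rw [Real.norm_eq_abs, abs_of_nonneg (by linarith : 0 ≤ v - 1)] at this
    linarith

lemma intervalIntegrable_of_abs_le_rpow {f : ℝ → ℝ} {M r C D : ℝ} (hM : 0 < M) (hr : -1 < r)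
    (hf : ContinuousOn f (Set.Ioc 0 M)) (hb : ∀ x ∈ Set.Ioc 0 M, |f x| ≤ C * x ^ r + D) :
    IntervalIntegrable f volume 0 M := by
  have hg : IntervalIntegrable (fun x : ℝ => C * x ^ r + D) volume 0 M :=
    ((intervalIntegral.intervalIntegrable_rpow' hr).const_mul C).add (g := fun _ => D)
      (_root_.intervalIntegrable_const)
  refine hg.mono_fun' ?_ ?_
  · rw [Set.uIoc_of_le hM.le]
    exact hf.aestronglyMeasurable measurableSet_Ioc
  · rw [Set.uIoc_of_le hM.le]
    exact (ae_restrict_mem measurableSet_Ioc).mono fun x hx => hb x hx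

lemma intervalIntegrable_of_abs_le {f : ℝ → ℝ} {M D : ℝ} (hM : 0 < M)
    (hf : ContinuousOn f (Set.Ioc 0 M)) (hb : ∀ x ∈ Set.Ioc 0 M, |f x| ≤ D) :
    IntervalIntegrable f volume 0 M :=
  intervalIntegrable_of_abs_le_rpow (r := 0) (C := 0) (D := D) hM (by norm_num) hf
    fun x hx => by simpa using hb x hx

namespace IsC1On

variable {f f' : ℝ → ℝ} {M : ℝ}

lemma continuousOn (hf : IsC1On f f' M) : ContinuousOn f (Set.Icc 0 M) :=
  fun x hx => (hf.1 x hx).continuousWithinAt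

lemma hasDerivAt (hf : IsC1On f f' M) {x : ℝ} (hx : x ∈ Set.Ioo 0 M) : HasDerivAt f (f' x) x :=
  (hf.1 x ⟨hx.1.le, hx.2.le⟩).hasDerivAt (Icc_mem_nhds hx.1 hx.2)

lemma add {g g' : ℝ → ℝ} (hf : IsC1On f f' M) (hg : IsC1On g g' M) :
    IsC1On (fun x => f x + g x) (fun x => f' x + g' x) M :=
  ⟨fun x hx => (hf.1 x hx).add (hg.1 x hx), hf.2.add hg.2⟩

lemma const_mul (hf : IsC1On f f' M) (t : ℝ) :
    IsC1On (fun x => t * f x) (fun x => t * f' x) M :=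
  ⟨fun x hx => (hf.1 x hx).const_mul t, hf.2.const_smul t⟩

lemma abs_sub_le {c d : ℝ} (hf : IsC1On f f' M) (h0 : f 0 = 0)
    (hb : ∀ x ∈ Set.Icc 0 M, |f' x - c| ≤ d) :
    ∀ x ∈ Set.Icc 0 M, |f x - c * x| ≤ d * x := by
  intro x hx
  have := (convex_Icc (0 : ℝ) M).norm_image_sub_le_of_norm_hasDerivWithin_le
    (f := fun x => f x - c * x) (f' := fun x => f' x - c) (C := d)
    (fun y hy => ((hf.1 y hy).sub
      ((hasDerivWithinAt_id y (Set.Icc 0 M)).const_mul c)).congr_deriv (by simp))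
    hb (x := 0) (y := x) ⟨le_rfl, hx.1.trans hx.2⟩ hx
  simpa [h0, abs_of_nonneg hx.1] using this

lemma abs_le {d : ℝ} (hf : IsC1On f f' M) (h0 : f 0 = 0)
    (hb : ∀ x ∈ Set.Icc 0 M, |f' x| ≤ d) : ∀ x ∈ Set.Icc 0 M, |f x| ≤ d * x := by
  simpa using hf.abs_sub_le (c := 0) (d := d) h0 (by simpa using hb)

lemma mem_Icc_mul {m K : ℝ} (hf : IsC1On f f' M) (h0 : f 0 = 0)
    (hb : ∀ x ∈ Set.Icc 0 M, f' x ∈ Set.Icc m K) :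
    ∀ x ∈ Set.Icc 0 M, f x ∈ Set.Icc (m * x) (K * x) := by
  intro x hx
  have := hf.abs_sub_le (c := (K + m) / 2) (d := (K - m) / 2) h0
    (fun y hy => by rw [_root_.abs_le]; constructor <;> linarith [(hb y hy).1, (hb y hy).2]) x hx
  rw [_root_.abs_le] at this
  constructor <;> linarith [this.1, this.2]

lemma exists_abs_deriv_le (hf : IsC1On f f' M) : ∃ B, 0 < B ∧ ∀ x ∈ Set.Icc 0 M, |f' x| ≤ B := by
  obtain ⟨B, hB⟩ := isCompact_Icc.exists_bound_of_continuousOn hf.2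
  exact ⟨max B 1, by positivity, fun x hx => (hB x hx).trans (le_max_left _ _)⟩

lemma exists_deriv_mem_Icc (hf : IsC1On f f' M) (hM : 0 < M)
    (hpos : ∀ x ∈ Set.Icc 0 M, 0 < f' x) :
    ∃ m K, 0 < m ∧ ∀ x ∈ Set.Icc 0 M, f' x ∈ Set.Icc m K := by
  obtain ⟨x₀, hx₀, hmin⟩ := isCompact_Icc.exists_isMinOn (Set.nonempty_Icc.2 hM.le) hf.2
  obtain ⟨B, -, hB⟩ := hf.exists_abs_deriv_le
  exact ⟨f' x₀, B, hpos x₀ hx₀, fun x hx => ⟨hmin hx, (le_abs_self _).trans (hB x hx)⟩⟩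

end IsC1On

/-- The energy density as a function of position, value and slope. -/
noncomputable def energyDensity (A P γ c s x v p : ℝ) : ℝ :=
  A / (γ - 1) * p ^ (1 - γ) + P * p + c * x * ∫ h in (1 : ℝ)..v, h ^ s

/-- The first variation density of the energy. -/
noncomputable def firstDensity (A P γ c s x v p w q : ℝ) : ℝ :=
  (P - A * p ^ (-γ)) * q + c * x * v ^ s * w

/-- The second variation density of the energy. -/
noncomputable def secondDensity (A γ c s x v p w q : ℝ) : ℝ :=
  γ * A * p ^ (-(1 + γ)) * q ^ 2 + s * (c * x * v ^ (s - 1) * w ^ 2)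

/-- The constant in the third-order Taylor estimate of the energy. -/
noncomputable def taylorConst (A γ c s m M : ℝ) : ℝ :=
  A * (|-γ * (-γ - 1)| * (m / 2) ^ (-γ - 2)) +
    c * (|s * (s - 1)| * (m / 2) ^ (s - 2) * M ^ (s + 2))

lemma taylorConst_nonneg {A γ c s m M : ℝ} (hA : 0 ≤ A) (hc : 0 ≤ c) (hm : 0 < m) (hM : 0 < M) :
    0 ≤ taylorConst A γ c s m M := by
  unfold taylorConst
  positivity

lemma abs_energyDensity_taylor {A P γ c s m M x v p w q δ : ℝ} (hA : 0 ≤ A) (hγ : 1 < γ)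
    (hc : 0 ≤ c) (hs : -2 < s) (hs0 : s ≤ 0) (hm : 0 < m) (hx : x ∈ Set.Ioc 0 M)
    (hp : m ≤ p) (hv : m * x ≤ v) (hq : |q| ≤ δ) (hw : |w| ≤ δ * x) (hδ : δ ≤ m / 2) :
    |energyDensity A P γ c s x (v + w) (p + q) - energyDensity A P γ c s x v p -
        firstDensity A P γ c s x v p w q - 1 / 2 * secondDensity A γ c s x v p w q| ≤
      taylorConst A γ c s m M * δ * (q ^ 2 + (w / x) ^ 2) := by
  have hx0 : 0 < x := hx.1
  have hδ0 : 0 ≤ δ := (abs_nonneg _).trans hq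
  have hp0 : 0 < p := hm.trans_le hp
  have hmx : 0 < m * x := mul_pos hm hx0
  have hv0 : 0 < v := hmx.trans_le hv
  have hP : ∀ h : ℝ, 0 < h → HasDerivAt (fun h => -(h ^ (1 - γ) / (γ - 1))) (h ^ (-γ)) h := by
    intro h hh
    have := ((Real.hasDerivAt_rpow_const (p := 1 - γ) (Or.inl hh.ne')).div_const (γ - 1)).neg
    refine this.congr_deriv ?_
    rw [show 1 - γ - 1 = -γ by ring]
    have : γ - 1 ≠ 0 := by linarith
    field_simp
    ring
  have h1 := abs_primitive_rpow_taylor (w := q) (by linarith : -γ ≤ 0) hP hp0 (by linarith)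
  have h2 := abs_primitive_rpow_taylor (v := v) (w := w) hs0
    (fun h hh => hasDerivAt_integral_rpow s hh) hv0 (by nlinarith)
  have h1' : |-γ * (-γ - 1)| * (p / 2) ^ (-γ - 2) * |q| ^ 3 ≤
      |-γ * (-γ - 1)| * (m / 2) ^ (-γ - 2) * (δ * q ^ 2) := by
    have e : |q| ^ 3 = |q| * q ^ 2 := by rw [← sq_abs q]; ring
    rw [e]
    have : (p / 2) ^ (-γ - 2) ≤ (m / 2) ^ (-γ - 2) :=
      Real.rpow_le_rpow_of_nonpos (by positivity) (by linarith) (by linarith)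
    gcongr
  have h2' : |s * (s - 1)| * (v / 2) ^ (s - 2) * |w| ^ 3 * x ≤
      |s * (s - 1)| * (m / 2) ^ (s - 2) * M ^ (s + 2) * (δ * (w / x) ^ 2) := by
    have e : |w| ^ 3 = |w| * w ^ 2 := by rw [← sq_abs w]; ring
    have e1 : (v / 2) ^ (s - 2) ≤ (m / 2) ^ (s - 2) * x ^ (s - 2) := by
      rw [← Real.mul_rpow (by positivity) hx0.le]
      exact Real.rpow_le_rpow_of_nonpos (by positivity) (by linarith) (by linarith)
    have e2 : x ^ (s + 2) ≤ M ^ (s + 2) := Real.rpow_le_rpow hx0.le hx.2 (by linarith)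
    have e3 : x ^ (s + 2) = x ^ (s - 2) * x ^ 4 := by
      rw [← Real.rpow_natCast x 4, ← Real.rpow_add hx0]
      congr 1
      push_cast
      ring
    calc |s * (s - 1)| * (v / 2) ^ (s - 2) * |w| ^ 3 * x
        ≤ |s * (s - 1)| * ((m / 2) ^ (s - 2) * x ^ (s - 2)) * (δ * x * w ^ 2) * x := by
          rw [e]; gcongr
      _ = |s * (s - 1)| * (m / 2) ^ (s - 2) * x ^ (s + 2) * (δ * (w / x) ^ 2) := by
          rw [e3]; field_simp
      _ ≤ _ := by gcongr
  have key : energyDensity A P γ c s x (v + w) (p + q) - energyDensity A P γ c s x v p -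
        firstDensity A P γ c s x v p w q - 1 / 2 * secondDensity A γ c s x v p w q =
      -A * (-((p + q) ^ (1 - γ) / (γ - 1)) - -(p ^ (1 - γ) / (γ - 1)) - p ^ (-γ) * q -
        -γ / 2 * p ^ (-γ - 1) * q ^ 2) +
      c * x * ((∫ h in (1 : ℝ)..(v + w), h ^ s) - (∫ h in (1 : ℝ)..v, h ^ s) - v ^ s * w -
        s / 2 * v ^ (s - 1) * w ^ 2) := by
    unfold energyDensity firstDensity secondDensity
    rw [show -(1 + γ) = -γ - 1 by ring]
    ring
  rw [key]
  refine (abs_add_le _ _).trans ?_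
  rw [abs_mul, abs_mul (c * x), abs_neg, abs_of_nonneg hA, abs_of_nonneg (mul_nonneg hc hx0.le)]
  have i1 := mul_le_mul_of_nonneg_left (h1.trans h1') hA
  have i2 := mul_le_mul_of_nonneg_left h2 (mul_nonneg hc hx0.le)
  have i3 := mul_le_mul_of_nonneg_left h2' hc
  have i4 : 0 ≤ A * (|-γ * (-γ - 1)| * (m / 2) ^ (-γ - 2)) * (δ * (w / x) ^ 2) := by positivity
  have hM0 : 0 < M := hx0.trans_le hx.2
  have i5 : 0 ≤ c * (|s * (s - 1)| * (m / 2) ^ (s - 2) * M ^ (s + 2)) * (δ * q ^ 2) := by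
    positivity
  unfold taylorConst
  linarith

/-- `V` is `C¹` on `[0,M]`, vanishes at `0`, and has slope between `m` and `K`. -/
structure IsProfile (V V' : ℝ → ℝ) (M m K : ℝ) : Prop where
  isC1On : IsC1On V V' M
  map_zero : V 0 = 0
  pos : 0 < m
  deriv_mem : ∀ x ∈ Set.Icc 0 M, V' x ∈ Set.Icc m K

namespace IsProfile

variable {V V' : ℝ → ℝ} {M m K : ℝ}

lemma add (hV : IsProfile V V' M m K) {W W' : ℝ → ℝ} {δ : ℝ} (hW : IsC1On W W' M)
    (hW0 : W 0 = 0) (hδ : δ ≤ m / 2) (hWδ : ∀ x ∈ Set.Icc 0 M, |W' x| ≤ δ) :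
    IsProfile (fun x => V x + W x) (fun x => V' x + W' x) M (m / 2) (K + δ) where
  isC1On := hV.isC1On.add hW
  map_zero := by simp [hV.map_zero, hW0]
  pos := half_pos hV.pos
  deriv_mem x hx := by
    have h1 := hV.deriv_mem x hx
    have h2 := abs_le.1 (hWδ x hx)
    exact ⟨by linarith [h1.1, h2.1], by linarith [h1.2, h2.2]⟩

lemma mem_Icc_mul (hV : IsProfile V V' M m K) :
    ∀ x ∈ Set.Icc 0 M, V x ∈ Set.Icc (m * x) (K * x) :=
  hV.isC1On.mem_Icc_mul hV.map_zero hV.deriv_mem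

lemma pos_of_mem_Ioc (hV : IsProfile V V' M m K) {x : ℝ} (hx : x ∈ Set.Ioc 0 M) : 0 < V x :=
  (mul_pos hV.pos hx.1).trans_le (hV.mem_Icc_mul x ⟨hx.1.le, hx.2⟩).1

lemma deriv_pos (hV : IsProfile V V' M m K) {x : ℝ} (hx : x ∈ Set.Icc 0 M) : 0 < V' x :=
  hV.pos.trans_le (hV.deriv_mem x hx).1

lemma continuousOn_deriv_rpow (hV : IsProfile V V' M m K) (r : ℝ) :
    ContinuousOn (fun x => V' x ^ r) (Set.Icc 0 M) :=
  hV.isC1On.2.rpow_const fun _ hx => Or.inl (hV.deriv_pos hx).ne'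

lemma continuousOn_rpow (hV : IsProfile V V' M m K) (r : ℝ) :
    ContinuousOn (fun x => V x ^ r) (Set.Ioc 0 M) :=
  (hV.isC1On.continuousOn.mono Set.Ioc_subset_Icc_self).rpow_const
    fun _ hx => Or.inl (hV.pos_of_mem_Ioc hx).ne'

lemma rpow_le (hV : IsProfile V V' M m K) {r x : ℝ} (hr : r ≤ 0) (hx : x ∈ Set.Ioc 0 M) :
    V x ^ r ≤ m ^ r * x ^ r := by
  rw [← Real.mul_rpow hV.pos.le hx.1.le]
  exact Real.rpow_le_rpow_of_nonpos (mul_pos hV.pos hx.1)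
    (hV.mem_Icc_mul x ⟨hx.1.le, hx.2⟩).1 hr

lemma intervalIntegrable_force (hV : IsProfile V V' M m K) {c s : ℝ} (hM : 0 < M) (hc : 0 ≤ c)
    (hs : -2 < s) (hs0 : s ≤ 0) :
    IntervalIntegrable (fun x => c * x * V x ^ s) volume 0 M := by
  refine intervalIntegrable_of_abs_le_rpow (r := s + 1) (C := c * m ^ s) (D := 0) hM
    (by linarith) ((continuousOn_const.mul continuousOn_id).mul (hV.continuousOn_rpow s)) ?_
  intro x hx
  have hx0 : 0 < x := hx.1
  have h := Real.rpow_nonneg (hV.pos_of_mem_Ioc hx).le s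
  rw [abs_of_nonneg (by positivity), Real.rpow_add_one hx0.ne']
  have := mul_le_mul_of_nonneg_left (hV.rpow_le hs0 hx) (mul_nonneg hc hx0.le)
  linarith

lemma intervalIntegrable_energyDensity (hV : IsProfile V V' M m K) {A P γ c s : ℝ} (hM : 0 < M)
    (hc : 0 ≤ c) (hs : -2 < s) (hs0 : s ≤ 0) :
    IntervalIntegrable (fun x => energyDensity A P γ c s x (V x) (V' x)) volume 0 M := by
  unfold energyDensity
  refine IntervalIntegrable.add ?_ ?_
  · refine ContinuousOn.intervalIntegrable ?_
    rw [Set.uIcc_of_le hM.le]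
    exact (continuousOn_const.mul (hV.continuousOn_deriv_rpow _)).add
      (continuousOn_const.mul hV.isC1On.2)
  · refine intervalIntegrable_of_abs_le_rpow (r := s + 1) (C := c * m ^ s) (D := c * M * (K * M))
      hM (by linarith) ((continuousOn_const.mul continuousOn_id).mul ?_) ?_
    · intro x hx
      exact (hasDerivAt_integral_rpow s (hV.pos_of_mem_Ioc hx)).continuousAt.comp_continuousWithinAt
        ((hV.isC1On.continuousOn.mono Set.Ioc_subset_Icc_self) x hx)
    · intro x hx
      have hx0 : 0 < x := hx.1
      have hVx := hV.pos_of_mem_Ioc hx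
      have hVK := (hV.mem_Icc_mul x ⟨hx.1.le, hx.2⟩).2
      have hK : 0 < K := pos_of_mul_pos_left (hVx.trans_le hVK) hx0.le
      have h1 := abs_integral_rpow_le hs0 hVx
      have h2 : V x ≤ K * M := hVK.trans (by gcongr; exact hx.2)
      have h3 : c * x * V x ≤ c * M * (K * M) := by
        have := hx.2
        gcongr
      have h4 := mul_le_mul_of_nonneg_left (h1.trans (add_le_add_left (hV.rpow_le hs0 hx) _))
        (mul_nonneg hc hx0.le)
      rw [abs_mul, abs_of_nonneg (mul_nonneg hc hx0.le), Real.rpow_add_one hx0.ne']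
      linarith

lemma intervalIntegrable_firstDensity (hV : IsProfile V V' M m K) {W W' : ℝ → ℝ}
    (hW : IsC1On W W' M) {A P γ c s : ℝ} (hM : 0 < M)
    (hc : 0 ≤ c) (hs : -2 < s) (hs0 : s ≤ 0) :
    IntervalIntegrable (fun x => firstDensity A P γ c s x (V x) (V' x) (W x) (W' x))
      volume 0 M := by
  unfold firstDensity
  refine IntervalIntegrable.add ?_ ?_
  · refine ContinuousOn.intervalIntegrable ?_
    rw [Set.uIcc_of_le hM.le]
    exact (continuousOn_const.sub (continuousOn_const.mul (hV.continuousOn_deriv_rpow _))).mul hW.2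
  · refine (hV.intervalIntegrable_force hM hc hs hs0).mul_continuousOn ?_
    rw [Set.uIcc_of_le hM.le]
    exact hW.continuousOn

lemma intervalIntegrable_secondDensity (hV : IsProfile V V' M m K) {W W' : ℝ → ℝ}
    (hW : IsC1On W W' M) (hW0 : W 0 = 0) {A γ c s : ℝ} (hM : 0 < M)
    (hc : 0 ≤ c) (hs : -2 < s) (hs0 : s ≤ 0) :
    IntervalIntegrable (fun x => secondDensity A γ c s x (V x) (V' x) (W x) (W' x))
      volume 0 M := by
  unfold secondDensity
  refine IntervalIntegrable.add ?_ (IntervalIntegrable.const_mul ?_ _)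
  · refine ContinuousOn.intervalIntegrable ?_
    rw [Set.uIcc_of_le hM.le]
    exact (continuousOn_const.mul (hV.continuousOn_deriv_rpow _)).mul (hW.2.pow 2)
  · obtain ⟨B, hB0, hB⟩ := hW.exists_abs_deriv_le
    refine intervalIntegrable_of_abs_le_rpow (r := s + 2) (C := c * m ^ (s - 1) * B ^ 2) (D := 0)
      hM (by linarith) (((continuousOn_const.mul continuousOn_id).mul
        (hV.continuousOn_rpow _)).mul
        ((hW.continuousOn.mono Set.Ioc_subset_Icc_self).pow 2)) ?_
    intro x hx
    have hx0 : 0 < x := hx.1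
    have h := Real.rpow_nonneg (hV.pos_of_mem_Ioc hx).le (s - 1)
    have h1 : W x ^ 2 ≤ (B * x) ^ 2 :=
      sq_le_sq.2 ((hW.abs_le hW0 hB x ⟨hx.1.le, hx.2⟩).trans (le_abs_self _))
    have h2 := hV.rpow_le (by linarith : s - 1 ≤ 0) hx
    have e3 : x ^ (s + 2) = x ^ (s - 1) * x ^ 3 := by
      rw [← Real.rpow_natCast x 3, ← Real.rpow_add hx0]
      congr 1
      push_cast
      ring
    have hm := hV.pos
    rw [abs_of_nonneg (by positivity)]
    calc c * x * V x ^ (s - 1) * W x ^ 2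
        ≤ c * x * (m ^ (s - 1) * x ^ (s - 1)) * (B * x) ^ 2 := by gcongr
      _ = _ := by rw [e3]; ring

end IsProfile

lemma IsC1On.intervalIntegrable_deriv_sq {W W' : ℝ → ℝ} {M : ℝ} (hW : IsC1On W W' M)
    (hM : 0 < M) : IntervalIntegrable (fun x => W' x ^ 2) volume 0 M := by
  refine ContinuousOn.intervalIntegrable ?_
  rw [Set.uIcc_of_le hM.le]
  exact hW.2.pow 2

lemma IsC1On.intervalIntegrable_div_sq {W W' : ℝ → ℝ} {M : ℝ} (hW : IsC1On W W' M)
    (hW0 : W 0 = 0) (hM : 0 < M) : IntervalIntegrable (fun x => (W x / x) ^ 2) volume 0 M := by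
  obtain ⟨B, hB0, hB⟩ := hW.exists_abs_deriv_le
  refine intervalIntegrable_of_abs_le (D := B ^ 2) hM
    (((hW.continuousOn.mono Set.Ioc_subset_Icc_self).div continuousOn_id
      fun x hx => hx.1.ne').pow 2) ?_
  intro x hx
  rw [abs_pow, abs_div, abs_of_pos hx.1]
  have := (div_le_iff₀ hx.1).2 (hW.abs_le hW0 hB x ⟨hx.1.le, hx.2⟩)
  have hx0 : 0 < x := hx.1
  gcongr

lemma Qnorm_nonneg {M : ℝ} (hM : 0 < M) (W W' : ℝ → ℝ) : 0 ≤ Qnorm M W W' :=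
  add_nonneg (intervalIntegral.integral_nonneg hM.le fun _ _ => sq_nonneg _)
    (intervalIntegral.integral_nonneg hM.le fun _ _ => sq_nonneg _)

/-- Third-order Taylor estimate for the total energy. -/
lemma IsProfile.abs_integral_energyDensity_taylor {V V' W W' : ℝ → ℝ} {A P γ c s m K M δ : ℝ}
    (hV : IsProfile V V' M m K) (hW : IsC1On W W' M) (hW0 : W 0 = 0) (hM : 0 < M)
    (hA : 0 ≤ A) (hγ : 1 < γ) (hc : 0 ≤ c) (hs : -2 < s) (hs0 : s ≤ 0)
    (hδ : δ ≤ m / 2) (hWδ : ∀ x ∈ Set.Icc 0 M, |W' x| ≤ δ) :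
    |(∫ x in (0 : ℝ)..M, energyDensity A P γ c s x (V x + W x) (V' x + W' x)) -
        (∫ x in (0 : ℝ)..M, energyDensity A P γ c s x (V x) (V' x)) -
        (∫ x in (0 : ℝ)..M, firstDensity A P γ c s x (V x) (V' x) (W x) (W' x)) -
        1 / 2 * ∫ x in (0 : ℝ)..M, secondDensity A γ c s x (V x) (V' x) (W x) (W' x)| ≤
      taylorConst A γ c s m M * δ * Qnorm M W W' := by
  have hVW := hV.add hW hW0 hδ hWδ
  have i1 := hVW.intervalIntegrable_energyDensity (A := A) (P := P) (γ := γ) hM hc hs hs0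
  have i2 := hV.intervalIntegrable_energyDensity (A := A) (P := P) (γ := γ) hM hc hs hs0
  have i3 := hV.intervalIntegrable_firstDensity hW (A := A) (P := P) (γ := γ) hM hc hs hs0
  have i4 := hV.intervalIntegrable_secondDensity hW hW0 (A := A) (γ := γ) hM hc hs hs0
  have i5 := hW.intervalIntegrable_deriv_sq hM
  have i6 := hW.intervalIntegrable_div_sq hW0 hM
  rw [← intervalIntegral.integral_sub i1 i2, ← intervalIntegral.integral_sub (i1.sub i2) i3,
    ← intervalIntegral.integral_const_mul,
    ← intervalIntegral.integral_sub ((i1.sub i2).sub i3) (i4.const_mul _), Qnorm,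
    ← intervalIntegral.integral_add i5 i6, ← intervalIntegral.integral_const_mul]
  rw [← Real.norm_eq_abs]
  refine intervalIntegral.norm_integral_le_of_norm_le (μ := volume) hM.le (Filter.Eventually.of_forall ?_)
    ((i5.add i6).const_mul _)
  intro x hx
  have hx' : x ∈ Set.Icc 0 M := ⟨hx.1.le, hx.2⟩
  exact abs_energyDensity_taylor hA hγ hc hs hs0 hV.pos hx (hV.deriv_mem x hx').1
    (hV.mem_Icc_mul x hx').1 (hWδ x hx') (hW.abs_le hW0 hWδ x hx') hδ

/-- The residual of the integrated equilibrium equation. -/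
noncomputable def equilibriumResidual (A P γ c s M : ℝ) (V V' : ℝ → ℝ) (x : ℝ) : ℝ :=
  P - A * V' x ^ (-γ) + ∫ t in x..M, c * t * V t ^ s

lemma mul_rpow_neg_eq_iff {A P γ p : ℝ} (hA : 0 < A) (hP : 0 < P) (hγ : 0 < γ) (hp : 0 < p) :
    A * p ^ (-γ) = P ↔ p = (A / P) ^ (1 / γ) := by
  rw [one_div, Real.eq_rpow_inv hp.le (by positivity) hγ.ne', Real.rpow_neg hp.le,
    eq_div_iff hP.ne', ← div_eq_mul_inv, div_eq_iff (Real.rpow_pos_of_pos hp γ).ne', eq_comm,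
    mul_comm]

namespace IsProfile

variable {V V' : ℝ → ℝ} {M m K A P γ c s : ℝ}

lemma continuousOn_integral_force (hV : IsProfile V V' M m K) (hM : 0 < M) (hc : 0 ≤ c)
    (hs : -2 < s) (hs0 : s ≤ 0) :
    ContinuousOn (fun x => ∫ t in x..M, c * t * V t ^ s) (Set.Icc 0 M) := by
  have h := hV.intervalIntegrable_force hM hc hs hs0
  rw [intervalIntegrable_iff_integrableOn_Icc_of_le hM.le, ← Set.uIcc_of_le hM.le] at h
  have := intervalIntegral.continuousOn_primitive_interval_left h
  rwa [Set.uIcc_of_le hM.le] at this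

lemma hasDerivAt_integral_force (hV : IsProfile V V' M m K) (hM : 0 < M) (hc : 0 ≤ c)
    (hs : -2 < s) (hs0 : s ≤ 0) {x : ℝ} (hx : x ∈ Set.Ioo 0 M) :
    HasDerivAt (fun x => ∫ t in x..M, c * t * V t ^ s) (-(c * x * V x ^ s)) x := by
  have hcont : ContinuousOn (fun t => c * t * V t ^ s) (Set.Ioo 0 M) :=
    ((continuousOn_const.mul continuousOn_id).mul (hV.continuousOn_rpow s)).mono
      Set.Ioo_subset_Ioc_self
  refine intervalIntegral.integral_hasDerivAt_left ?_
    (hcont.stronglyMeasurableAtFilter isOpen_Ioo x hx) (hcont.continuousAt (Ioo_mem_nhds hx.1 hx.2))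
  refine (hV.intervalIntegrable_force hM hc hs hs0).mono_set ?_
  rw [Set.uIcc_of_le hM.le, Set.uIcc_of_le hx.2.le]
  exact Set.Icc_subset_Icc_left hx.1.le

lemma continuousOn_residual (hV : IsProfile V V' M m K) (hM : 0 < M) (hc : 0 ≤ c)
    (hs : -2 < s) (hs0 : s ≤ 0) : ContinuousOn (equilibriumResidual A P γ c s M V V') (Set.Icc 0 M) :=
  (continuousOn_const.sub (continuousOn_const.mul (hV.continuousOn_deriv_rpow _))).add
    (hV.continuousOn_integral_force hM hc hs hs0)

lemma integral_firstDensity (hV : IsProfile V V' M m K) {W W' : ℝ → ℝ} (hW : IsC1On W W' M)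
    (hW0 : W 0 = 0) (hM : 0 < M) (hc : 0 ≤ c) (hs : -2 < s) (hs0 : s ≤ 0) :
    ∫ x in (0 : ℝ)..M, firstDensity A P γ c s x (V x) (V' x) (W x) (W' x) =
      ∫ x in (0 : ℝ)..M, equilibriumResidual A P γ c s M V V' x * W' x := by
  have i1 : IntervalIntegrable (fun x => equilibriumResidual A P γ c s M V V' x * W' x) volume 0 M := by
    refine ContinuousOn.intervalIntegrable ?_
    rw [Set.uIcc_of_le hM.le]
    exact (hV.continuousOn_residual hM hc hs hs0).mul hW.2
  have i2 := hV.intervalIntegrable_firstDensity hW (A := A) (P := P) (γ := γ) hM hc hs hs0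
  have hftc := intervalIntegral.integral_eq_sub_of_hasDerivAt_of_le hM.le
    (f := fun x => (∫ t in x..M, c * t * V t ^ s) * W x)
    (f' := fun x => equilibriumResidual A P γ c s M V V' x * W' x -
      firstDensity A P γ c s x (V x) (V' x) (W x) (W' x))
    ((hV.continuousOn_integral_force hM hc hs hs0).mul hW.continuousOn)
    (fun x hx => ((hV.hasDerivAt_integral_force hM hc hs hs0 hx).mul (hW.hasDerivAt hx)).congr_deriv
      (by unfold equilibriumResidual firstDensity; ring))
    (i1.sub i2)
  rw [intervalIntegral.integral_sub i1 i2] at hftc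
  simp only [intervalIntegral.integral_same, hW0] at hftc
  linarith

lemma residual_eq_zero_iff (hV : IsProfile V V' M m K) (hM : 0 < M) (hA : 0 < A) (hP : 0 < P)
    (hγ : 1 < γ) (hc : 0 ≤ c) (hs : -2 < s) (hs0 : s ≤ 0) :
    (∀ x ∈ Set.Icc 0 M, equilibriumResidual A P γ c s M V V' x = 0) ↔
      (∀ x ∈ Set.Ioo 0 M, HasDerivAt (fun y => A * V' y ^ (-γ)) (-(c * x * V x ^ s)) x) ∧
        V' M = (A / P) ^ (1 / γ) := by
  have hMM : M ∈ Set.Icc 0 M := ⟨hM.le, le_rfl⟩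
  have hres : equilibriumResidual A P γ c s M V V' M = P - A * V' M ^ (-γ) := by simp [equilibriumResidual]
  rw [← mul_rpow_neg_eq_iff hA hP (by linarith) (hV.deriv_pos hMM)]
  constructor
  · intro h
    refine ⟨fun x hx => ?_, by linarith [h M hMM]⟩
    refine ((hV.hasDerivAt_integral_force hM hc hs hs0 hx).const_add P).congr_of_eventuallyEq ?_
    filter_upwards [Icc_mem_nhds hx.1 hx.2] with y hy
    have := h y hy
    unfold equilibriumResidual at this
    linarith
  · rintro ⟨hode, hbc⟩ x hx
    rcases hx.2.eq_or_lt with rfl | hxM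
    · rw [hres, hbc, sub_self]
    · obtain ⟨y, hy, hslope⟩ := exists_hasDerivAt_eq_slope (equilibriumResidual A P γ c s M V V')
        (fun _ => 0) hxM ((hV.continuousOn_residual hM hc hs hs0).mono
          (Set.Icc_subset_Icc_left hx.1)) (fun y hy => by
            have hy' : y ∈ Set.Ioo 0 M := ⟨hx.1.trans_lt hy.1, hy.2⟩
            exact (((hode y hy').const_sub P).add
              (hV.hasDerivAt_integral_force hM hc hs hs0 hy')).congr_deriv (by ring))
      have hne : M - x ≠ 0 := by linarith
      rw [eq_div_iff hne, hres, hbc] at hslope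
      linarith

/-- The fundamental lemma of the calculus of variations for the energy. -/
lemma residual_eq_zero_of_firstVariation (hV : IsProfile V V' M m K) (hM : 0 < M)
    (hc : 0 ≤ c) (hs : -2 < s) (hs0 : s ≤ 0)
    (h : ∀ W W' : ℝ → ℝ, IsC1On W W' M → W 0 = 0 →
      ∫ x in (0 : ℝ)..M, firstDensity A P γ c s x (V x) (V' x) (W x) (W' x) = 0) :
    ∀ x ∈ Set.Icc 0 M, equilibriumResidual A P γ c s M V V' x = 0 := by
  have hcont := hV.continuousOn_residual (A := A) (P := P) (γ := γ) hM hc hs hs0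
  set ψ := Set.IccExtend hM.le ((Set.Icc 0 M).domRestrict (equilibriumResidual A P γ c s M V V')) with hψ
  have hψc : Continuous ψ := hcont.domRestrict.Icc_extend'
  have hψe : ∀ x ∈ Set.Icc 0 M, ψ x = equilibriumResidual A P γ c s M V V' x := fun x hx =>
    Set.IccExtend_of_mem hM.le _ hx
  have hW : IsC1On (fun x => ∫ t in (0 : ℝ)..x, ψ t) ψ M :=
    ⟨fun x _ => (hψc.integral_hasStrictDerivAt 0 x).hasDerivAt.hasDerivWithinAt,
      hψc.continuousOn⟩
  have h0 : ∫ x in (0 : ℝ)..M, ψ x ^ 2 = 0 := by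
    have h1 := h _ _ hW (by simp)
    rw [hV.integral_firstDensity hW (by simp) hM hc hs hs0] at h1
    refine (intervalIntegral.integral_congr fun x hx => ?_).trans h1
    rw [Set.uIcc_of_le hM.le] at hx
    simp only [← hψe x hx, sq]
  intro x hx
  by_contra hne
  rw [← hψe x hx] at hne
  exact (intervalIntegral.integral_pos hM (hψc.pow 2).continuousOn (fun _ _ => sq_nonneg _)
    ⟨x, hx, sq_pos_of_ne_zero hne⟩).ne' h0

end IsProfile

lemma nonneg_of_quadratic_nonneg {a b c t₀ : ℝ} (ht₀ : 0 < t₀)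
    (h : ∀ t, 0 < t → t ≤ t₀ → 0 ≤ a + b * t + c * t ^ 2) : 0 ≤ a := by
  have hc : Continuous fun t : ℝ => a + b * t + c * t ^ 2 := by fun_prop
  have ht : Filter.Tendsto (fun t : ℝ => a + b * t + c * t ^ 2) (nhdsWithin 0 (Set.Ioi 0))
      (nhds a) := by
    simpa using (hc.tendsto 0).mono_left nhdsWithin_le_nhds
  refine ge_of_tendsto ht ?_
  filter_upwards [Ioc_mem_nhdsGT ht₀] with t ht
  exact h t ht.1 ht.2

/-- Necessary conditions extracted from a quadratic lower bound on a third-order expansion. -/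
lemma eq_zero_and_le_of_expansion {L J C D t₀ : ℝ} (ht₀ : 0 < t₀)
    (h : ∀ t, |t| ≤ t₀ → D * t ^ 2 ≤ t * L + 1 / 2 * (t ^ 2 * J) + C * |t| ^ 3) :
    L = 0 ∧ 2 * D ≤ J := by
  have h1 : 0 ≤ L := nonneg_of_quadratic_nonneg (b := J / 2 - D) (c := C) ht₀ fun t ht htt => by
    have := h t (by rwa [abs_of_pos ht])
    rw [abs_of_pos ht] at this
    exact nonneg_of_mul_nonneg_right (by linarith : 0 ≤ t * _) ht
  have h2 : 0 ≤ -L := nonneg_of_quadratic_nonneg (b := J / 2 - D) (c := C) ht₀ fun t ht htt => by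
    have := h (-t) (by rwa [abs_neg, abs_of_pos ht])
    rw [abs_neg, abs_of_pos ht] at this
    exact nonneg_of_mul_nonneg_right (by linarith : 0 ≤ t * _) ht
  have hL : L = 0 := by linarith
  have h3 : 0 ≤ J / 2 - D := nonneg_of_quadratic_nonneg (b := C) (c := 0) ht₀ fun t ht htt => by
    have := h t (by rwa [abs_of_pos ht])
    rw [abs_of_pos ht, hL] at this
    exact nonneg_of_mul_nonneg_right (by linarith : 0 ≤ t ^ 2 * _) (by positivity)
  exact ⟨hL, by linarith⟩

lemma firstDensity_mul (A P γ c s x v p w q t : ℝ) :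
    firstDensity A P γ c s x v p (t * w) (t * q) = t * firstDensity A P γ c s x v p w q := by
  unfold firstDensity
  ring

lemma secondDensity_mul (A γ c s x v p w q t : ℝ) :
    secondDensity A γ c s x v p (t * w) (t * q) = t ^ 2 * secondDensity A γ c s x v p w q := by
  unfold secondDensity
  ring

lemma Qnorm_mul (M t : ℝ) (W W' : ℝ → ℝ) :
    Qnorm M (fun x => t * W x) (fun x => t * W' x) = t ^ 2 * Qnorm M W W' := by
  simp only [Qnorm, mul_pow, mul_div_assoc, intervalIntegral.integral_const_mul, mul_add]

lemma Sfun_eq_integral_energyDensity {n : ℕ} {A G P M γ m K : ℝ} {V V' : ℝ → ℝ}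
    (hM : 0 < M) (hV : IsProfile V V' M m K) :
    Sfun n A G P M γ V V' = ∫ x in (0 : ℝ)..M, energyDensity A P γ
      (G * (n : ℝ) ^ ((2 - 2 * (n : ℝ)) / n)) ((2 - 2 * (n : ℝ)) / n) x (V x) (V' x) := by
  refine intervalIntegral.integral_congr fun x hx => ?_
  rw [Set.uIcc_of_le hM.le] at hx
  unfold energyDensity
  simp only [add_right_inj]
  rw [← intervalIntegral.integral_const_mul]
  rcases hx.1.eq_or_lt with rfl | hx0
  · simp
  refine intervalIntegral.integral_congr fun h hh => ?_
  have hh0 : 0 ≤ h := (le_min zero_le_one (hV.pos_of_mem_Ioc ⟨hx0, hx.2⟩).le).trans hh.1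
  simp only [Real.mul_rpow n.cast_nonneg hh0]
  ring

lemma Jfun_eq_integral_secondDensity {n : ℕ} (hn : n ≠ 0) {A G M γ m K : ℝ} {V V' : ℝ → ℝ}
    (hM : 0 < M) (hV : IsProfile V V' M m K) (W W' : ℝ → ℝ) :
    Jfun n A G M γ V V' W W' = ∫ x in (0 : ℝ)..M, secondDensity A γ
      (G * (n : ℝ) ^ ((2 - 2 * (n : ℝ)) / n)) ((2 - 2 * (n : ℝ)) / n) x (V x) (V' x)
        (W x) (W' x) := by
  have hn0 : (0 : ℝ) < n := by exact_mod_cast Nat.pos_of_ne_zero hn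
  have he : (2 - 3 * (n : ℝ)) / n = (2 - 2 * (n : ℝ)) / n - 1 := by field_simp; ring
  refine intervalIntegral.integral_congr fun x hx => ?_
  rw [Set.uIcc_of_le hM.le] at hx
  have hVx : 0 ≤ V x := (mul_nonneg hV.pos.le hx.1).trans (hV.mem_Icc_mul x hx).1
  simp only [secondDensity]
  rw [he, Real.mul_rpow hn0.le hVx, Real.rpow_sub_one hn0.ne']
  field_simp
  ring

/-- A function `V ∈ K₂` is a point of local quadratic minimum of the static potential
energy `S` if and only if `V` solves the stationary boundary-value problem
`(A V_x^(−γ))_x = −G x n^((2−2n)/n) V^((2−2n)/n)`, `V(0) = 0`, `V_x(M) = (A/P∞)^(1/γ)`,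
and satisfies the static stability condition. -/
theorem local_quadratic_minimum_iff
    (n : ℕ) (hn : 2 ≤ n) (A G Pinf M γ : ℝ)
    (hA : 0 < A) (hG : 0 < G) (hPinf : 0 < Pinf) (hM : 0 < M) (hγ : 1 < γ)
    (V V' : ℝ → ℝ) (hV : IsC1On V V' M) (hV0 : V 0 = 0)
    (hVpos : ∀ x ∈ Set.Icc (0 : ℝ) M, 0 < V' x) :
    (∃ δ₄ > (0 : ℝ), ∃ δ₅ > (0 : ℝ), ∀ W W' : ℝ → ℝ,
        IsC1On W W' M → W 0 = 0 →
        (∀ x ∈ Set.Icc (0 : ℝ) M, |W x| ≤ δ₅ ∧ |W' x| ≤ δ₅) →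
        Sfun n A G Pinf M γ (fun x => V x + W x) (fun x => V' x + W' x) -
            Sfun n A G Pinf M γ V V' ≥ δ₄ * Qnorm M W W')
    ↔
    ((∀ x ∈ Set.Ioo (0 : ℝ) M,
        HasDerivAt (fun y => A * (V' y) ^ (-γ))
          (-(G * x * (n : ℝ) ^ ((2 - 2 * (n : ℝ)) / (n : ℝ)) *
            (V x) ^ ((2 - 2 * (n : ℝ)) / (n : ℝ)))) x) ∧
      V' M = (A / Pinf) ^ (1 / γ) ∧
      ∃ δ₃ > (0 : ℝ), ∀ W W' : ℝ → ℝ, IsC1On W W' M → W 0 = 0 →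
        Jfun n A G M γ V V' W W' ≥ δ₃ * Qnorm M W W') := by
  obtain ⟨m, K, hm, hmK⟩ := hV.exists_deriv_mem_Icc hM hVpos
  have hVp : IsProfile V V' M m K := ⟨hV, hV0, hm, hmK⟩
  have hn0 : (0 : ℝ) < n := by exact_mod_cast (by omega : 0 < n)
  have hn2 : (2 : ℝ) ≤ n := by exact_mod_cast hn
  have hs : -2 < (2 - 2 * (n : ℝ)) / n := by rw [lt_div_iff₀ hn0]; linarith
  have hs0 : (2 - 2 * (n : ℝ)) / n ≤ 0 := div_nonpos_of_nonpos_of_nonneg (by linarith) hn0.le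
  have hS := fun (V V' : ℝ → ℝ) (m K : ℝ) (h : IsProfile V V' M m K) =>
    Sfun_eq_integral_energyDensity (n := n) (A := A) (G := G) (P := Pinf) (γ := γ) hM h
  have hJ := Jfun_eq_integral_secondDensity (n := n) (by omega) (A := A) (G := G) (γ := γ) hM hVp
  have hc : 0 ≤ G * (n : ℝ) ^ ((2 - 2 * (n : ℝ)) / n) := by positivity
  have hbvp := hVp.residual_eq_zero_iff hM hA hPinf hγ hc hs hs0
  have hforce : ∀ x, G * x * (n : ℝ) ^ ((2 - 2 * (n : ℝ)) / n) * V x ^ ((2 - 2 * (n : ℝ)) / n) =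
      G * (n : ℝ) ^ ((2 - 2 * (n : ℝ)) / n) * x * V x ^ ((2 - 2 * (n : ℝ)) / n) :=
    fun x => by ring
  simp only [hforce]
  rw [← and_assoc, ← hbvp]
  set s := (2 - 2 * (n : ℝ)) / n
  set c := G * (n : ℝ) ^ s
  set C := taylorConst A γ c s m M
  have hC : 0 ≤ C := taylorConst_nonneg hA.le hc hm hM
  have htaylor : ∀ (W W' : ℝ → ℝ) (δ : ℝ), IsC1On W W' M → W 0 = 0 → δ ≤ m / 2 →
      (∀ x ∈ Set.Icc 0 M, |W' x| ≤ δ) →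
      |Sfun n A G Pinf M γ (fun x => V x + W x) (fun x => V' x + W' x) -
        Sfun n A G Pinf M γ V V' -
        (∫ x in (0 : ℝ)..M, firstDensity A Pinf γ c s x (V x) (V' x) (W x) (W' x)) -
        1 / 2 * Jfun n A G M γ V V' W W'| ≤ C * δ * Qnorm M W W' := by
    intro W W' δ hW hW0 hδ hWδ
    rw [hS _ _ _ _ hVp, hS _ _ _ _ (hVp.add hW hW0 hδ hWδ), hJ]
    exact hVp.abs_integral_energyDensity_taylor hW hW0 hM hA.le hγ hc hs hs0 hδ hWδ
  constructor
  · rintro ⟨δ₄, hδ₄, δ₅, hδ₅, hmin⟩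
    have key : ∀ W W' : ℝ → ℝ, IsC1On W W' M → W 0 = 0 →
        (∫ x in (0 : ℝ)..M, firstDensity A Pinf γ c s x (V x) (V' x) (W x) (W' x)) = 0 ∧
          2 * (δ₄ * Qnorm M W W') ≤ Jfun n A G M γ V V' W W' := by
      intro W W' hW hW0
      obtain ⟨B, hB0, hB⟩ := hW.exists_abs_deriv_le
      have ht₀ : 0 < min (δ₅ / (B * (1 + M))) (m / (2 * B)) := by positivity
      refine eq_zero_and_le_of_expansion (C := C * B * Qnorm M W W') ht₀ fun t ht => ?_
      have ht1 := (le_div_iff₀ (by positivity)).1 (ht.trans (min_le_left _ _))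
      have ht2 := (le_div_iff₀ (by positivity)).1 (ht.trans (min_le_right _ _))
      have htB : 0 ≤ |t| * B := by positivity
      have htBM : 0 ≤ |t| * B * M := by positivity
      have htW' : ∀ x ∈ Set.Icc 0 M, |t * W' x| ≤ |t| * B := fun x hx => by
        rw [abs_mul]
        exact mul_le_mul_of_nonneg_left (hB x hx) (abs_nonneg t)
      have htW := hW.const_mul t
      have htW0 : t * W 0 = 0 := by rw [hW0, mul_zero]
      have h1 := hmin _ _ htW htW0 fun x hx => by
        have h2 := htW.abs_le htW0 htW' x hx
        have h3 := mul_le_mul_of_nonneg_left hx.2 htB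
        exact ⟨by linarith, by linarith [htW' x hx]⟩
      have h2 := (abs_le.1 (htaylor _ _ (|t| * B) htW htW0 (by linarith) htW')).2
      rw [hJ] at h2 ⊢
      simp only [firstDensity_mul, secondDensity_mul, Qnorm_mul,
        intervalIntegral.integral_const_mul] at h1 h2
      have h3 : C * (|t| * B) * (t ^ 2 * Qnorm M W W') = C * B * Qnorm M W W' * |t| ^ 3 := by
        rw [← sq_abs t]
        ring
      linarith
    refine ⟨hVp.residual_eq_zero_of_firstVariation hM hc hs hs0
      fun W W' hW hW0 => (key W W' hW hW0).1, 2 * δ₄, by positivity, fun W W' hW hW0 => ?_⟩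
    linarith [(key W W' hW hW0).2]
  · rintro ⟨hres, δ₃, hδ₃, hstab⟩
    refine ⟨δ₃ / 4, by positivity, min (m / 2) (δ₃ / (4 * (C + 1))), by positivity, ?_⟩
    intro W W' hW hW0 hWδ
    have h1 := (abs_le.1 (htaylor W W' _ hW hW0 (min_le_left _ _) fun x hx => (hWδ x hx).2)).1
    have hL : (∫ x in (0 : ℝ)..M, firstDensity A Pinf γ c s x (V x) (V' x) (W x) (W' x)) = 0 := by
      rw [hVp.integral_firstDensity hW hW0 hM hc hs hs0]
      refine (intervalIntegral.integral_congr (g := fun _ => 0) fun x hx => ?_).trans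
        intervalIntegral.integral_zero
      rw [Set.uIcc_of_le hM.le] at hx
      simp only [hres x hx, zero_mul]
    have hQ := Qnorm_nonneg hM W W'
    have h2 : C * min (m / 2) (δ₃ / (4 * (C + 1))) ≤ δ₃ / 4 := by
      refine (mul_le_mul_of_nonneg_left (min_le_right _ _) hC).trans ?_
      rw [mul_div_assoc', div_le_div_iff₀ (by positivity) (by norm_num)]
      nlinarith
    have h3 := mul_le_mul_of_nonneg_right h2 hQ
    have h4 := hstab W W' hW hW0
    rw [hL] at h1
    linarith
end

section
/- Let n ≥ 2 be an integer, A, G, P∞, M > 0, γ > 1. If V∞ ∈ K₂ = {f ∈ C¹([0,M]) : f(0) = 0, min f_x > 0} solves the boundary-value problem (A (V∞)_x^(−γ))_x = −G x n^((2−2n)/n) V∞^((2−2n)/n) on (0,M) with V∞(0) = 0 and (V∞)_x(M) = (A/P∞)^(1/γ), and if γ ≥ (2n−2)/n, then the static stability condition holds: there exists δ₃ > 0 such that J_{V∞}[W] ≥ δ₃(‖W_x‖²_{L²(0,M)} + ‖x^(−1)W‖²_{L²(0,M)}) for all W ∈ K₁ = {W ∈ C¹([0,M]) : W(0) = 0}.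 -/
open MeasureTheory intervalIntegral Set

/-- A function that is continuous and bounded on `(0, M]` is interval integrable on `[0, M]`. -/
theorem intervalIntegrable_of_continuousOn_Ioc_of_bound {f : ℝ → ℝ} {M C : ℝ} (hM : 0 ≤ M)
    (hf : ContinuousOn f (Ioc 0 M)) (hC : ∀ x ∈ Ioc 0 M, |f x| ≤ C) :
    IntervalIntegrable f volume 0 M := by
  rw [intervalIntegrable_iff_integrableOn_Ioc_of_le hM]
  refine IntegrableOn.of_bound (by simp) (hf.aestronglyMeasurable measurableSet_Ioc) C ?_
  exact (ae_restrict_iff' measurableSet_Ioc).2 (Filter.Eventually.of_forall hC)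

/-- A `C¹` function vanishing at `0` is bounded by a multiple of the identity. -/
theorem IsC1On.exists_abs_le_mul {f f' : ℝ → ℝ} {M : ℝ} (hM : 0 ≤ M) (hf : IsC1On f f' M)
    (h0 : f 0 = 0) : ∃ K, 0 ≤ K ∧ ∀ x ∈ Icc 0 M, |f x| ≤ K * x := by
  obtain ⟨K, hK⟩ := isCompact_Icc.exists_bound_of_continuousOn hf.2
  have h0M : (0 : ℝ) ∈ Icc 0 M := ⟨le_rfl, hM⟩
  refine ⟨K, (norm_nonneg _).trans (hK 0 h0M), fun x hx => ?_⟩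
  have := (convex_Icc (0 : ℝ) M).norm_image_sub_le_of_norm_hasDerivWithin_le hf.1 hK h0M hx
  simpa [h0, abs_of_nonneg hx.1] using this

/-- A `C¹` function vanishing at `0` with derivative at least `m` dominates `m * x`. -/
theorem IsC1On.mul_le {f f' : ℝ → ℝ} {M m : ℝ} (hf : IsC1On f f' M) (h0 : f 0 = 0)
    (hm : ∀ x ∈ Icc 0 M, m ≤ f' x) {x : ℝ} (hx : x ∈ Icc 0 M) : m * x ≤ f x := by
  have hd : ∀ y ∈ Ioo 0 M, HasDerivAt f (f' y) y := fun y hy =>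
    (hf.1 y (Ioo_subset_Icc_self hy)).hasDerivAt (Icc_mem_nhds hy.1 hy.2)
  have := (convex_Icc (0 : ℝ) M).mul_sub_le_image_sub_of_le_deriv
    (fun y hy => (hf.1 y hy).continuousWithinAt)
    (by
      rw [interior_Icc]
      exact fun y hy => (hd y hy).differentiableAt.differentiableWithinAt)
    (C := m)
    (by
      rw [interior_Icc]
      exact fun y hy => (hd y hy).deriv ▸ hm y (Ioo_subset_Icc_self hy))
    0 ⟨le_rfl, hx.1.trans hx.2⟩ x hx hx.1
  simpa [h0] using this

/-- Absorbing the cross term of a Hardy-type quadratic form. -/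
theorem hardy_quadratic_form_le {c ε δ L a t r z φ Q : ℝ} (hε : 0 < ε) (hδ : 0 < δ)
    (hQ : c ≤ Q) (hεt : 4 * (ε * t ^ 2) ≤ c) (ha : a ^ 2 ≤ L ^ 2) (hr : r ^ 2 ≤ L ^ 2)
    (hδc : 4 * δ ≤ c) (hδε : 6 * (δ * L ^ 2) ≤ ε) :
    δ * ((z + a * φ) ^ 2 + (φ * r) ^ 2) ≤ Q * z ^ 2 + ε * (φ ^ 2 + 2 * t * φ * z) := by
  have h1 : c * z ^ 2 ≤ Q * z ^ 2 := by gcongr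
  have h2 : 4 * (ε * t ^ 2) * z ^ 2 ≤ c * z ^ 2 := by gcongr
  have h3 : 4 * δ * z ^ 2 ≤ c * z ^ 2 := by gcongr
  have h4 : 6 * (δ * L ^ 2) * φ ^ 2 ≤ ε * φ ^ 2 := by gcongr
  have h5 : δ * φ ^ 2 * a ^ 2 ≤ δ * φ ^ 2 * L ^ 2 := by gcongr
  have h6 : δ * φ ^ 2 * r ^ 2 ≤ δ * φ ^ 2 * L ^ 2 := by gcongr
  have h7 : 0 ≤ ε * (φ + 2 * t * z) ^ 2 := by positivity
  have h8 : 0 ≤ δ * (z - a * φ) ^ 2 := by positivity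
  linarith

/-- If `V∞ ∈ K₂` solves the stationary boundary-value problem and `γ ≥ (2n−2)/n`, then
the static stability condition holds. -/
theorem static_stability_of_solution
    (n : ℕ) (hn : 2 ≤ n) (A G Pinf M γ : ℝ)
    (hA : 0 < A) (hG : 0 < G) (hPinf : 0 < Pinf) (hM : 0 < M) (hγ : 1 < γ)
    (hγn : (2 * (n : ℝ) - 2) / (n : ℝ) ≤ γ)
    (V V' : ℝ → ℝ) (hV : IsC1On V V' M) (hV0 : V 0 = 0)
    (hVpos : ∀ x ∈ Set.Icc (0 : ℝ) M, 0 < V' x)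
    (hODE : ∀ x ∈ Set.Ioo (0 : ℝ) M,
      HasDerivAt (fun y => A * (V' y) ^ (-γ))
        (-(G * x * (n : ℝ) ^ ((2 - 2 * (n : ℝ)) / (n : ℝ)) *
          (V x) ^ ((2 - 2 * (n : ℝ)) / (n : ℝ)))) x)
    (hVM : V' M = (A / Pinf) ^ (1 / γ)) :
    ∃ δ₃ > (0 : ℝ), ∀ W W' : ℝ → ℝ, IsC1On W W' M → W 0 = 0 →
      Jfun n A G M γ V V' W W' ≥ δ₃ * Qnorm M W W' := by
  have hM0 : (0 : ℝ) ≤ M := hM.le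
  have h0M : (0 : ℝ) ∈ Icc 0 M := ⟨le_rfl, hM0⟩
  have hMM : M ∈ Icc 0 M := ⟨hM0, le_rfl⟩
  have hn0 : (0 : ℝ) < n := by positivity
  have hn2 : (2 : ℝ) ≤ n := by exact_mod_cast hn
  obtain ⟨α, hα⟩ : ∃ α : ℝ, α = (2 * (n : ℝ) - 2) / (n : ℝ) := ⟨_, rfl⟩
  have hα0 : 0 < α := by rw [hα]; apply div_pos <;> linarith
  have hα2 : α ≤ 2 := by rw [hα, div_le_iff₀ hn0]; linarith
  have hαγ : α ≤ γ := hα ▸ hγn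
  have he1 : (2 - 2 * (n : ℝ)) / (n : ℝ) = -α := by rw [hα]; ring
  have he2 : (2 - 3 * (n : ℝ)) / (n : ℝ) = -α - 1 := by rw [hα]; field_simp; ring
  have hαn : 2 * (n : ℝ) - 2 = α * n := by rw [hα]; field_simp
  rw [he1] at hODE
  obtain ⟨x₀, hx₀, hmin⟩ := isCompact_Icc.exists_isMinOn ⟨0, h0M⟩ hV.2
  obtain ⟨x₁, hx₁, hmax⟩ := isCompact_Icc.exists_isMaxOn ⟨0, h0M⟩ hV.2
  obtain ⟨m, hm⟩ : ∃ m, m = V' x₀ := ⟨_, rfl⟩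
  have hm0 : 0 < m := hm ▸ hVpos _ hx₀
  have hmle : ∀ x ∈ Icc 0 M, m ≤ V' x := fun x hx => hm ▸ hmin hx
  obtain ⟨L, hL⟩ : ∃ L, L = V' x₁ := ⟨_, rfl⟩
  have hL0 : 0 < L := hL ▸ hVpos _ hx₁
  have hleL : ∀ x ∈ Icc 0 M, V' x ≤ L := fun x hx => hL ▸ hmax hx
  have hVm : ∀ x ∈ Icc 0 M, m * x ≤ V x := fun x hx => hV.mul_le hV0 hmle hx
  have hVL : ∀ x ∈ Icc 0 M, V x ≤ L * x := by
    intro x hx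
    have hneg : IsC1On (fun y => -V y) (fun y => -V' y) M :=
      ⟨fun y hy => (hV.1 y hy).neg, hV.2.neg⟩
    have := hneg.mul_le (m := -L) (by simp [hV0]) (fun y hy => neg_le_neg (hleL y hy)) hx
    linarith
  have hVpos' : ∀ x ∈ Ioc 0 M, 0 < V x := fun x hx =>
    (mul_pos hm0 hx.1).trans_le (hVm x (Ioc_subset_Icc_self hx))
  have hVc : ContinuousOn V (Icc 0 M) := fun y hy => (hV.1 y hy).continuousWithinAt
  have hqc : ∀ s : ℝ, ContinuousOn (fun x => V' x ^ s) (Icc 0 M) := fun s =>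
    hV.2.rpow_const fun x hx => Or.inl (hVpos x hx).ne'
  obtain ⟨c, hc⟩ : ∃ c, c = α * (A * L ^ (-(1 + γ))) := ⟨_, rfl⟩
  have hc0 : 0 < c := by rw [hc]; positivity
  have hcq : ∀ x ∈ Icc 0 M, c ≤ α * (A * V' x ^ (-(1 + γ))) := by
    intro x hx
    rw [hc]
    gcongr α * (A * ?_)
    exact Real.rpow_le_rpow_of_nonpos (hVpos x hx) (hleL x hx) (by linarith)
  have hPq : ∀ x ∈ Icc 0 M, V' x ^ (-γ) = V' x ^ (-(1 + γ)) * V' x := by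
    intro x hx
    rw [← Real.rpow_add_one (hVpos x hx).ne']
    congr 1; ring
  obtain ⟨ε, hε⟩ : ∃ ε, ε = c * m ^ 2 / 4 := ⟨_, rfl⟩
  have hε0 : 0 < ε := by rw [hε]; positivity
  obtain ⟨δ, hδ⟩ : ∃ δ, δ = min (c / 4) (ε / (6 * L ^ 2)) := ⟨_, rfl⟩
  have hδ0 : 0 < δ := by rw [hδ]; positivity
  have hδc : 4 * δ ≤ c := by
    have : δ ≤ c / 4 := hδ ▸ min_le_left _ _
    linarith
  have hδε : 6 * (δ * L ^ 2) ≤ ε := by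
    have : δ ≤ ε / (6 * L ^ 2) := hδ ▸ min_le_right _ _
    rw [le_div_iff₀ (by positivity)] at this
    linarith
  refine ⟨δ, hδ0, fun W W' hW hW0 => ?_⟩
  have hWc : ContinuousOn W (Icc 0 M) := fun y hy => (hW.1 y hy).continuousWithinAt
  obtain ⟨K, hK0, hK⟩ := hW.exists_abs_le_mul hM0 hW0
  have hφ : ∀ x ∈ Ioc 0 M, |W x / V x| ≤ K / m := by
    intro x hx
    rw [abs_div, abs_of_pos (hVpos' x hx), div_le_div_iff₀ (hVpos' x hx) hm0]
    have h1 := hK x (Ioc_subset_Icc_self hx)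
    have h2 := hVm x (Ioc_subset_Icc_self hx)
    calc |W x| * m ≤ K * x * m := by gcongr
      _ = K * (m * x) := by ring
      _ ≤ K * V x := by gcongr
  have hIQ1 : IntervalIntegrable (fun x => W' x ^ 2) volume 0 M := by
    apply ContinuousOn.intervalIntegrable
    rw [uIcc_of_le hM0]
    exact hW.2.pow 2
  have hIQ2 : IntervalIntegrable (fun x => (W x / x) ^ 2) volume 0 M := by
    refine intervalIntegrable_of_continuousOn_Ioc_of_bound (C := K ^ 2) hM0 ?_ fun x hx => ?_
    · exact ((hWc.mono Ioc_subset_Icc_self).div continuousOn_id fun x hx => hx.1.ne').pow 2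
    · rw [abs_pow, abs_div, abs_of_pos hx.1]
      refine pow_le_pow_left₀ (div_nonneg (abs_nonneg _) hx.1.le) ?_ 2
      rw [div_le_iff₀ hx.1]
      exact hK x (Ioc_subset_Icc_self hx)
  have hkernel : ∀ x ∈ Ioc 0 M, (2 * (n : ℝ) - 2) * G * x *
      ((n : ℝ) * V x) ^ ((2 - 3 * (n : ℝ)) / (n : ℝ)) * (W x) ^ 2 =
      α * (G * x * (n : ℝ) ^ (-α) * V x ^ (-α)) * (W x / V x) ^ 2 * V x := by
    intro x hx
    have hv := hVpos' x hx
    rw [he2, hαn, Real.rpow_sub_one (by positivity), Real.mul_rpow hn0.le hv.le]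
    field_simp
  have hI1 : IntervalIntegrable (fun x => γ * A * (V' x) ^ (-(1 + γ)) * (W' x) ^ 2)
      volume 0 M := by
    apply ContinuousOn.intervalIntegrable
    rw [uIcc_of_le hM0]
    exact (continuousOn_const.mul (hqc _)).mul (hW.2.pow 2)
  have hI2 : IntervalIntegrable (fun x => (2 * (n : ℝ) - 2) * G * x *
      ((n : ℝ) * V x) ^ ((2 - 3 * (n : ℝ)) / (n : ℝ)) * (W x) ^ 2) volume 0 M := by
    refine intervalIntegrable_of_continuousOn_Ioc_of_bound
      (C := α * G * (n : ℝ) ^ (-α) * (K / m) ^ 2 * (1 / m) * (L * M) ^ (2 - α))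
      hM0 ?_ fun x hx => ?_
    · refine ((continuousOn_const.mul continuousOn_id).mul
        (ContinuousOn.rpow_const (continuousOn_const.mul (hVc.mono Ioc_subset_Icc_self))
          fun x hx => Or.inl (mul_pos hn0 (hVpos' x hx)).ne')).mul
        ((hWc.mono Ioc_subset_Icc_self).pow 2)
    · have hv := hVpos' x hx
      have hx0 := hx.1
      have hvp : V x ^ (2 - α) = V x ^ (-α) * V x ^ 2 := by
        rw [← Real.rpow_natCast, ← Real.rpow_add hv]; congr 1; push_cast; ring
      have hxV : x / V x ≤ 1 / m := by
        rw [div_le_div_iff₀ hv hm0]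
        linarith [hVm x (Ioc_subset_Icc_self hx)]
      have hVLM : V x ≤ L * M := (hVL x (Ioc_subset_Icc_self hx)).trans (by gcongr; exact hx.2)
      have hpow : V x ^ (2 - α) ≤ (L * M) ^ (2 - α) :=
        Real.rpow_le_rpow hv.le hVLM (by linarith)
      have heq : α * (G * x * (n : ℝ) ^ (-α) * V x ^ (-α)) * (W x / V x) ^ 2 * V x =
          α * G * (n : ℝ) ^ (-α) * |W x / V x| ^ 2 * (x / V x) * V x ^ (2 - α) := by
        rw [hvp, sq_abs]; field_simp
      rw [hkernel x hx, heq, abs_of_nonneg (by positivity)]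
      have := hφ x hx
      gcongr
  have hIJ := hI1.sub hI2
  have hIQ := (hIQ1.add hIQ2).const_mul δ
  obtain ⟨g, hg⟩ : ∃ g : ℝ → ℝ, g = fun x =>
      α * (A * V' x ^ (-γ) * (W x ^ 2 / V x)) - ε * (x * (W x / V x) ^ 2) := ⟨_, rfl⟩
  have hgc : ContinuousOn g (Icc 0 M) := by
    intro x hx
    rcases hx.1.eq_or_lt with rfl | hx0
    · obtain ⟨B, hB⟩ := isCompact_Icc.exists_bound_of_continuousOn (hqc (-γ))
      have hB0 : 0 ≤ B := (norm_nonneg _).trans (hB 0 h0M)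
      have hg0 : g 0 = 0 := by simp [hg, hW0]
      have hbd : ∀ y ∈ Icc 0 M,
          ‖g y‖ ≤ (α * (A * B * (K * (K / m))) + ε * (K / m) ^ 2) * y := by
        intro y hy
        rcases hy.1.eq_or_lt with rfl | hy0
        · simp [hg0]
        · have hy' : y ∈ Ioc 0 M := ⟨hy0, hy.2⟩
          have h1 := hK y hy
          have h2 := hφ y hy'
          have h3 := hB y hy
          rw [Real.norm_eq_abs] at h3 ⊢
          have h4 : g y = α * (A * V' y ^ (-γ) * (W y * (W y / V y)))
              - ε * (y * (W y / V y) ^ 2) := by rw [hg]; ring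
          rw [h4]
          refine (abs_sub _ _).trans ?_
          simp only [abs_mul, abs_pow, abs_of_pos hα0, abs_of_pos hA, abs_of_pos hε0,
            abs_of_pos hy0]
          calc _ ≤ α * (A * B * (K * y * (K / m))) + ε * (y * (K / m) ^ 2) := by gcongr
            _ = _ := by ring
      rw [ContinuousWithinAt, hg0]
      refine squeeze_zero_norm' (Filter.eventually_of_mem self_mem_nhdsWithin hbd) ?_
      have : Filter.Tendsto
          (fun y : ℝ => (α * (A * B * (K * (K / m))) + ε * (K / m) ^ 2) * y)
          (nhds 0) (nhds (_ * 0)) := (continuous_const.mul continuous_id).tendsto 0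
      rw [mul_zero] at this
      exact this.mono_left nhdsWithin_le_nhds
    · have hv := (hVpos' x ⟨hx0, hx.2⟩).ne'
      rw [hg]
      exact (continuousWithinAt_const.mul ((continuousWithinAt_const.mul (hqc _ x hx)).mul
        (((hWc x hx).pow 2).div (hVc x hx) hv))).sub
        (continuousWithinAt_const.mul (continuousWithinAt_id.mul
          (((hWc x hx).div (hVc x hx) hv).pow 2)))
  have hgd : ∀ x ∈ Ioo 0 M, HasDerivAt g
      (α * (-(G * x * (n : ℝ) ^ (-α) * V x ^ (-α)) * (W x ^ 2 / V x) +
        A * V' x ^ (-γ) * ((2 * W x * W' x * V x - W x ^ 2 * V' x) / V x ^ 2)) -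
      ε * (1 * (W x / V x) ^ 2 +
        x * (2 * (W x / V x) * ((W' x * V x - W x * V' x) / V x ^ 2)))) x := by
    intro x hx
    have hxI := Ioo_subset_Icc_self hx
    have hv := (hVpos' x (Ioo_subset_Ioc_self hx)).ne'
    have hdV := (hV.1 x hxI).hasDerivAt (Icc_mem_nhds hx.1 hx.2)
    have hdW := (hW.1 x hxI).hasDerivAt (Icc_mem_nhds hx.1 hx.2)
    have hdW2 : HasDerivAt (fun y => W y ^ 2) (2 * W x * W' x) x := by
      simpa using hdW.fun_pow 2
    have hdφ2 : HasDerivAt (fun y => (W y / V y) ^ 2)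
        (2 * (W x / V x) * ((W' x * V x - W x * V' x) / V x ^ 2)) x := by
      simpa using (hdW.fun_div hdV hv).fun_pow 2
    rw [hg]
    exact (((hODE x hx).mul (hdW2.div hdV hv)).const_mul α).sub
      (((hasDerivAt_id x).mul hdφ2).const_mul ε)
  have hmain : g M - g 0 ≤ ∫ x in (0 : ℝ)..M,
      ((γ * A * (V' x) ^ (-(1 + γ)) * (W' x) ^ 2 -
        (2 * (n : ℝ) - 2) * G * x * ((n : ℝ) * V x) ^ ((2 - 3 * (n : ℝ)) / (n : ℝ)) *
          (W x) ^ 2) - δ * (W' x ^ 2 + (W x / x) ^ 2)) := by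
    refine sub_le_integral_of_hasDeriv_right_of_le hM0 hgc
      (fun x hx => (hgd x hx).hasDerivWithinAt)
      ((integrableOn_Icc_iff_integrableOn_Ioc).2 ((hIJ.sub hIQ).1)) fun x hx => ?_
    have hxI := Ioo_subset_Icc_self hx
    have hxo := Ioo_subset_Ioc_self hx
    have hx0 := hx.1
    have hv := hVpos' x hxo
    have ha := hVpos x hxI
    rw [hkernel x hxo, hPq x hxI]
    have hform := hardy_quadratic_form_le (a := V' x) (t := x / V x) (r := V x / x)
      (z := W' x - V' x * (W x / V x)) (φ := W x / V x) hε0 hδ0 (hcq x hxI)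
      (by
        have hxV : (m * (x / V x)) ^ 2 ≤ 1 := by
          rw [sq_le_one_iff₀ (by positivity), ← mul_div_assoc, div_le_one hv]
          exact hVm x hxI
        calc 4 * (ε * (x / V x) ^ 2) = c * (m * (x / V x)) ^ 2 := by rw [hε]; ring
          _ ≤ c * 1 := by gcongr
          _ = c := mul_one c)
      (by have := hleL x hxI; gcongr)
      (by
        have : V x / x ≤ L := by rw [div_le_iff₀ hx0]; exact hVL x hxI
        gcongr)
      hδc hδε
    have hq : α * (A * V' x ^ (-(1 + γ)) * W' x ^ 2) ≤
        γ * (A * V' x ^ (-(1 + γ)) * W' x ^ 2) := by gcongr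
    have e1 : W x ^ 2 / V x = (W x / V x) ^ 2 * V x := by field_simp
    have e2 : (2 * W x * W' x * V x - W x ^ 2 * V' x) / V x ^ 2 =
        2 * (W x / V x) * W' x - (W x / V x) ^ 2 * V' x := by field_simp
    have e3 : x * (2 * (W x / V x) * ((W' x * V x - W x * V' x) / V x ^ 2)) =
        2 * (x / V x) * (W x / V x) * (W' x - V' x * (W x / V x)) := by field_simp
    have e4 : W x / x = W x / V x * (V x / x) := by field_simp
    rw [e1, e2, e3, e4]
    linarith
  have hgM : 0 ≤ g M := by
    have hv := hVpos' M ⟨hM, le_rfl⟩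
    have hPV : ε * M ≤ α * (A * V' M ^ (-γ) * V M) := by
      rw [hPq M hMM]
      calc ε * M = c * m * (m * M) / 4 := by rw [hε]; ring
        _ ≤ c * m * (m * M) := div_le_self (by positivity) (by norm_num)
        _ ≤ α * (A * V' M ^ (-(1 + γ))) * V' M * V M := by
          have := hVpos M hMM
          gcongr
          exacts [hcq M hMM, hmle M hMM, hVm M hMM]
        _ = _ := by ring
    have e : g M = (α * (A * V' M ^ (-γ) * V M) - ε * M) * (W M / V M) ^ 2 := by
      rw [hg]; field_simp
    rw [e]
    exact mul_nonneg (sub_nonneg.2 hPV) (sq_nonneg _)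
  have hg0 : g 0 = 0 := by simp [hg, hW0]
  rw [integral_sub hIJ hIQ, intervalIntegral.integral_const_mul,
    integral_add hIQ1 hIQ2] at hmain
  unfold Jfun Qnorm
  linarith
end

section
/- Let n ≥ 2 be an integer and A, G, P∞, M > 0 real constants. Assume γ > (2n−2)/n, or γ = (2n−2)/n and G·n^((2−n)/n)·M^(2/n) < 2A. Then the Lagrangian stationary problem has a unique positive solution: there is exactly one continuous function ρ∞ : [0,M] → (0,∞) satisfying A·ρ∞(x)^γ = P∞ + ∫_x^M G y / r∞(y)^(2n−2) dy for all x ∈ [0,M], where r∞(x) = (n ∫_0^x ρ∞(y)^(−1) dy)^(1/n). -/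
open MeasureTheory intervalIntegral Set

/-- `ρ` is a positive continuous solution of the Lagrangian stationary problem
`A ρ(x)^γ = P∞ + ∫_x^M G y / r∞(y)^(2n−2) dy` with
`r∞(x) = (n ∫_0^x ρ(y)⁻¹ dy)^(1/n)`. -/
def IsLagrStationary (n : ℕ) (A G Pinf M γ : ℝ) (ρ : ℝ → ℝ) : Prop :=
  ContinuousOn ρ (Set.Icc 0 M) ∧ (∀ x ∈ Set.Icc (0 : ℝ) M, 0 < ρ x) ∧
    ∀ x ∈ Set.Icc (0 : ℝ) M,
      A * ρ x ^ γ = Pinf +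
        ∫ y in x..M,
          G * y / (((n : ℝ) * ∫ z in (0 : ℝ)..y, (ρ z)⁻¹) ^ ((1 : ℝ) / (n : ℝ))) ^
            (2 * n - 2)

/-- The gravitational integrand `G y / r∞(y)^(2n−2)` associated with the density `ρ`. -/
noncomputable def lagrIntegrand (n : ℕ) (G : ℝ) (ρ : ℝ → ℝ) (y : ℝ) : ℝ :=
  G * y / (((n : ℝ) * ∫ z in (0 : ℝ)..y, (ρ z)⁻¹) ^ ((1 : ℝ) / (n : ℝ))) ^ (2 * n - 2)

theorem rpow_one_div_pow_two_mul_sub_two {n : ℕ} (hn : 2 ≤ n) {v : ℝ} (hv : 0 ≤ v) :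
    (v ^ ((1 : ℝ) / (n : ℝ))) ^ (2 * n - 2) = v ^ ((2 * (n : ℝ) - 2) / (n : ℝ)) := by
  rw [← Real.rpow_natCast, ← Real.rpow_mul hv, Nat.cast_sub (by omega)]
  push_cast
  congr 1
  ring

theorem integral_inv_pos {M : ℝ} {ρ : ℝ → ℝ}
    (hint : IntervalIntegrable (fun z => (ρ z)⁻¹) volume 0 M)
    (hpos : ∀ x ∈ Icc (0 : ℝ) M, 0 < ρ x) {y : ℝ} (hy0 : 0 < y) (hyM : y ≤ M) :
    0 < ∫ z in (0 : ℝ)..y, (ρ z)⁻¹ := by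
  refine intervalIntegral_pos_of_pos_on (hint.mono_set ?_) ?_ hy0
  · rw [uIcc_of_le hy0.le, uIcc_of_le (hy0.le.trans hyM)]
    exact Icc_subset_Icc_right hyM
  · intro x hx
    exact inv_pos.2 (hpos x ⟨hx.1.le, hx.2.le.trans hyM⟩)

theorem lagrIntegrand_nonneg {n : ℕ} {G M : ℝ} (hG : 0 < G) {ρ : ℝ → ℝ}
    (hpos : ∀ x ∈ Icc (0 : ℝ) M, 0 < ρ x) {y : ℝ} (hy : y ∈ Icc (0 : ℝ) M) :
    0 ≤ lagrIntegrand n G ρ y := by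
  have hV : 0 ≤ ∫ z in (0 : ℝ)..y, (ρ z)⁻¹ :=
    integral_nonneg hy.1 fun z hz => (inv_pos.2 (hpos z ⟨hz.1, hz.2.trans hy.2⟩)).le
  have := hy.1
  unfold lagrIntegrand
  positivity

/-- The integrand is monotone in the density and homogeneous of degree `(2n−2)/n`. -/
theorem lagrIntegrand_le_rpow_mul {n : ℕ} (hn : 2 ≤ n) {G M : ℝ} (hG : 0 < G)
    {ρ₁ ρ₂ : ℝ → ℝ} {c : ℝ} (hc : 0 < c)
    (hint₁ : IntervalIntegrable (fun z => (ρ₁ z)⁻¹) volume 0 M)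
    (hint₂ : IntervalIntegrable (fun z => (ρ₂ z)⁻¹) volume 0 M)
    (hpos₁ : ∀ x ∈ Icc (0 : ℝ) M, 0 < ρ₁ x) (hpos₂ : ∀ x ∈ Icc (0 : ℝ) M, 0 < ρ₂ x)
    (hle : ∀ x ∈ Icc (0 : ℝ) M, ρ₁ x ≤ c * ρ₂ x) {y : ℝ} (hy : y ∈ Icc (0 : ℝ) M) :
    lagrIntegrand n G ρ₁ y ≤ c ^ ((2 * (n : ℝ) - 2) / (n : ℝ)) * lagrIntegrand n G ρ₂ y := by
  rcases hy.1.eq_or_lt with rfl | hy0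
  · simp [lagrIntegrand]
  have hV₁ := integral_inv_pos hint₁ hpos₁ hy0 hy.2
  have hV₂ := integral_inv_pos hint₂ hpos₂ hy0 hy.2
  have hsub : uIcc 0 y ⊆ uIcc 0 M := by
    rw [uIcc_of_le hy0.le, uIcc_of_le (hy0.le.trans hy.2)]
    exact Icc_subset_Icc_right hy.2
  have hV : ∫ z in (0 : ℝ)..y, (ρ₂ z)⁻¹ ≤ c * ∫ z in (0 : ℝ)..y, (ρ₁ z)⁻¹ := by
    rw [← intervalIntegral.integral_const_mul]
    refine integral_mono_on hy0.le (hint₂.mono_set hsub) ((hint₁.mono_set hsub).const_mul c) ?_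
    intro z hz
    have hz' : z ∈ Icc (0 : ℝ) M := ⟨hz.1, hz.2.trans hy.2⟩
    have h1 := hpos₁ z hz'
    have h2 := hpos₂ z hz'
    rw [← div_eq_mul_inv, inv_eq_one_div, div_le_div_iff₀ h2 h1, one_mul]
    exact hle z hz'
  have hn0 : (0 : ℝ) < n := by positivity
  have hn2 : (2 : ℝ) ≤ n := by exact_mod_cast hn
  unfold lagrIntegrand
  rw [rpow_one_div_pow_two_mul_sub_two hn (by positivity),
    rpow_one_div_pow_two_mul_sub_two hn (by positivity), ← mul_div_assoc,
    div_le_div_iff₀ (by positivity) (by positivity)]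
  have hα : (0 : ℝ) ≤ (2 * (n : ℝ) - 2) / (n : ℝ) := div_nonneg (by linarith) hn0.le
  have key : ((n : ℝ) * ∫ z in (0 : ℝ)..y, (ρ₂ z)⁻¹) ^ ((2 * (n : ℝ) - 2) / (n : ℝ)) ≤
      c ^ ((2 * (n : ℝ) - 2) / (n : ℝ)) *
        ((n : ℝ) * ∫ z in (0 : ℝ)..y, (ρ₁ z)⁻¹) ^ ((2 * (n : ℝ) - 2) / (n : ℝ)) := by
    rw [← Real.mul_rpow hc.le (by positivity)]
    refine Real.rpow_le_rpow (by positivity) ?_ hα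
    calc _ ≤ (n : ℝ) * (c * ∫ z in (0 : ℝ)..y, (ρ₁ z)⁻¹) := by gcongr
      _ = _ := by ring
  calc _ ≤ G * y * _ := mul_le_mul_of_nonneg_left key (by positivity)
    _ = _ := by ring

theorem lagrIntegrand_one {n : ℕ} (hn : 2 ≤ n) {G y : ℝ} (hy : 0 < y) :
    lagrIntegrand n G (fun _ => 1) y =
      G * (n : ℝ) ^ (-((2 * (n : ℝ) - 2) / (n : ℝ))) * y ^ ((2 : ℝ) / n - 1) := by
  have hn0 : (0 : ℝ) < n := by positivity
  simp only [lagrIntegrand, inv_one, intervalIntegral.integral_const, sub_zero, smul_eq_mul, mul_one]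
  rw [rpow_one_div_pow_two_mul_sub_two hn (by positivity), Real.mul_rpow hn0.le hy.le,
    Real.rpow_neg hn0.le, show (2 : ℝ) / n - 1 = 1 - (2 * (n : ℝ) - 2) / n by field_simp; ring,
    Real.rpow_sub hy, Real.rpow_one]
  field_simp

theorem intervalIntegrable_lagrIntegrand_one {n : ℕ} (hn : 2 ≤ n) {G M : ℝ} (hM : 0 < M) :
    IntervalIntegrable (lagrIntegrand n G (fun _ => 1)) volume 0 M := by
  have hn0 : (0 : ℝ) < n := by positivity
  have h := (intervalIntegrable_rpow' (a := 0) (b := M) (r := (2 : ℝ) / n - 1)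
    (by linarith [div_pos two_pos hn0])).const_mul
      (G * (n : ℝ) ^ (-((2 * (n : ℝ) - 2) / (n : ℝ))))
  refine h.congr fun y hy => ?_
  rw [uIoc_of_le hM.le] at hy
  exact (lagrIntegrand_one hn hy.1).symm

theorem integral_lagrIntegrand_one {n : ℕ} (hn : 2 ≤ n) {G M : ℝ} (hM : 0 < M) :
    ∫ y in (0 : ℝ)..M, lagrIntegrand n G (fun _ => 1) y =
      G * (n : ℝ) ^ ((2 - (n : ℝ)) / (n : ℝ)) * M ^ ((2 : ℝ) / (n : ℝ)) / 2 := by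
  have hn0 : (0 : ℝ) < n := by positivity
  have hp := div_pos two_pos hn0
  have hcongr : ∫ y in (0 : ℝ)..M, lagrIntegrand n G (fun _ => 1) y =
      ∫ y in (0 : ℝ)..M,
        G * (n : ℝ) ^ (-((2 * (n : ℝ) - 2) / (n : ℝ))) * y ^ ((2 : ℝ) / n - 1) := by
    refine integral_congr_ae (Filter.Eventually.of_forall fun y hy => ?_)
    rw [uIoc_of_le hM.le] at hy
    exact lagrIntegrand_one hn hy.1
  rw [hcongr, intervalIntegral.integral_const_mul, integral_rpow (Or.inl (by linarith)),
    sub_add_cancel, Real.zero_rpow hp.ne', sub_zero,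
    show (2 - (n : ℝ)) / n = -((2 * (n : ℝ) - 2) / (n : ℝ)) + 1 by field_simp; ring,
    Real.rpow_add hn0, Real.rpow_one]
  field_simp

theorem intervalIntegrable_lagrIntegrand {n : ℕ} (hn : 2 ≤ n) {G M : ℝ} (hG : 0 < G)
    (hM : 0 < M) {ρ : ℝ → ℝ} {C : ℝ} (hC : 0 < C)
    (hint : IntervalIntegrable (fun z => (ρ z)⁻¹) volume 0 M)
    (hpos : ∀ x ∈ Icc (0 : ℝ) M, 0 < ρ x) (hle : ∀ x ∈ Icc (0 : ℝ) M, ρ x ≤ C) :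
    IntervalIntegrable (lagrIntegrand n G ρ) volume 0 M := by
  have hV : ContinuousOn (fun y => ∫ z in (0 : ℝ)..y, (ρ z)⁻¹) (Ioc 0 M) := by
    have := continuousOn_primitive_interval' hint left_mem_uIcc
    rw [uIcc_of_le hM.le] at this
    exact this.mono Ioc_subset_Icc_self
  have hn0 : (0 : ℝ) < n := by positivity
  have hF : ContinuousOn (lagrIntegrand n G ρ) (Ioc 0 M) := by
    have hVpos : ∀ y ∈ Ioc (0 : ℝ) M, 0 < (n : ℝ) * ∫ z in (0 : ℝ)..y, (ρ z)⁻¹ := fun y hy =>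
      mul_pos hn0 (integral_inv_pos hint hpos hy.1 hy.2)
    refine ContinuousOn.div (by fun_prop) (((continuousOn_const.mul hV).rpow_const
      fun y hy => Or.inl (hVpos y hy).ne').pow _) fun y hy => ?_
    exact (pow_pos (Real.rpow_pos_of_pos (hVpos y hy) _) _).ne'
  have hbd := (intervalIntegrable_lagrIntegrand_one hn (G := G) hM).const_mul
    (C ^ ((2 * (n : ℝ) - 2) / (n : ℝ)))
  rw [intervalIntegrable_iff_integrableOn_Ioc_of_le hM.le] at hbd ⊢
  refine Integrable.mono' hbd (hF.aestronglyMeasurable measurableSet_Ioc) ?_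
  refine (ae_restrict_mem measurableSet_Ioc).mono fun y hy => ?_
  have hy' := Ioc_subset_Icc_self hy
  rw [Real.norm_of_nonneg (lagrIntegrand_nonneg hG hpos hy')]
  exact lagrIntegrand_le_rpow_mul hn hG hC hint (by simp) hpos (by simp)
    (fun x hx => by simpa using hle x hx) hy'

theorem integral_lagrIntegrand_le {n : ℕ} (hn : 2 ≤ n) {G M : ℝ} (hG : 0 < G) (hM : 0 < M)
    {ρ₁ ρ₂ : ℝ → ℝ} {c C₂ : ℝ} (hc : 0 < c)
    (hint₁ : IntervalIntegrable (fun z => (ρ₁ z)⁻¹) volume 0 M)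
    (hint₂ : IntervalIntegrable (fun z => (ρ₂ z)⁻¹) volume 0 M)
    (hpos₁ : ∀ x ∈ Icc (0 : ℝ) M, 0 < ρ₁ x) (hpos₂ : ∀ x ∈ Icc (0 : ℝ) M, 0 < ρ₂ x)
    (hle : ∀ x ∈ Icc (0 : ℝ) M, ρ₁ x ≤ c * ρ₂ x)
    (hC₂ : ∀ x ∈ Icc (0 : ℝ) M, ρ₂ x ≤ C₂) {x : ℝ} (hx : x ∈ Icc (0 : ℝ) M) :
    ∫ y in x..M, lagrIntegrand n G ρ₁ y ≤
      c ^ ((2 * (n : ℝ) - 2) / (n : ℝ)) * ∫ y in x..M, lagrIntegrand n G ρ₂ y := by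
  have h0 : (0 : ℝ) ∈ Icc (0 : ℝ) M := ⟨le_rfl, hM.le⟩
  have hC₂pos : 0 < C₂ := (hpos₂ 0 h0).trans_le (hC₂ 0 h0)
  have hsub : uIcc x M ⊆ uIcc 0 M := by
    rw [uIcc_of_le hx.2, uIcc_of_le hM.le]
    exact Icc_subset_Icc_left hx.1
  have hi₁ := (intervalIntegrable_lagrIntegrand hn hG hM (mul_pos hc hC₂pos) hint₁ hpos₁
    fun z hz => (hle z hz).trans (mul_le_mul_of_nonneg_left (hC₂ z hz) hc.le)).mono_set hsub
  have hi₂ := (intervalIntegrable_lagrIntegrand hn hG hM hC₂pos hint₂ hpos₂ hC₂).mono_set hsub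
  rw [← intervalIntegral.integral_const_mul]
  exact integral_mono_on hx.2 hi₁ (hi₂.const_mul _) fun y hy =>
    lagrIntegrand_le_rpow_mul hn hG hc hint₁ hint₂ hpos₁ hpos₂ hle ⟨hx.1.trans hy.1, hy.2⟩

theorem integral_lagrIntegrand_nonneg {n : ℕ} {G M : ℝ} (hG : 0 < G) {ρ : ℝ → ℝ}
    (hpos : ∀ x ∈ Icc (0 : ℝ) M, 0 < ρ x) {x : ℝ} (hx : x ∈ Icc (0 : ℝ) M) :
    0 ≤ ∫ y in x..M, lagrIntegrand n G ρ y :=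
  integral_nonneg hx.2 fun _ hy => lagrIntegrand_nonneg hG hpos ⟨hx.1.trans hy.1, hy.2⟩

/-- Comparison of two solutions, by the strict subhomogeneity of the right-hand side. -/
theorem IsLagrStationary.le {n : ℕ} (hn : 2 ≤ n) {A G Pinf M γ : ℝ} (hA : 0 < A) (hG : 0 < G)
    (hPinf : 0 < Pinf) (hM : 0 < M) (hγ : (2 * (n : ℝ) - 2) / (n : ℝ) ≤ γ) {ρ₁ ρ₂ : ℝ → ℝ}
    (h₁ : IsLagrStationary n A G Pinf M γ ρ₁) (h₂ : IsLagrStationary n A G Pinf M γ ρ₂)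
    {x : ℝ} (hx : x ∈ Icc (0 : ℝ) M) : ρ₁ x ≤ ρ₂ x := by
  obtain ⟨hcont₁, hpos₁, heq₁⟩ := h₁
  obtain ⟨hcont₂, hpos₂, heq₂⟩ := h₂
  have hint : ∀ {ρ : ℝ → ℝ}, ContinuousOn ρ (Icc 0 M) → (∀ x ∈ Icc (0 : ℝ) M, 0 < ρ x) →
      IntervalIntegrable (fun z => (ρ z)⁻¹) volume 0 M := fun hc hp =>
    (hc.inv₀ fun z hz => (hp z hz).ne').intervalIntegrable_of_Icc hM.le
  obtain ⟨x₀, hx₀, hmax⟩ := isCompact_Icc.exists_isMaxOn (nonempty_Icc.2 hM.le)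
    (hcont₁.div hcont₂ fun z hz => (hpos₂ z hz).ne')
  obtain ⟨x₁, -, hmax₂⟩ := isCompact_Icc.exists_isMaxOn (nonempty_Icc.2 hM.le) hcont₂
  set c := ρ₁ x₀ / ρ₂ x₀ with hc_def
  have hc : 0 < c := div_pos (hpos₁ x₀ hx₀) (hpos₂ x₀ hx₀)
  have hle : ∀ z ∈ Icc (0 : ℝ) M, ρ₁ z ≤ c * ρ₂ z := fun z hz =>
    (div_le_iff₀ (hpos₂ z hz)).1 (hmax hz)
  rcases le_or_gt c 1 with hc1 | hc1
  · exact (hle x hx).trans (mul_le_of_le_one_left (hpos₂ x hx).le hc1)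
  exfalso
  have hn2 : (2 : ℝ) ≤ n := by exact_mod_cast hn
  have hα : (0 : ℝ) < (2 * (n : ℝ) - 2) / (n : ℝ) := div_pos (by linarith) (by linarith)
  have hI := integral_lagrIntegrand_le hn hG hM hc (hint hcont₁ hpos₁) (hint hcont₂ hpos₂)
    hpos₁ hpos₂ hle (fun z hz => hmax₂ hz) hx₀
  have hcα : 1 < c ^ ((2 * (n : ℝ) - 2) / (n : ℝ)) := Real.one_lt_rpow hc1 hα
  have hcγ : c ^ ((2 * (n : ℝ) - 2) / (n : ℝ)) ≤ c ^ γ :=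
    Real.rpow_le_rpow_of_exponent_le hc1.le hγ
  have e₁ : A * ρ₁ x₀ ^ γ = Pinf + ∫ y in x₀..M, lagrIntegrand n G ρ₁ y := heq₁ x₀ hx₀
  have e₂ : A * ρ₂ x₀ ^ γ = Pinf + ∫ y in x₀..M, lagrIntegrand n G ρ₂ y := heq₂ x₀ hx₀
  have e₃ : ρ₁ x₀ ^ γ = c ^ γ * ρ₂ x₀ ^ γ := by
    rw [← Real.mul_rpow hc.le (hpos₂ x₀ hx₀).le, hc_def,
      div_mul_cancel₀ _ (hpos₂ x₀ hx₀).ne']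
  have hpow : 0 < A * ρ₂ x₀ ^ γ := mul_pos hA (Real.rpow_pos_of_pos (hpos₂ x₀ hx₀) _)
  have h3 := mul_le_mul_of_nonneg_right hcγ hpow.le
  have h4 : Pinf < c ^ ((2 * (n : ℝ) - 2) / (n : ℝ)) * Pinf := lt_mul_of_one_lt_left hPinf hcα
  have : A * ρ₁ x₀ ^ γ < A * ρ₁ x₀ ^ γ := calc
    _ = Pinf + ∫ y in x₀..M, lagrIntegrand n G ρ₁ y := e₁
    _ < c ^ ((2 * (n : ℝ) - 2) / (n : ℝ)) * (A * ρ₂ x₀ ^ γ) := by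
      rw [e₂, mul_add]
      linarith
    _ ≤ c ^ γ * (A * ρ₂ x₀ ^ γ) := h3
    _ = A * ρ₁ x₀ ^ γ := by rw [e₃]; ring
  exact this.false

/-- A constant `C` that is a supersolution of the stationary problem. -/
theorem exists_lagr_supersolution {n : ℕ} (hn : 2 ≤ n) {A G Pinf M γ : ℝ} (hA : 0 < A)
    (hM : 0 < M) (hPinf : 0 < Pinf)
    (hcond :
      ((2 * (n : ℝ) - 2) / (n : ℝ) < γ) ∨
      (γ = (2 * (n : ℝ) - 2) / (n : ℝ) ∧
        G * (n : ℝ) ^ ((2 - (n : ℝ)) / (n : ℝ)) * M ^ ((2 : ℝ) / (n : ℝ)) < 2 * A)) (c : ℝ) :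
    ∃ C, 0 < C ∧ c ≤ C ∧
      Pinf + C ^ ((2 * (n : ℝ) - 2) / (n : ℝ)) *
        ∫ y in (0 : ℝ)..M, lagrIntegrand n G (fun _ => 1) y ≤ A * C ^ γ := by
  have hn2 : (2 : ℝ) ≤ n := by exact_mod_cast hn
  have hα : (0 : ℝ) < (2 * (n : ℝ) - 2) / (n : ℝ) := div_pos (by linarith) (by linarith)
  set α := (2 * (n : ℝ) - 2) / (n : ℝ)
  rcases hcond with h | ⟨rfl, h⟩
  · set K := ∫ y in (0 : ℝ)..M, lagrIntegrand n G (fun _ => 1) y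
    obtain ⟨C, h1, h2, h3⟩ := ((Filter.eventually_ge_atTop (1 : ℝ)).and
      ((Filter.eventually_ge_atTop c).and
        ((tendsto_rpow_atTop (sub_pos.2 h)).eventually_ge_atTop ((K + Pinf) / A)))).exists
    have hC : 0 < C := by linarith
    refine ⟨C, hC, h2, ?_⟩
    rw [div_le_iff₀ hA] at h3
    have h4 : C ^ γ = C ^ α * C ^ (γ - α) := by
      rw [← Real.rpow_add hC]
      congr 1
      ring
    have h5 : 1 ≤ C ^ α := Real.one_le_rpow h1 hα.le
    rw [h4]
    nlinarith [mul_le_mul_of_nonneg_left h3 (zero_le_one.trans h5),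
      mul_le_mul_of_nonneg_right h5 hPinf.le]
  · rw [integral_lagrIntegrand_one hn hM]
    set K := G * (n : ℝ) ^ ((2 - (n : ℝ)) / (n : ℝ)) * M ^ ((2 : ℝ) / (n : ℝ))
    have hd : 0 < A - K / 2 := by linarith
    obtain ⟨C, h1, h2, h3⟩ := ((Filter.eventually_gt_atTop (0 : ℝ)).and
      ((Filter.eventually_ge_atTop c).and
        ((tendsto_rpow_atTop hα).eventually_ge_atTop (Pinf / (A - K / 2))))).exists
    refine ⟨C, h1, h2, ?_⟩
    rw [div_le_iff₀ hd] at h3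
    linarith

/-- Existence, by the Knaster–Tarski argument: the supremum of all antitone subsolutions
lying between two constants is a solution. -/
theorem exists_isLagrStationary {n : ℕ} (hn : 2 ≤ n) {A G Pinf M γ : ℝ} (hA : 0 < A)
    (hG : 0 < G) (hPinf : 0 < Pinf) (hM : 0 < M) (hγ : 0 < γ)
    (hsuper : ∀ c : ℝ, ∃ C, 0 < C ∧ c ≤ C ∧
      Pinf + C ^ ((2 * (n : ℝ) - 2) / (n : ℝ)) *
        ∫ y in (0 : ℝ)..M, lagrIntegrand n G (fun _ => 1) y ≤ A * C ^ γ) :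
    ∃ ρ : ℝ → ℝ, IsLagrStationary n A G Pinf M γ ρ := by
  set S : (ℝ → ℝ) → ℝ → ℝ := fun ρ x => Pinf + ∫ y in x..M, lagrIntegrand n G ρ y with hS
  set T : (ℝ → ℝ) → ℝ → ℝ := fun ρ x => (S ρ x / A) ^ γ⁻¹ with hT
  set c : ℝ := (Pinf / A) ^ γ⁻¹
  have hc : 0 < c := Real.rpow_pos_of_pos (div_pos hPinf hA) _
  have hγ' : 0 ≤ γ⁻¹ := (inv_pos.2 hγ).le
  obtain ⟨C, hC, hcC, hCsuper⟩ := hsuper c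
  have h0M : (0 : ℝ) ∈ Icc (0 : ℝ) M := ⟨le_rfl, hM.le⟩
  let Q : (ℝ → ℝ) → Prop := fun ρ =>
    AntitoneOn ρ (Icc 0 M) ∧ ∀ x ∈ Icc (0 : ℝ) M, c ≤ ρ x ∧ ρ x ≤ C
  have Qpos : ∀ {ρ}, Q ρ → ∀ x ∈ Icc (0 : ℝ) M, 0 < ρ x := fun h x hx =>
    hc.trans_le (h.2 x hx).1
  have Qint : ∀ {ρ}, Q ρ → IntervalIntegrable (fun z => (ρ z)⁻¹) volume 0 M := by
    intro ρ h
    refine MonotoneOn.intervalIntegrable ?_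
    rw [uIcc_of_le hM.le]
    intro x hx y hy hxy
    exact inv_anti₀ (Qpos h y hy) (h.1 hx hy hxy)
  have QintF : ∀ {ρ}, Q ρ → IntervalIntegrable (lagrIntegrand n G ρ) volume 0 M := fun h =>
    intervalIntegrable_lagrIntegrand hn hG hM hC (Qint h) (Qpos h) fun x hx => (h.2 x hx).2
  have Sge : ∀ {ρ}, Q ρ → ∀ x ∈ Icc (0 : ℝ) M, Pinf ≤ S ρ x := fun h x hx =>
    le_add_of_nonneg_right (integral_lagrIntegrand_nonneg hG (Qpos h) hx)
  have Santi : ∀ {ρ}, Q ρ → AntitoneOn (S ρ) (Icc 0 M) := by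
    intro ρ h x hx y hy hxy
    have hsub : ∀ {a b : ℝ}, a ∈ Icc (0 : ℝ) M → b ∈ Icc (0 : ℝ) M → uIcc a b ⊆ uIcc 0 M := by
      intro a b ha hb
      rw [uIcc_of_le hM.le]
      exact uIcc_subset_Icc ha hb
    have hMM : M ∈ Icc (0 : ℝ) M := ⟨hM.le, le_rfl⟩
    have hadd := integral_add_adjacent_intervals ((QintF h).mono_set (hsub hx hy))
      ((QintF h).mono_set (hsub hy hMM))
    have hnn : 0 ≤ ∫ z in x..y, lagrIntegrand n G ρ z := integral_nonneg hxy fun z hz =>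
      lagrIntegrand_nonneg hG (Qpos h) ⟨hx.1.trans hz.1, hz.2.trans hy.2⟩
    simp only [hS]
    linarith
  have Smono : ∀ {ρ₁ ρ₂}, Q ρ₁ → Q ρ₂ → (∀ x ∈ Icc (0 : ℝ) M, ρ₁ x ≤ ρ₂ x) →
      ∀ x ∈ Icc (0 : ℝ) M, S ρ₁ x ≤ S ρ₂ x := by
    intro ρ₁ ρ₂ h₁ h₂ hle x hx
    have := integral_lagrIntegrand_le hn hG hM one_pos (Qint h₁) (Qint h₂) (Qpos h₁) (Qpos h₂)
      (by simpa using hle) (fun z hz => (h₂.2 z hz).2) hx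
    rw [Real.one_rpow, one_mul] at this
    simp only [hS]
    linarith
  have Sle : ∀ {ρ}, Q ρ → ∀ x ∈ Icc (0 : ℝ) M, S ρ x ≤ A * C ^ γ := by
    intro ρ h x hx
    have := integral_lagrIntegrand_le hn hG hM hC (Qint h) (ρ₂ := fun _ => 1) (by simp) (Qpos h)
      (by simp) (fun z hz => by simpa using (h.2 z hz).2) (fun z _ => le_rfl) h0M
    have h2 := Santi h h0M hx hx.1
    simp only [hS] at h2 ⊢
    linarith
  have Tmono : ∀ {a b : ℝ}, 0 ≤ a → a ≤ b → (a / A) ^ γ⁻¹ ≤ (b / A) ^ γ⁻¹ := fun ha hab =>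
    Real.rpow_le_rpow (div_nonneg ha hA.le) (div_le_div_of_nonneg_right hab hA.le) hγ'
  have TQ : ∀ {ρ}, Q ρ → Q (T ρ) := by
    intro ρ h
    refine ⟨fun x hx y hy hxy => Tmono (hPinf.le.trans (Sge h y hy)) (Santi h hx hy hxy),
      fun x hx => ⟨Tmono hPinf.le (Sge h x hx), ?_⟩⟩
    have := Tmono (hPinf.le.trans (Sge h x hx)) (Sle h x hx)
    rwa [mul_div_cancel_left₀ _ hA.ne', Real.rpow_rpow_inv hC.le hγ.ne'] at this
  let sub : Set (ℝ → ℝ) := {ρ | Q ρ ∧ ∀ x ∈ Icc (0 : ℝ) M, ρ x ≤ T ρ x}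
  have hcsub : (fun _ => c) ∈ sub := by
    have hQ : Q (fun _ => c) := ⟨antitoneOn_const, fun _ _ => ⟨le_rfl, hcC⟩⟩
    exact ⟨hQ, fun x hx => ((TQ hQ).2 x hx).1⟩
  set σ : ℝ → ℝ := fun x => sSup ((fun ρ : ℝ → ℝ => ρ x) '' sub)
  have hne : ∀ x, ((fun ρ : ℝ → ℝ => ρ x) '' sub).Nonempty := fun x => ⟨_, _, hcsub, rfl⟩
  have le_σ : ∀ ρ ∈ sub, ∀ x ∈ Icc (0 : ℝ) M, ρ x ≤ σ x := by
    intro ρ hρ x hx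
    refine le_csSup ⟨C, ?_⟩ ⟨ρ, hρ, rfl⟩
    rintro _ ⟨ρ', hρ', rfl⟩
    exact (hρ'.1.2 x hx).2
  have σ_le : ∀ (x b : ℝ), (∀ ρ ∈ sub, ρ x ≤ b) → σ x ≤ b := by
    intro x b h
    refine csSup_le (hne x) ?_
    rintro _ ⟨ρ, hρ, rfl⟩
    exact h ρ hρ
  have Qσ : Q σ := ⟨fun x hx y hy hxy => σ_le y _ fun ρ hρ =>
      (hρ.1.1 hx hy hxy).trans (le_σ ρ hρ x hx),
    fun x hx => ⟨le_σ _ hcsub x hx, σ_le x _ fun ρ hρ => (hρ.1.2 x hx).2⟩⟩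
  have TTmono : ∀ {ρ₁ ρ₂}, Q ρ₁ → Q ρ₂ → (∀ x ∈ Icc (0 : ℝ) M, ρ₁ x ≤ ρ₂ x) →
      ∀ x ∈ Icc (0 : ℝ) M, T ρ₁ x ≤ T ρ₂ x := fun h₁ h₂ hle x hx =>
    Tmono (hPinf.le.trans (Sge h₁ x hx)) (Smono h₁ h₂ hle x hx)
  have hσT : ∀ x ∈ Icc (0 : ℝ) M, σ x ≤ T σ x := fun x hx => σ_le x _ fun ρ hρ =>
    (hρ.2 x hx).trans (TTmono hρ.1 Qσ (le_σ ρ hρ) x hx)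
  have hTσ : ∀ x ∈ Icc (0 : ℝ) M, T σ x ≤ σ x :=
    le_σ (T σ) ⟨TQ Qσ, TTmono Qσ (TQ Qσ) hσT⟩
  have hfix : ∀ x ∈ Icc (0 : ℝ) M, σ x = T σ x := fun x hx => (hσT x hx).antisymm (hTσ x hx)
  refine ⟨σ, ?_, Qpos Qσ, fun x hx => ?_⟩
  · have hScont : ContinuousOn (S σ) (Icc 0 M) := by
      have := continuousOn_primitive_interval' (QintF Qσ) right_mem_uIcc
      rw [uIcc_of_le hM.le] at this
      refine ((continuousOn_const (c := Pinf)).add this.neg).congr fun x _ => ?_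
      simp only [hS, Pi.add_apply, Pi.neg_apply, integral_symm x M, neg_neg]
    exact ((hScont.div_const A).rpow_const fun x _ => Or.inr hγ').congr hfix
  · have hnn : 0 ≤ S σ x / A := div_nonneg (hPinf.le.trans (Sge Qσ x hx)) hA.le
    calc A * σ x ^ γ = A * T σ x ^ γ := by rw [← hfix x hx]
      _ = A * (S σ x / A) := by rw [hT, Real.rpow_inv_rpow hnn hγ.ne']
      _ = S σ x := mul_div_cancel₀ _ hA.ne'

/-- Existence and uniqueness of the positive solution of the Lagrangian stationary
problem, when `γ > (2n−2)/n`, or `γ = (2n−2)/n` and `G n^((2−n)/n) M^(2/n) < 2A`. -/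
theorem stationary_existence_uniqueness
    (n : ℕ) (hn : 2 ≤ n) (A G Pinf M γ : ℝ)
    (hA : 0 < A) (hG : 0 < G) (hPinf : 0 < Pinf) (hM : 0 < M)
    (hcond :
      ((2 * (n : ℝ) - 2) / (n : ℝ) < γ) ∨
      (γ = (2 * (n : ℝ) - 2) / (n : ℝ) ∧
        G * (n : ℝ) ^ ((2 - (n : ℝ)) / (n : ℝ)) * M ^ ((2 : ℝ) / (n : ℝ)) < 2 * A)) :
    (∃ ρ : ℝ → ℝ, IsLagrStationary n A G Pinf M γ ρ) ∧
      ∀ ρ₁ ρ₂ : ℝ → ℝ, IsLagrStationary n A G Pinf M γ ρ₁ →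
        IsLagrStationary n A G Pinf M γ ρ₂ →
        ∀ x ∈ Set.Icc (0 : ℝ) M, ρ₁ x = ρ₂ x := by
  have hn2 : (2 : ℝ) ≤ n := by exact_mod_cast hn
  have hα : (0 : ℝ) < (2 * (n : ℝ) - 2) / (n : ℝ) := div_pos (by linarith) (by linarith)
  have hγ : (2 * (n : ℝ) - 2) / (n : ℝ) ≤ γ := hcond.elim le_of_lt fun h => h.1.ge
  exact ⟨exists_isLagrStationary hn hA hG hPinf hM (hα.trans_le hγ)
      (exists_lagr_supersolution hn hA hM hPinf hcond),
    fun ρ₁ ρ₂ h₁ h₂ x hx =>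
      (h₁.le hn hA hG hPinf hM hγ h₂ hx).antisymm (h₂.le hn hA hG hPinf hM hγ h₁ hx)⟩
end

section
/- Let n ≥ 2 be an integer, A, G, P∞ > 0, γ > 0, M > 0, and σ > 0. Let M₀ ∈ (0, M] satisfy A σ^γ − (G/2) n^((2−n)/n) σ^((2n−2)/n) M₀^(2/n) ≥ A (σ/2)^γ. Then there exists a continuous function ρ : [0, M₀] → [σ/2, σ] such that, with V(x) = ∫_0^x ρ(y)^(−1) dy, the integral equation A ρ(x)^γ = A σ^γ − ∫_0^x G y (n V(y))^((2−2n)/n) dy holds for all x ∈ (0, M₀], and moreover V(x) ∈ [x/σ, 2x/σ] for all x ∈ [0,M₀]. Furthermore the solution is unique: if ρ₁ : [0,M₁] → (0,∞) and ρ₂ : [0,M₂] → (0,∞) are continuous functions, each satisfying this integral equation (with its own V_i(x) = ∫_0^x ρ_i^(−1)) on its interval, then ρ₁(x) = ρ₂(x) for all x ∈ [0, min(M₁, M₂)]. -/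
open MeasureTheory intervalIntegral Set

/-- `ρ` is a positive continuous solution on `[0,M₁]` of the shooting Cauchy problem
`A ρ(x)^γ = A σ^γ − ∫_0^x G y (n V(y))^((2−2n)/n) dy` with `V(x) = ∫_0^x ρ(y)⁻¹ dy`. -/
def IsShootingSolution (n : ℕ) (A G γ σ M₁ : ℝ) (ρ : ℝ → ℝ) : Prop :=
  ContinuousOn ρ (Set.Icc 0 M₁) ∧ (∀ x ∈ Set.Icc (0 : ℝ) M₁, 0 < ρ x) ∧
    ∀ x ∈ Set.Ioc (0 : ℝ) M₁,
      A * ρ x ^ γ = A * σ ^ γ -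
        ∫ y in (0 : ℝ)..x,
          G * y * ((n : ℝ) * ∫ z in (0 : ℝ)..y, (ρ z)⁻¹) ^ ((2 - 2 * (n : ℝ)) / (n : ℝ))

/-- The volume `V(y) = ∫_0^y f⁻¹` occupied by the mass `y` when the density is `f`. -/
noncomputable def massVolume (f : ℝ → ℝ) (y : ℝ) : ℝ := ∫ z in (0 : ℝ)..y, (f z)⁻¹

/-- The gravitational force density `G y (c V(y))^q` generated by the density `f`. -/
noncomputable def gravForce (G c q : ℝ) (f : ℝ → ℝ) (y : ℝ) : ℝ :=
  G * y * (c * massVolume f y) ^ q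

/-- `f` is continuous on `[0,L]` with values in `[a,b]`. -/
structure IsBoundedDensity (a b L : ℝ) (f : ℝ → ℝ) : Prop where
  continuousOn : ContinuousOn f (Icc 0 L)
  le : ∀ x ∈ Icc (0 : ℝ) L, a ≤ f x
  ge : ∀ x ∈ Icc (0 : ℝ) L, f x ≤ b

lemma abs_rpow_sub_rpow_le {p m M B s t : ℝ} (hm : 0 < m)
    (hB : ∀ x ∈ Icc m M, x ^ (p - 1) ≤ B) (hs : s ∈ Icc m M) (ht : t ∈ Icc m M) :
    |s ^ p - t ^ p| ≤ |p| * B * |s - t| := by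
  have key := Convex.norm_image_sub_le_of_norm_hasDerivWithin_le
    (f := fun x : ℝ => x ^ p) (f' := fun x => p * x ^ (p - 1)) (s := Icc m M) (C := |p| * B)
    (fun x hx => (Real.hasDerivAt_rpow_const (Or.inl (hm.trans_le hx.1).ne')).hasDerivWithinAt)
    (fun x hx => by
      rw [Real.norm_eq_abs, abs_mul, abs_of_nonneg (Real.rpow_nonneg (hm.le.trans hx.1) _)]
      exact mul_le_mul_of_nonneg_left (hB x hx) (abs_nonneg p))
    (convex_Icc m M) ht hs
  simpa only [Real.norm_eq_abs] using key

lemma exists_abs_sub_le_mul_abs_rpow_sub_rpow {γ a b : ℝ} (hγ : 0 < γ) (ha : 0 < a) :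
    ∃ C, 0 ≤ C ∧ ∀ s ∈ Icc a b, ∀ t ∈ Icc a b, |s - t| ≤ C * |s ^ γ - t ^ γ| := by
  have hm : 0 < a ^ γ := Real.rpow_pos_of_pos ha γ
  have hcont : ContinuousOn (fun x : ℝ => x ^ (γ⁻¹ - 1)) (Icc (a ^ γ) (b ^ γ)) := fun x hx =>
    (Real.continuousAt_rpow_const _ _ (Or.inl (hm.trans_le hx.1).ne')).continuousWithinAt
  obtain ⟨B, hB⟩ := isCompact_Icc.bddAbove_image hcont
  refine ⟨|γ⁻¹| * max B 0, by positivity, fun s hs t ht => ?_⟩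
  have hmem : ∀ r ∈ Icc a b, r ^ γ ∈ Icc (a ^ γ) (b ^ γ) := fun r hr =>
    ⟨Real.rpow_le_rpow ha.le hr.1 hγ.le, Real.rpow_le_rpow (ha.le.trans hr.1) hr.2 hγ.le⟩
  have key := abs_rpow_sub_rpow_le (p := γ⁻¹) hm
    (fun x hx => (hB (mem_image_of_mem _ hx)).trans (le_max_left B 0)) (hmem s hs) (hmem t ht)
  rwa [Real.rpow_rpow_inv (ha.le.trans hs.1) hγ.ne',
    Real.rpow_rpow_inv (ha.le.trans ht.1) hγ.ne'] at key

lemma exists_forall_exp_integral_le {p E : ℝ} (hp : -1 < p) (hE : 0 ≤ E) :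
    ∃ l, 0 ≤ l ∧ ∀ x, 0 ≤ x →
      IntervalIntegrable (fun y => y ^ p * Real.exp (l * y ^ (p + 1))) volume 0 x ∧
      E * ∫ y in (0 : ℝ)..x, y ^ p * Real.exp (l * y ^ (p + 1)) ≤
        2⁻¹ * Real.exp (l * x ^ (p + 1)) := by
  have hp1 : 0 < p + 1 := by linarith
  refine ⟨2 * (E + 1) / (p + 1), by positivity, fun x hx => ?_⟩
  set l := 2 * (E + 1) / (p + 1) with hl
  have hl0 : 0 < l := by positivity
  have hcont : Continuous fun y : ℝ => Real.exp (l * y ^ (p + 1)) :=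
    Real.continuous_exp.comp (continuous_const.mul (Real.continuous_rpow_const hp1.le))
  have hint : IntervalIntegrable (fun y => y ^ p * Real.exp (l * y ^ (p + 1))) volume 0 x :=
    (intervalIntegral.intervalIntegrable_rpow' hp).mul_continuousOn hcont.continuousOn
  refine ⟨hint, ?_⟩
  have hFTC := integral_eq_sub_of_hasDerivAt_of_le hx
    (f := fun y => (l * (p + 1))⁻¹ * Real.exp (l * y ^ (p + 1)))
    (continuous_const.mul hcont).continuousOn
    (fun y hy => by
      have h1 := (((Real.hasDerivAt_rpow_const (p := p + 1) (Or.inl hy.1.ne')).const_mul l).exp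
        ).const_mul (l * (p + 1))⁻¹
      refine h1.congr_deriv ?_
      rw [add_sub_cancel_right]
      field_simp) hint
  rw [hFTC]
  have hle : E * (l * (p + 1))⁻¹ ≤ 2⁻¹ := by
    have : l * (p + 1) = 2 * (E + 1) := by rw [hl]; field_simp
    rw [this, ← div_eq_mul_inv, div_le_iff₀ (by positivity)]
    linarith
  have h0 : 0 ≤ E * ((l * (p + 1))⁻¹ * Real.exp (l * 0 ^ (p + 1))) := by positivity
  calc _ = E * (l * (p + 1))⁻¹ * Real.exp (l * x ^ (p + 1)) -
        E * ((l * (p + 1))⁻¹ * Real.exp (l * 0 ^ (p + 1))) := by ring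
    _ ≤ E * (l * (p + 1))⁻¹ * Real.exp (l * x ^ (p + 1)) := by linarith
    _ ≤ _ := mul_le_mul_of_nonneg_right hle (Real.exp_nonneg _)

namespace IsBoundedDensity

variable {a b L : ℝ} {f g : ℝ → ℝ}

lemma mono (hf : IsBoundedDensity a b L f) {y : ℝ} (hy : y ≤ L) : IsBoundedDensity a b y f :=
  ⟨hf.continuousOn.mono (Icc_subset_Icc_right hy), fun x hx => hf.le x ⟨hx.1, hx.2.trans hy⟩,
    fun x hx => hf.ge x ⟨hx.1, hx.2.trans hy⟩⟩

lemma weaken (hf : IsBoundedDensity a b L f) {a' b' : ℝ} (ha : a' ≤ a) (hb : b ≤ b') :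
    IsBoundedDensity a' b' L f :=
  ⟨hf.continuousOn, fun x hx => ha.trans (hf.le x hx), fun x hx => (hf.ge x hx).trans hb⟩

lemma continuousOn_inv (hf : IsBoundedDensity a b L f) (ha : 0 < a) :
    ContinuousOn (fun z => (f z)⁻¹) (Icc 0 L) :=
  hf.continuousOn.inv₀ fun x hx => (ha.trans_le (hf.le x hx)).ne'

lemma intervalIntegrable_inv (hf : IsBoundedDensity a b L f) (ha : 0 < a) {y : ℝ}
    (hy : y ∈ Icc 0 L) : IntervalIntegrable (fun z => (f z)⁻¹) volume 0 y :=
  ((hf.mono hy.2).continuousOn_inv ha).intervalIntegrable_of_Icc hy.1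

lemma div_le_massVolume (hf : IsBoundedDensity a b L f) (ha : 0 < a) {y : ℝ}
    (hy : y ∈ Icc 0 L) : y / b ≤ massVolume f y := by
  have h := integral_mono_on hy.1 (intervalIntegrable_const (c := b⁻¹))
    (hf.intervalIntegrable_inv ha hy) fun z hz =>
      inv_anti₀ (ha.trans_le ((hf.mono hy.2).le z hz)) ((hf.mono hy.2).ge z hz)
  simpa [massVolume, div_eq_mul_inv] using h

lemma massVolume_le_div (hf : IsBoundedDensity a b L f) (ha : 0 < a) {y : ℝ}
    (hy : y ∈ Icc 0 L) : massVolume f y ≤ y / a := by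
  have h := integral_mono_on hy.1 (hf.intervalIntegrable_inv ha hy)
    (intervalIntegrable_const (c := a⁻¹)) fun z hz => inv_anti₀ ha ((hf.mono hy.2).le z hz)
  simpa [massVolume, div_eq_mul_inv] using h

lemma continuousOn_massVolume (hf : IsBoundedDensity a b L f) (ha : 0 < a) (hL : 0 ≤ L) :
    ContinuousOn (massVolume f) (Icc 0 L) := by
  have h := continuousOn_primitive_interval (μ := volume) (a := 0) (b := L)
    (f := fun z => (f z)⁻¹)
    (by rw [uIcc_of_le hL]; exact (hf.continuousOn_inv ha).integrableOn_Icc)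
  rwa [uIcc_of_le hL] at h

lemma abs_massVolume_sub_le (hf : IsBoundedDensity a b L f) (hg : IsBoundedDensity a b L g)
    (ha : 0 < a) {y E : ℝ} (hy : y ∈ Icc 0 L) (hfg : ∀ z ∈ Icc 0 y, |f z - g z| ≤ E) :
    |massVolume f y - massVolume g y| ≤ E / a ^ 2 * y := by
  rw [massVolume, massVolume,
    ← integral_sub (hf.intervalIntegrable_inv ha hy) (hg.intervalIntegrable_inv ha hy),
    ← Real.norm_eq_abs]
  have h := norm_integral_le_of_norm_le_const (a := 0) (b := y)
    (f := fun z => (f z)⁻¹ - (g z)⁻¹) (C := E / a ^ 2) fun z hz => ?_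
  · rwa [sub_zero, abs_of_nonneg hy.1] at h
  rw [uIoc_of_le hy.1] at hz
  have hz' : z ∈ Icc 0 y := ⟨hz.1.le, hz.2⟩
  have hfz := (hf.mono hy.2).le z hz'
  have hgz := (hg.mono hy.2).le z hz'
  rw [Real.norm_eq_abs, inv_sub_inv (ha.trans_le hfz).ne' (ha.trans_le hgz).ne', abs_div,
    abs_of_pos (mul_pos (ha.trans_le hfz) (ha.trans_le hgz)), abs_sub_comm]
  have : a ^ 2 ≤ f z * g z := by nlinarith
  exact div_le_div₀ ((abs_nonneg _).trans (hfg z hz')) (hfg z hz') (by positivity) this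

variable {G c q : ℝ}

lemma gravForce_nonneg (hf : IsBoundedDensity a b L f) (ha : 0 < a) (hb : 0 < b) (hG : 0 < G)
    (hc : 0 < c) {y : ℝ} (hy : y ∈ Icc 0 L) : 0 ≤ gravForce G c q f y := by
  have hV : 0 ≤ massVolume f y := (div_nonneg hy.1 hb.le).trans (hf.div_le_massVolume ha hy)
  exact mul_nonneg (mul_nonneg hG.le hy.1) (Real.rpow_nonneg (mul_nonneg hc.le hV) q)

lemma gravForce_le (hf : IsBoundedDensity a b L f) (ha : 0 < a) (hb : 0 < b) (hG : 0 < G)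
    (hc : 0 < c) (hq : q < 0) {y : ℝ} (hy : y ∈ Ioc 0 L) :
    gravForce G c q f y ≤ G * (c / b) ^ q * y ^ (q + 1) := by
  have hV := hf.div_le_massVolume ha ⟨hy.1.le, hy.2⟩
  have hy0 : 0 < y := hy.1
  calc gravForce G c q f y ≤ G * y * (c * (y / b)) ^ q := by
        refine mul_le_mul_of_nonneg_left ?_ (by positivity)
        exact Real.rpow_le_rpow_of_nonpos (by positivity)
          (mul_le_mul_of_nonneg_left hV hc.le) hq.le
    _ = G * (c / b) ^ q * y ^ (q + 1) := by
        rw [show c * (y / b) = c / b * y by ring, Real.mul_rpow (by positivity) hy0.le,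
          Real.rpow_add_one hy0.ne']
        ring

lemma continuousOn_gravForce (hf : IsBoundedDensity a b L f) (ha : 0 < a) (hb : 0 < b)
    (hc : 0 < c) : ContinuousOn (gravForce G c q f) (Ioc 0 L) := by
  rcases le_or_gt L 0 with hL | hL
  · simp [Ioc_eq_empty_of_le hL]
  refine (continuousOn_const.mul continuousOn_id).mul (ContinuousOn.rpow_const
    (continuousOn_const.mul ((hf.continuousOn_massVolume ha hL.le).mono Ioc_subset_Icc_self))
    fun y hy => Or.inl ?_)
  exact (mul_pos hc ((div_pos hy.1 hb).trans_le
    (hf.div_le_massVolume ha ⟨hy.1.le, hy.2⟩))).ne'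

lemma intervalIntegrable_gravForce (hf : IsBoundedDensity a b L f) (ha : 0 < a) (hb : 0 < b)
    (hG : 0 < G) (hc : 0 < c) (hq : q < 0) (hq2 : -2 < q) (hL : 0 ≤ L) :
    IntervalIntegrable (gravForce G c q f) volume 0 L := by
  have hdom : IntervalIntegrable (fun y : ℝ => G * (c / b) ^ q * y ^ (q + 1)) volume 0 L :=
    (intervalIntegrable_rpow' (by linarith)).const_mul _
  rw [intervalIntegrable_iff_integrableOn_Ioc_of_le hL] at hdom ⊢
  refine hdom.mono' ((hf.continuousOn_gravForce ha hb hc).aestronglyMeasurable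
    measurableSet_Ioc) ?_
  filter_upwards [ae_restrict_mem measurableSet_Ioc] with y hy
  rw [Real.norm_eq_abs, abs_of_nonneg (hf.gravForce_nonneg ha hb hG hc ⟨hy.1.le, hy.2⟩)]
  exact hf.gravForce_le ha hb hG hc hq hy

lemma integral_gravForce_nonneg (hf : IsBoundedDensity a b L f) (ha : 0 < a) (hb : 0 < b)
    (hG : 0 < G) (hc : 0 < c) (hL : 0 ≤ L) : 0 ≤ ∫ y in (0 : ℝ)..L, gravForce G c q f y :=
  integral_nonneg hL fun _ hy => hf.gravForce_nonneg ha hb hG hc hy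

lemma integral_gravForce_le (hf : IsBoundedDensity a b L f) (ha : 0 < a) (hb : 0 < b)
    (hG : 0 < G) (hc : 0 < c) (hq : q < 0) (hq2 : -2 < q) (hL : 0 ≤ L) :
    ∫ y in (0 : ℝ)..L, gravForce G c q f y ≤
      G * (c / b) ^ q * (L ^ (q + 2) / (q + 2)) := by
  have h := integral_mono_on_of_le_Ioo hL
    (hf.intervalIntegrable_gravForce (q := q) ha hb hG hc hq hq2 hL)
    ((intervalIntegrable_rpow' (r := q + 1) (by linarith)).const_mul (G * (c / b) ^ q))
    fun y hy => hf.gravForce_le ha hb hG hc hq ⟨hy.1, hy.2.le⟩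
  rwa [intervalIntegral.integral_const_mul, integral_rpow (Or.inl (by linarith)),
    show q + 1 + 1 = q + 2 by ring, Real.zero_rpow (by linarith), sub_zero] at h

lemma continuousOn_integral_gravForce (hf : IsBoundedDensity a b L f) (ha : 0 < a) (hb : 0 < b)
    (hG : 0 < G) (hc : 0 < c) (hq : q < 0) (hq2 : -2 < q) (hL : 0 ≤ L) :
    ContinuousOn (fun x => ∫ y in (0 : ℝ)..x, gravForce G c q f y) (Icc 0 L) := by
  have h := continuousOn_primitive_interval' (hf.intervalIntegrable_gravForce (q := q) ha hb hG hc
    hq hq2 hL) left_mem_uIcc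
  rwa [uIcc_of_le hL] at h

lemma abs_gravForce_sub_le (hf : IsBoundedDensity a b L f) (hg : IsBoundedDensity a b L g)
    (ha : 0 < a) (hb : 0 < b) (hG : 0 < G) (hc : 0 < c) (hq : q < 0) {y E : ℝ}
    (hy : y ∈ Ioc 0 L) (hfg : ∀ z ∈ Icc 0 y, |f z - g z| ≤ E) :
    |gravForce G c q f y - gravForce G c q g y| ≤
      G * |q| * (c / b) ^ (q - 1) * c / a ^ 2 * (y ^ (q + 1) * E) := by
  have hy0 : 0 < y := hy.1
  have hy' : y ∈ Icc 0 L := ⟨hy.1.le, hy.2⟩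
  have hm : 0 < c * (y / b) := by positivity
  set M := c * (y / a)
  have hmem : ∀ {h}, IsBoundedDensity a b L h → c * massVolume h y ∈ Icc (c * (y / b)) M :=
    fun hh => ⟨mul_le_mul_of_nonneg_left (hh.div_le_massVolume ha hy') hc.le,
      mul_le_mul_of_nonneg_left (hh.massVolume_le_div ha hy') hc.le⟩
  have h1 := abs_rpow_sub_rpow_le (p := q) hm
    (fun x hx => Real.rpow_le_rpow_of_nonpos hm hx.1 (by linarith : q - 1 ≤ 0))
    (hmem hf) (hmem hg)
  have h2 := hf.abs_massVolume_sub_le hg ha hy' hfg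
  rw [← mul_sub, abs_mul, abs_of_pos hc] at h1
  calc |gravForce G c q f y - gravForce G c q g y|
      = G * y * |(c * massVolume f y) ^ q - (c * massVolume g y) ^ q| := by
        rw [gravForce, gravForce, ← mul_sub, abs_mul, abs_of_pos (by positivity)]
    _ ≤ G * y * (|q| * (c * (y / b)) ^ (q - 1) * (c * (E / a ^ 2 * y))) := by
        gcongr
        exact h1.trans (by gcongr)
    _ = _ := by
        rw [show c * (y / b) = c / b * y by ring, Real.mul_rpow (by positivity) hy0.le,
          show q + 1 = q - 1 + 1 + 1 by ring, Real.rpow_add_one hy0.ne',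
          Real.rpow_add_one hy0.ne']
        ring

end IsBoundedDensity

/-- Two densities `F`, `H` obtained from `f`, `g` by one Picard step are closer than `f`, `g` by
a factor `1/2`, in a suitable exponentially weighted uniform distance. -/
lemma exists_weight_forall_abs_sub_le {a b A G c q γ s : ℝ} (ha : 0 < a) (hb : 0 < b)
    (hA : 0 < A) (hG : 0 < G) (hc : 0 < c) (hq : q < 0) (hq2 : -2 < q) (hγ : 0 < γ) :
    ∃ w : ℝ → ℝ, Continuous w ∧ (∀ x, 0 ≤ x → 1 ≤ w x) ∧ ∀ {L : ℝ} {f g F H : ℝ → ℝ},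
      IsBoundedDensity a b L f → IsBoundedDensity a b L g →
      IsBoundedDensity a b L F → IsBoundedDensity a b L H →
      (∀ x ∈ Icc 0 L, A * F x ^ γ = s - ∫ y in (0 : ℝ)..x, gravForce G c q f y) →
      (∀ x ∈ Icc 0 L, A * H x ^ γ = s - ∫ y in (0 : ℝ)..x, gravForce G c q g y) →
      ∀ D, 0 ≤ D → (∀ x ∈ Icc 0 L, |f x - g x| ≤ D * w x) →
        ∀ x ∈ Icc 0 L, |F x - H x| ≤ D / 2 * w x := by
  obtain ⟨C, hC, hlip⟩ := exists_abs_sub_le_mul_abs_rpow_sub_rpow (b := b) hγ ha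
  set B := G * |q| * (c / b) ^ (q - 1) * c / a ^ 2
  have hB : 0 ≤ B := by positivity
  obtain ⟨l, hl, hexp⟩ := exists_forall_exp_integral_le (p := q + 1) (E := C / A * B)
    (by linarith) (by positivity)
  refine ⟨fun x => Real.exp (l * x ^ (q + 1 + 1)),
    Real.continuous_exp.comp (continuous_const.mul (Real.continuous_rpow_const (by linarith))),
    fun x hx => Real.one_le_exp (by positivity), ?_⟩
  intro L f g F H hf hg hF hH hFf hHg D hD hfg x hx
  obtain ⟨hint, hbound⟩ := hexp x hx.1
  have hfi := (hf.mono hx.2).intervalIntegrable_gravForce ha hb hG hc hq hq2 hx.1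
  have hgi := (hg.mono hx.2).intervalIntegrable_gravForce ha hb hG hc hq hq2 hx.1
  have hdiff : |∫ y in (0 : ℝ)..x, (gravForce G c q f y - gravForce G c q g y)| ≤
      B * D * ∫ y in (0 : ℝ)..x, y ^ (q + 1) * Real.exp (l * y ^ (q + 1 + 1)) := by
    rw [← intervalIntegral.integral_const_mul, ← Real.norm_eq_abs]
    refine norm_integral_le_of_norm_le hx.1 (Filter.Eventually.of_forall fun y hy => ?_)
      (hint.const_mul _)
    refine ((hf.abs_gravForce_sub_le hg ha hb hG hc hq ⟨hy.1, hy.2.trans hx.2⟩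
      (E := D * Real.exp (l * y ^ (q + 1 + 1))) fun z hz => ?_)).trans_eq (by ring)
    refine (hfg z ⟨hz.1, hz.2.trans (hy.2.trans hx.2)⟩).trans ?_
    have := Real.rpow_le_rpow hz.1 hz.2 (by linarith : 0 ≤ q + 1 + 1)
    dsimp only
    gcongr
  rw [intervalIntegral.integral_sub hfi hgi] at hdiff
  have hrpow : F x ^ γ - H x ^ γ = -A⁻¹ * ((∫ y in (0 : ℝ)..x, gravForce G c q f y) -
      ∫ y in (0 : ℝ)..x, gravForce G c q g y) := by
    field_simp
    linarith [hFf x hx, hHg x hx]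
  have h1 := hlip _ ⟨hF.le x hx, hF.ge x hx⟩ _ ⟨hH.le x hx, hH.ge x hx⟩
  rw [hrpow, abs_mul, abs_neg, abs_of_pos (inv_pos.2 hA)] at h1
  calc |F x - H x| ≤ C * (A⁻¹ * (B * D *
        ∫ y in (0 : ℝ)..x, y ^ (q + 1) * Real.exp (l * y ^ (q + 1 + 1)))) := h1.trans (by gcongr)
    _ = D * (C / A * B * ∫ y in (0 : ℝ)..x, y ^ (q + 1) * Real.exp (l * y ^ (q + 1 + 1))) := by
        ring
    _ ≤ D * (2⁻¹ * Real.exp (l * x ^ (q + 1 + 1))) := by gcongr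
    _ = _ := by ring

lemma exists_fixed_density {a b A G c q γ s L : ℝ} (ha : 0 < a) (hab : a ≤ b)
    (hA : 0 < A) (hG : 0 < G) (hc : 0 < c) (hq : q < 0) (hq2 : -2 < q) (hγ : 0 < γ)
    (hL : 0 ≤ L) (hs : s ≤ A * b ^ γ)
    (hLs : A * a ^ γ ≤ s - G * (c / b) ^ q * (L ^ (q + 2) / (q + 2))) :
    ∃ ρ : ℝ → ℝ, IsBoundedDensity a b L ρ ∧
      ∀ x ∈ Icc 0 L, A * ρ x ^ γ = s - ∫ y in (0 : ℝ)..x, gravForce G c q ρ y := by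
  have hb : 0 < b := ha.trans_le hab
  obtain ⟨w, hwc, hw1, hw⟩ := exists_weight_forall_abs_sub_le (s := s) ha hb hA hG hc hq hq2 hγ
  set T : (ℝ → ℝ) → ℝ → ℝ := fun f x =>
    ((s - ∫ y in (0 : ℝ)..x, gravForce G c q f y) / A) ^ γ⁻¹ with hT
  have hlow : ∀ {f}, IsBoundedDensity a b L f → ∀ x ∈ Icc 0 L,
      a ^ γ ≤ (s - ∫ y in (0 : ℝ)..x, gravForce G c q f y) / A := by
    intro f hf x hx
    rw [le_div_iff₀ hA]
    have h1 := (hf.mono hx.2).integral_gravForce_le ha hb hG hc hq hq2 hx.1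
    have h2 : G * (c / b) ^ q * (x ^ (q + 2) / (q + 2)) ≤
        G * (c / b) ^ q * (L ^ (q + 2) / (q + 2)) := by
      have h3 : 0 < q + 2 := by linarith
      have h4 := Real.rpow_le_rpow hx.1 hx.2 h3.le
      gcongr
    linarith
  have haγ : 0 < a ^ γ := Real.rpow_pos_of_pos ha γ
  have hTeq : ∀ {f}, IsBoundedDensity a b L f → ∀ x ∈ Icc 0 L,
      A * T f x ^ γ = s - ∫ y in (0 : ℝ)..x, gravForce G c q f y := by
    intro f hf x hx
    rw [hT, Real.rpow_inv_rpow (haγ.le.trans (hlow hf x hx)) hγ.ne', mul_div_cancel₀ _ hA.ne']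
  have hTmem : ∀ {f}, IsBoundedDensity a b L f → IsBoundedDensity a b L (T f) := by
    intro f hf
    refine ⟨?_, fun x hx => ?_, fun x hx => ?_⟩
    · exact ((continuousOn_const.sub (hf.continuousOn_integral_gravForce ha hb hG hc hq hq2
        hL)).div_const A).rpow_const fun x hx => Or.inl (haγ.trans_le (hlow hf x hx)).ne'
    · exact (Real.le_rpow_inv_iff_of_pos ha.le (haγ.le.trans (hlow hf x hx)) hγ).2 (hlow hf x hx)
    · refine (Real.rpow_inv_le_iff_of_pos (haγ.le.trans (hlow hf x hx)) hb.le hγ).2 ?_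
      rw [div_le_iff₀ hA]
      have := (hf.mono hx.2).integral_gravForce_nonneg (q := q) ha hb hG hc hx.1
      linarith
  set u : ℕ → ℝ → ℝ := fun k => T^[k] fun _ => b with hu
  have husucc : ∀ k, u (k + 1) = T (u k) := fun k => Function.iterate_succ_apply' T k _
  have humem : ∀ k, IsBoundedDensity a b L (u k) := by
    intro k
    induction k with
    | zero => exact ⟨continuousOn_const, fun _ _ => hab, fun _ _ => le_rfl⟩
    | succ k ih => rw [husucc]; exact hTmem ih
  have hstep : ∀ k, ∀ x ∈ Icc 0 L, |u k x - u (k + 1) x| ≤ b / 2 ^ k * w x := by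
    intro k
    induction k with
    | zero =>
      intro x hx
      have h0 := (humem 0).le x hx
      have h0' := (humem 0).ge x hx
      have h1 := (humem 1).le x hx
      have h1' := (humem 1).ge x hx
      have hwx := hw1 x hx.1
      rw [pow_zero, div_one, zero_add, abs_le]
      constructor <;> nlinarith
    | succ k ih =>
      have h := hw (humem k) (humem (k + 1)) (hTmem (humem k)) (hTmem (humem (k + 1)))
        (hTeq (humem k)) (hTeq (humem (k + 1))) (b / 2 ^ k) (by positivity) ih
      rw [← husucc, ← husucc] at h
      intro x hx
      exact (h x hx).trans_eq (by rw [pow_succ, div_div])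
  have hlim : ∀ x ∈ Icc 0 L, ∃ r, Filter.Tendsto (fun k => u k x) Filter.atTop (nhds r) :=
    fun x hx => cauchySeq_tendsto_of_complete
      (cauchySeq_of_le_geometric_two (C := 2 * (b * w x)) fun k => by
        rw [Real.dist_eq]
        exact (hstep k x hx).trans_eq (by ring))
  choose! ρ hρ using hlim
  have hdist : ∀ k, ∀ x ∈ Icc 0 L, |u k x - ρ x| ≤ 2 * b / 2 ^ k * w x := by
    intro k x hx
    have h := dist_le_of_le_geometric_two_of_tendsto (C := 2 * (b * w x)) (f := fun k => u k x)
      (fun k => by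
        rw [Real.dist_eq]
        exact (hstep k x hx).trans_eq (by ring)) (hρ x hx) k
    rw [Real.dist_eq] at h
    exact h.trans_eq (by ring)
  have hzero : ∀ C : ℝ, Filter.Tendsto (fun k : ℕ => 2 * b / 2 ^ k * C) Filter.atTop (nhds 0) := by
    intro C
    have := (tendsto_pow_atTop_nhds_zero_of_lt_one (r := (2 : ℝ)⁻¹) (by norm_num)
      (by norm_num)).const_mul (2 * b * C)
    rw [mul_zero] at this
    refine this.congr fun k => ?_
    rw [inv_pow]
    ring
  obtain ⟨W, hW⟩ := isCompact_Icc.bddAbove_image (hwc.continuousOn (s := Icc 0 L))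
  have hunif : TendstoUniformlyOn u ρ Filter.atTop (Icc 0 L) := by
    rw [Metric.tendstoUniformlyOn_iff]
    intro ε hε
    filter_upwards [(hzero W).eventually_lt_const hε] with k hk x hx
    rw [dist_comm, Real.dist_eq]
    refine ((hdist k x hx).trans ?_).trans_lt hk
    exact mul_le_mul_of_nonneg_left (hW (mem_image_of_mem w hx)) (by positivity)
  have hρmem : IsBoundedDensity a b L ρ :=
    ⟨hunif.continuousOn (Filter.Frequently.of_forall fun k => (humem k).continuousOn),
      fun x hx => ge_of_tendsto' (hρ x hx) fun k => (humem k).le x hx,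
      fun x hx => le_of_tendsto' (hρ x hx) fun k => (humem k).ge x hx⟩
  refine ⟨ρ, hρmem, fun x hx => ?_⟩
  suffices T ρ x = ρ x by rw [← hTeq hρmem x hx, this]
  have hconv : Filter.Tendsto (fun k => u (k + 1) x) Filter.atTop (nhds (T ρ x)) := by
    rw [tendsto_iff_dist_tendsto_zero]
    refine squeeze_zero (fun _ => dist_nonneg) (fun k => ?_) (hzero (w x / 2))
    have h := hw (humem k) hρmem (hTmem (humem k)) (hTmem hρmem) (hTeq (humem k)) (hTeq hρmem)
      (2 * b / 2 ^ k) (by positivity) (hdist k) x hx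
    rw [← husucc] at h
    rw [Real.dist_eq]
    exact h.trans_eq (by ring)
  exact tendsto_nhds_unique hconv ((Filter.tendsto_add_atTop_iff_nat 1).2 (hρ x hx))

lemma eqOn_of_integral_gravForce {a b A G c q γ s L : ℝ} {f g : ℝ → ℝ} (ha : 0 < a) (hb : 0 < b)
    (hA : 0 < A) (hG : 0 < G) (hc : 0 < c) (hq : q < 0) (hq2 : -2 < q) (hγ : 0 < γ)
    (hf : IsBoundedDensity a b L f) (hg : IsBoundedDensity a b L g)
    (hfs : ∀ x ∈ Icc 0 L, A * f x ^ γ = s - ∫ y in (0 : ℝ)..x, gravForce G c q f y)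
    (hgs : ∀ x ∈ Icc 0 L, A * g x ^ γ = s - ∫ y in (0 : ℝ)..x, gravForce G c q g y) :
    EqOn f g (Icc 0 L) := by
  obtain ⟨w, -, hw1, hw⟩ := exists_weight_forall_abs_sub_le (s := s) ha hb hA hG hc hq hq2 hγ
  have hiter : ∀ k : ℕ, ∀ x ∈ Icc 0 L, |f x - g x| ≤ b * 2⁻¹ ^ k * w x := by
    intro k
    induction k with
    | zero =>
      intro x hx
      have h0 := hf.le x hx
      have h0' := hf.ge x hx
      have h1 := hg.le x hx
      have h1' := hg.ge x hx
      have hwx := hw1 x hx.1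
      rw [pow_zero, mul_one, abs_le]
      constructor <;> nlinarith
    | succ k ih =>
      intro x hx
      exact (hw hf hg hf hg hfs hgs _ (by positivity) ih x hx).trans_eq (by rw [pow_succ]; ring)
  intro x hx
  have hzero := ((tendsto_pow_atTop_nhds_zero_of_lt_one (r := (2 : ℝ)⁻¹) (by norm_num)
      (by norm_num)).const_mul b).mul_const (w x)
  rw [mul_zero, zero_mul] at hzero
  exact sub_eq_zero.1 (abs_nonpos_iff.1 (ge_of_tendsto' hzero fun k => hiter k x hx))

namespace IsShootingSolution

variable {n : ℕ} {A G γ σ L : ℝ} {ρ : ℝ → ℝ}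

lemma mono (hρ : IsShootingSolution n A G γ σ L ρ) {L' : ℝ} (h : L' ≤ L) :
    IsShootingSolution n A G γ σ L' ρ :=
  ⟨hρ.1.mono (Icc_subset_Icc_right h), fun x hx => hρ.2.1 x ⟨hx.1, hx.2.trans h⟩,
    fun x hx => hρ.2.2 x ⟨hx.1, hx.2.trans h⟩⟩

lemma exists_isBoundedDensity (hρ : IsShootingSolution n A G γ σ L ρ) :
    ∃ a b, 0 < a ∧ 0 < b ∧ IsBoundedDensity a b L ρ := by
  rcases lt_or_ge L 0 with hL | hL
  · exact ⟨1, 1, one_pos, one_pos, by rw [Icc_eq_empty hL.not_ge]; exact continuousOn_empty _,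
      fun x hx => absurd (hx.1.trans hx.2) hL.not_ge,
      fun x hx => absurd (hx.1.trans hx.2) hL.not_ge⟩
  have hne : (Icc 0 L).Nonempty := nonempty_Icc.2 hL
  obtain ⟨x, hx, hmin⟩ := isCompact_Icc.exists_isMinOn hne hρ.1
  obtain ⟨y, hy, hmax⟩ := isCompact_Icc.exists_isMaxOn hne hρ.1
  exact ⟨ρ x, ρ y, hρ.2.1 x hx, hρ.2.1 y hy, hρ.1, hmin, hmax⟩

lemma rpow_eq (hρ : IsShootingSolution n A G γ σ L ρ) (hG : 0 < G) (hc : 0 < (n : ℝ))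
    (hq : (2 - 2 * (n : ℝ)) / (n : ℝ) < 0) (hq2 : -2 < (2 - 2 * (n : ℝ)) / (n : ℝ))
    (hL : 0 < L) : ∀ x ∈ Icc 0 L, A * ρ x ^ γ = A * σ ^ γ -
      ∫ y in (0 : ℝ)..x, gravForce G n ((2 - 2 * (n : ℝ)) / (n : ℝ)) ρ y := by
  obtain ⟨a, b, ha, hb, hbd⟩ := hρ.exists_isBoundedDensity
  have heq : EqOn (fun x => A * ρ x ^ γ) (fun x => A * σ ^ γ -
      ∫ y in (0 : ℝ)..x, gravForce G n ((2 - 2 * (n : ℝ)) / (n : ℝ)) ρ y) (Ioc 0 L) := hρ.2.2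
  exact heq.of_subset_closure
    (continuousOn_const.mul (hρ.1.rpow_const fun x hx => Or.inl (hρ.2.1 x hx).ne'))
    (continuousOn_const.sub
      (hbd.continuousOn_integral_gravForce ha hb hG hc hq hq2 hL.le))
    Ioc_subset_Icc_self (closure_Ioc hL.ne).ge

end IsShootingSolution

/-- Existence of a solution of the shooting Cauchy problem on `[0,M₀]`, with values in
`[σ/2, σ]` and `V(x) ∈ [x/σ, 2x/σ]`; and uniqueness: any two continuous positive
solutions agree on the common interval. -/
theorem shooting_existence_uniqueness
    (n : ℕ) (hn : 2 ≤ n) (A G Pinf γ M σ M₀ : ℝ)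
    (hA : 0 < A) (hG : 0 < G) (hPinf : 0 < Pinf) (hγ : 0 < γ) (hM : 0 < M) (hσ : 0 < σ)
    (hM₀pos : 0 < M₀) (hM₀le : M₀ ≤ M)
    (hM₀ : A * (σ / 2) ^ γ ≤
      A * σ ^ γ - G / 2 * (n : ℝ) ^ ((2 - (n : ℝ)) / (n : ℝ)) *
        σ ^ ((2 * (n : ℝ) - 2) / (n : ℝ)) * M₀ ^ ((2 : ℝ) / (n : ℝ))) :
    (∃ ρ : ℝ → ℝ, IsShootingSolution n A G γ σ M₀ ρ ∧
      (∀ x ∈ Set.Icc (0 : ℝ) M₀, σ / 2 ≤ ρ x ∧ ρ x ≤ σ) ∧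
      (∀ x ∈ Set.Icc (0 : ℝ) M₀,
        x / σ ≤ (∫ y in (0 : ℝ)..x, (ρ y)⁻¹) ∧ (∫ y in (0 : ℝ)..x, (ρ y)⁻¹) ≤ 2 * x / σ)) ∧
    (∀ M₁ M₂ : ℝ, 0 < M₁ → 0 < M₂ → ∀ ρ₁ ρ₂ : ℝ → ℝ,
      IsShootingSolution n A G γ σ M₁ ρ₁ → IsShootingSolution n A G γ σ M₂ ρ₂ →
      ∀ x ∈ Set.Icc (0 : ℝ) (min M₁ M₂), ρ₁ x = ρ₂ x) := by
  have hn2 : (2 : ℝ) ≤ n := by exact_mod_cast hn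
  have hn0 : (0 : ℝ) < n := by linarith
  have hq : (2 - 2 * (n : ℝ)) / n < 0 := div_neg_of_neg_of_pos (by linarith) hn0
  have hq2 : -2 < (2 - 2 * (n : ℝ)) / n := by
    rw [lt_div_iff₀ hn0]
    linarith
  constructor
  · have hβ : (2 - 2 * (n : ℝ)) / n + 2 = 2 / n := by field_simp; ring
    have hconst : G * ((n : ℝ) / σ) ^ ((2 - 2 * (n : ℝ)) / n) * (M₀ ^ ((2 : ℝ) / n) / (2 / n)) =
        G / 2 * (n : ℝ) ^ ((2 - (n : ℝ)) / (n : ℝ)) *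
          σ ^ ((2 * (n : ℝ) - 2) / (n : ℝ)) * M₀ ^ ((2 : ℝ) / (n : ℝ)) := by
      rw [Real.div_rpow hn0.le hσ.le,
        show (2 - (n : ℝ)) / n = (2 - 2 * (n : ℝ)) / n + 1 by field_simp; ring,
        Real.rpow_add_one hn0.ne',
        show (2 * (n : ℝ) - 2) / n = -((2 - 2 * (n : ℝ)) / n) by ring, Real.rpow_neg hσ.le]
      field_simp
    obtain ⟨ρ, hρ, heq⟩ := exists_fixed_density (a := σ / 2) (b := σ) (s := A * σ ^ γ)
      (half_pos hσ) (half_le_self hσ.le) hA hG hn0 hq hq2 hγ hM₀pos.le le_rfl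
      (by rw [hβ, hconst]; exact hM₀)
    refine ⟨ρ, ⟨hρ.continuousOn, fun x hx => (half_pos hσ).trans_le (hρ.le x hx),
      fun x hx => heq x ⟨hx.1.le, hx.2⟩⟩, fun x hx => ⟨hρ.le x hx, hρ.ge x hx⟩,
      fun x hx => ⟨hρ.div_le_massVolume (half_pos hσ) hx,
        (hρ.massVolume_le_div (half_pos hσ) hx).trans_eq ?_⟩⟩
    field_simp
  · intro M₁ M₂ hM₁ hM₂ ρ₁ ρ₂ h₁ h₂
    have hL : 0 < min M₁ M₂ := lt_min hM₁ hM₂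
    replace h₁ := h₁.mono (min_le_left M₁ M₂)
    replace h₂ := h₂.mono (min_le_right M₁ M₂)
    obtain ⟨a₁, b₁, ha₁, hb₁, hd₁⟩ := h₁.exists_isBoundedDensity
    obtain ⟨a₂, b₂, ha₂, hb₂, hd₂⟩ := h₂.exists_isBoundedDensity
    exact eqOn_of_integral_gravForce (lt_min ha₁ ha₂) (lt_max_of_lt_left hb₁) hA hG hn0 hq hq2 hγ
      (hd₁.weaken (min_le_left _ _) (le_max_left _ _))
      (hd₂.weaken (min_le_right _ _) (le_max_right _ _))
      (h₁.rpow_eq hG hn0 hq hq2 hL) (h₂.rpow_eq hG hn0 hq hq2 hL)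
end

section
/- Let y : [0,∞) → [0,∞) be locally absolutely continuous with y ∈ L¹((0,∞)). Suppose there exist a constant C ≥ 0 and a function g ∈ L¹((0,∞)) such that |y'(t)| ≤ C·y(t) + g(t) for almost every t ≥ 0. Then y(t) → 0 as t → ∞. -/
open MeasureTheory intervalIntegral Set Filter

/-- A function integrable on every `[0, T]` is a.e. strongly measurable on `(0, ∞)`. -/
theorem aestronglyMeasurable_Ioi_of_integrableOn_Icc {f : ℝ → ℝ}
    (hf : ∀ T > (0 : ℝ), IntegrableOn f (Icc 0 T)) :
    AEStronglyMeasurable f (volume.restrict (Ioi 0)) := by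
  have hsub : Ioi (0 : ℝ) ⊆ ⋃ n : ℕ, Icc (0 : ℝ) (n + 1) := by
    intro t ht
    obtain ⟨n, hn⟩ := exists_nat_ge t
    exact mem_iUnion.2 ⟨n, le_of_lt ht, by linarith⟩
  refine AEStronglyMeasurable.mono_set hsub ?_
  exact aestronglyMeasurable_iUnion_iff.2 fun n =>
    (hf (n + 1) (by positivity)).aestronglyMeasurable

/-- Prototype decay lemma: a nonnegative locally absolutely continuous function
`y ∈ L¹((0,∞))` (encoded via `y(t) = y(0) + ∫_0^t y'` with locally integrable a.e.
derivative `y'`) whose a.e. derivative satisfies `|y'(t)| ≤ C y(t) + g(t)` with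
`C ≥ 0` and `g ∈ L¹((0,∞))`, tends to `0` as `t → ∞`. -/
theorem decay_lemma
    (y yd g : ℝ → ℝ) (C : ℝ) (hC : 0 ≤ C)
    (hyd_loc : ∀ T > (0 : ℝ), IntegrableOn yd (Set.Icc 0 T))
    (hy_AC : ∀ t ∈ Set.Ici (0 : ℝ), y t = y 0 + ∫ s in (0 : ℝ)..t, yd s)
    (hy_nonneg : ∀ t ∈ Set.Ici (0 : ℝ), 0 ≤ y t)
    (hy_L1 : IntegrableOn y (Set.Ioi (0 : ℝ)))
    (hg_L1 : IntegrableOn g (Set.Ioi (0 : ℝ)))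
    (hbound : ∀ᵐ t ∂(volume.restrict (Set.Ici (0 : ℝ))), |yd t| ≤ C * y t + g t) :
    Tendsto y atTop (nhds 0) := by
  have hyd : IntegrableOn yd (Ioi 0) := by
    refine Integrable.mono' ((hy_L1.const_mul C).add hg_L1)
      (aestronglyMeasurable_Ioi_of_integrableOn_Icc hyd_loc) ?_
    exact ae_restrict_of_ae_restrict_of_subset Ioi_subset_Ici_self hbound
  have hlim : Tendsto y atTop (nhds (y 0 + ∫ s in Ioi 0, yd s)) := by
    refine ((intervalIntegral_tendsto_integral_Ioi 0 hyd tendsto_id).const_add (y 0)).congr' ?_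
    filter_upwards [eventually_ge_atTop 0] with t ht using (hy_AC t ht).symm
  have hzero : y 0 + ∫ s in Ioi 0, yd s = 0 := by
    refine IntegrableAtFilter.eq_zero_of_tendsto ⟨Ioi 0, Ioi_mem_atTop 0, hy_L1⟩
      (fun s hs => ?_) hlim
    obtain ⟨b, hb⟩ := mem_atTop_sets.1 hs
    rw [← top_le_iff, ← Real.volume_Ici (a := b)]
    exact measure_mono hb
  rwa [hzero] at hlim
end

section
/- Let n ≥ 2 be an integer, M > 0, C₀ ≥ 1, and let r : [0,M] → (0,∞) be a measurable function with C₀^(−1) x ≤ r(x)^n ≤ C₀ x for all x ∈ (0,M]. Let k ∈ {0, 1, …, n−2} and set α_k = −1/2 − k and α_{k−1} = 1/2 − k. Then there exists a constant C > 0, depending only on n, M, C₀ and k, such that for every g ∈ C¹([0,M]): ∫_0^M r(x)^{α_k} g(x)² dx ≤ C g(M)² + C ∫_0^M r(x)^{2n−2+α_{k−1}} g'(x)² dx. -/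
open MeasureTheory intervalIntegral Set

/-- The Hardy inequality with power weights `x ^ (-a)` and `x ^ (2 - a)`, `0 < a < 1`, on `[0, M]`,
with a boundary term at `M`. -/
theorem hardy_rpow_weight {a M : ℝ} (ha : 0 < a) (ha1 : a < 1) (hM : 0 < M) {g g' : ℝ → ℝ}
    (hg : ∀ x ∈ Icc 0 M, HasDerivAt g (g' x) x) (hg' : ContinuousOn g' (Icc 0 M)) :
    (∫ x in (0 : ℝ)..M, x ^ (-a) * g x ^ 2) ≤
      2 * (M ^ (1 - a) / (1 - a)) * g M ^ 2 +
        4 / (1 - a) ^ 2 * ∫ x in (0 : ℝ)..M, x ^ (2 - a) * g' x ^ 2 := by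
  have hc : 0 < 1 - a := by linarith
  have hgc : ContinuousOn g (Icc 0 M) := fun x hx => (hg x hx).continuousAt.continuousWithinAt
  have hI : uIcc 0 M = Icc 0 M := uIcc_of_le hM.le
  have hpow : ∀ p : ℝ, 0 < p → ContinuousOn (fun x : ℝ => x ^ p) (Icc 0 M) :=
    fun p hp => (Real.continuous_rpow_const hp.le).continuousOn
  have i1 : IntervalIntegrable (fun x : ℝ => x ^ (-a) * g x ^ 2) volume 0 M :=
    (intervalIntegrable_rpow' (by linarith)).mul_continuousOn (by rw [hI]; exact hgc.pow 2)
  have i2 : IntervalIntegrable (fun x : ℝ => x ^ (2 - a) * g' x ^ 2) volume 0 M :=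
    ContinuousOn.intervalIntegrable
      (by rw [hI]; exact (hpow _ (by linarith)).mul (hg'.pow 2))
  have i3 : IntervalIntegrable (fun x : ℝ => x ^ (1 - a) / (1 - a) * (2 * g x * g' x)) volume 0 M :=
    ContinuousOn.intervalIntegrable
      (by
        rw [hI]
        exact ((hpow _ hc).div_const _).mul ((continuousOn_const.mul hgc).mul hg'))
  have ftc := integral_eq_sub_of_hasDerivAt_of_le hM.le
    (f := fun x => x ^ (1 - a) / (1 - a) * g x ^ 2)
    (f' := fun x => x ^ (-a) * g x ^ 2 + x ^ (1 - a) / (1 - a) * (2 * g x * g' x))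
    (((hpow _ hc).div_const _).mul (hgc.pow 2))
    (fun x hx => by
      have h1 : HasDerivAt (fun x : ℝ => x ^ (1 - a) / (1 - a)) (x ^ (-a)) x := by
        refine ((Real.hasDerivAt_rpow_const (p := 1 - a) (Or.inl hx.1.ne')).div_const
          (1 - a)).congr_deriv ?_
        rw [show 1 - a - 1 = -a by ring]
        field_simp
      refine (h1.mul ((hg x (Ioo_subset_Icc_self hx)).pow 2)).congr_deriv ?_
      simp)
    (i1.add i3)
  have key : (∫ x in (0 : ℝ)..M,
        (1 / 2 * (x ^ (-a) * g x ^ 2) - 2 / (1 - a) ^ 2 * (x ^ (2 - a) * g' x ^ 2))) ≤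
      ∫ x in (0 : ℝ)..M, (x ^ (-a) * g x ^ 2 + x ^ (1 - a) / (1 - a) * (2 * g x * g' x)) := by
    refine integral_mono_on_of_le_Ioo hM.le ((i1.const_mul _).sub (i2.const_mul _)) (i1.add i3) ?_
    intro x hx
    have hx0 := hx.1
    have e1 : x ^ (1 - a) = x ^ (-a) * x := by
      rw [show 1 - a = -a + 1 by ring, Real.rpow_add_one hx0.ne']
    have e2 : x ^ (2 - a) = x ^ (-a) * x * x := by
      rw [show 2 - a = -a + 1 + 1 by ring, Real.rpow_add_one hx0.ne', Real.rpow_add_one hx0.ne']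
    rw [e1, e2, ← sub_nonneg]
    have hsq : 0 ≤ x ^ (-a) / 2 * (g x + 2 / (1 - a) * x * g' x) ^ 2 := by positivity
    convert hsq using 1
    field_simp
    ring
  rw [intervalIntegral.integral_sub (i1.const_mul _) (i2.const_mul _),
    intervalIntegral.integral_const_mul, intervalIntegral.integral_const_mul, ftc,
    Real.zero_rpow hc.ne', zero_div, zero_mul, sub_zero] at key
  have e : 4 / (1 - a) ^ 2 = 2 * (2 / (1 - a) ^ 2) := by ring
  rw [e]
  linarith

/-- Weighted Hardy-type inequality: if `C₀⁻¹ x ≤ r(x)ⁿ ≤ C₀ x` on `(0,M]`, `k ≤ n−2`,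
`α_k = −1/2 − k` and `α_{k−1} = 1/2 − k`, then there is `C > 0` depending only on
`n, M, C₀, k` such that for every `C¹` function `g` on `[0,M]`,
`∫_0^M r^{α_k} g² dx ≤ C g(M)² + C ∫_0^M r^{2n−2+α_{k−1}} (g')² dx`. -/
theorem weighted_hardy_inequality
    (n : ℕ) (hn : 2 ≤ n) (M C₀ : ℝ) (hM : 0 < M) (hC₀ : 1 ≤ C₀)
    (k : ℕ) (hk : k ≤ n - 2) :
    ∃ C > (0 : ℝ), ∀ r : ℝ → ℝ, Measurable r →
      (∀ x ∈ Set.Icc (0 : ℝ) M, 0 < r x) →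
      (∀ x ∈ Set.Ioc (0 : ℝ) M, C₀⁻¹ * x ≤ r x ^ n ∧ r x ^ n ≤ C₀ * x) →
      ∀ g g' : ℝ → ℝ,
        (∀ x ∈ Set.Icc (0 : ℝ) M, HasDerivAt g (g' x) x) →
        ContinuousOn g' (Set.Icc (0 : ℝ) M) →
        (∫ x in (0 : ℝ)..M, r x ^ (-(1 / 2 : ℝ) - (k : ℝ)) * (g x) ^ 2) ≤
          C * (g M) ^ 2 +
            C * ∫ x in (0 : ℝ)..M,
              r x ^ (2 * (n : ℝ) - 2 + ((1 / 2 : ℝ) - (k : ℝ))) * (g' x) ^ 2 := by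
  have hC : 0 < C₀ := by linarith
  have hn0 : (0 : ℝ) < n := by exact_mod_cast (by omega : 0 < n)
  have hkn : (k : ℝ) + 2 ≤ n := by exact_mod_cast (by omega : k + 2 ≤ n)
  have hk0 : (0 : ℝ) ≤ k := k.cast_nonneg
  obtain ⟨a, ha⟩ : ∃ a : ℝ, a = (1 / 2 + k) / n := ⟨_, rfl⟩
  obtain ⟨b, hb⟩ : ∃ b : ℝ, b = 2 - a - 1 / n := ⟨_, rfl⟩
  have hna : -(1 / 2 : ℝ) - k = n * (-a) := by rw [ha]; field_simp; ring
  have hnb : 2 * (n : ℝ) - 2 + (1 / 2 - k) = n * b := by rw [hb, ha]; field_simp; ring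
  have ha0 : 0 < a := by rw [ha]; positivity
  have ha1 : a < 1 := by rw [ha, div_lt_one hn0]; linarith
  have hb0 : 0 < b := pos_of_mul_pos_right (by linarith : 0 < (n : ℝ) * b) hn0.le
  have hc : 0 < 1 - a := by linarith
  rw [hna, hnb]
  set A := C₀ ^ a * (2 * (M ^ (1 - a) / (1 - a))) with hA
  set B := C₀ ^ a * (4 / (1 - a) ^ 2) * (M ^ (1 / n : ℝ) * C₀ ^ b) with hB
  have hA0 : 0 < A := by positivity
  have hB0 : 0 < B := by positivity
  refine ⟨A + B, by positivity, fun r hr hrpos hrn g g' hg hg' => ?_⟩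
  have hrpow : ∀ x ∈ Ioc 0 M, ∀ p : ℝ, r x ^ (n * p) = (r x ^ n) ^ p := fun x hx p => by
    rw [Real.rpow_mul (hrpos x (Ioc_subset_Icc_self hx)).le, Real.rpow_natCast]
  have hgc : ContinuousOn g (Icc 0 M) := fun x hx => (hg x hx).continuousAt.continuousWithinAt
  have hI : uIcc 0 M = Icc 0 M := uIcc_of_le hM.le
  have i1 : IntervalIntegrable (fun x : ℝ => x ^ (-a) * g x ^ 2) volume 0 M :=
    (intervalIntegrable_rpow' (by linarith)).mul_continuousOn (by rw [hI]; exact hgc.pow 2)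
  have i2 : IntervalIntegrable (fun x : ℝ => x ^ (2 - a) * g' x ^ 2) volume 0 M :=
    ContinuousOn.intervalIntegrable (by
      rw [hI]
      exact (Real.continuous_rpow_const (by linarith)).continuousOn.mul (hg'.pow 2))
  have i3 : IntervalIntegrable (fun x : ℝ => r x ^ (n * b) * g' x ^ 2) volume 0 M := by
    have h : IntervalIntegrable (fun x => g' x ^ 2) volume 0 M :=
      ContinuousOn.intervalIntegrable (by rw [hI]; exact hg'.pow 2)
    rw [intervalIntegrable_iff_integrableOn_Ioc_of_le hM.le] at h ⊢
    refine Integrable.bdd_mul (c := (C₀ * M) ^ b) h (hr.pow_const _).aestronglyMeasurable ?_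
    filter_upwards [ae_restrict_mem measurableSet_Ioc] with x hx
    have hrx := hrpos x (Ioc_subset_Icc_self hx)
    rw [Real.norm_of_nonneg (by positivity), hrpow x hx]
    refine Real.rpow_le_rpow (by positivity) ((hrn x hx).2.trans ?_) hb0.le
    exact mul_le_mul_of_nonneg_left hx.2 hC.le
  have hleft : (∫ x in (0 : ℝ)..M, r x ^ (n * (-a)) * g x ^ 2) ≤
      C₀ ^ a * ∫ x in (0 : ℝ)..M, x ^ (-a) * g x ^ 2 := by
    rw [← intervalIntegral.integral_const_mul, integral_of_le hM.le, integral_of_le hM.le]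
    refine integral_mono_of_nonneg ?_ (i1.const_mul _).1 ?_ <;>
      filter_upwards [ae_restrict_mem measurableSet_Ioc] with x hx
    · have hrx := hrpos x (Ioc_subset_Icc_self hx)
      positivity
    · have hx0 := hx.1
      rw [hrpow x hx, ← mul_assoc]
      refine mul_le_mul_of_nonneg_right ?_ (sq_nonneg _)
      calc (r x ^ n) ^ (-a) ≤ (C₀⁻¹ * x) ^ (-a) :=
            Real.rpow_le_rpow_of_nonpos (by positivity) (hrn x hx).1 (by linarith)
        _ = C₀ ^ a * x ^ (-a) := by
            rw [Real.mul_rpow (by positivity) hx0.le, Real.inv_rpow hC.le, Real.rpow_neg hC.le,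
              inv_inv]
  have hright : (∫ x in (0 : ℝ)..M, x ^ (2 - a) * g' x ^ 2) ≤
      M ^ (1 / n : ℝ) * C₀ ^ b * ∫ x in (0 : ℝ)..M, r x ^ (n * b) * g' x ^ 2 := by
    rw [← intervalIntegral.integral_const_mul]
    refine integral_mono_on_of_le_Ioo hM.le i2 (i3.const_mul _) fun x hx => ?_
    have hx' := Ioo_subset_Ioc_self hx
    have hx0 := hx.1
    have hrx := hrpos x (Ioo_subset_Icc_self hx)
    rw [hrpow x hx', ← mul_assoc]
    refine mul_le_mul_of_nonneg_right ?_ (sq_nonneg _)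
    have hxr : x ≤ C₀ * r x ^ n := by
      have := (hrn x hx').1
      rwa [inv_mul_le_iff₀ hC] at this
    calc x ^ (2 - a) = x ^ (1 / n : ℝ) * x ^ b := by
          rw [← Real.rpow_add hx0, hb]; ring_nf
      _ ≤ M ^ (1 / n : ℝ) * (C₀ * r x ^ n) ^ b := by
          gcongr
          exact hx.2.le
      _ = M ^ (1 / n : ℝ) * C₀ ^ b * (r x ^ n) ^ b := by
          rw [Real.mul_rpow hC.le (by positivity), mul_assoc]
  have hJ : 0 ≤ ∫ x in (0 : ℝ)..M, r x ^ (n * b) * g' x ^ 2 :=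
    integral_nonneg hM.le fun x hx => by
      have := hrpos x hx
      positivity
  have hmain := hardy_rpow_weight ha0 ha1 hM hg hg'
  calc (∫ x in (0 : ℝ)..M, r x ^ (n * (-a)) * g x ^ 2)
      ≤ C₀ ^ a * (2 * (M ^ (1 - a) / (1 - a)) * g M ^ 2 + 4 / (1 - a) ^ 2 *
          (M ^ (1 / n : ℝ) * C₀ ^ b * ∫ x in (0 : ℝ)..M, r x ^ (n * b) * g' x ^ 2)) :=
        hleft.trans (by gcongr; exact hmain.trans (by gcongr))
    _ = A * g M ^ 2 + B * ∫ x in (0 : ℝ)..M, r x ^ (n * b) * g' x ^ 2 := by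
        rw [hA, hB]; ring
    _ ≤ _ := by
        gcongr <;> linarith
end

section
/- Let n ≥ 2 be an integer, A, G, P∞, M > 0, γ > 1. Suppose ρ∞ : [0,M] → (0,∞) is continuous and satisfies A ρ∞(x)^γ = P∞ + ∫_x^M G y / r∞(y)^(2n−2) dy for all x ∈ [0,M], where r∞(x) = (n ∫_0^x ρ∞(y)^(−1) dy)^(1/n). Then: (i) (P∞/A)^(1/γ) ≤ ρ∞(x) ≤ ρ̄ < ∞ for all x ∈ [0,M], where ρ̄ = max_{[0,M]} ρ∞; (ii) there exists a constant C ≥ 1 such that C^(−1) x ≤ r∞(x)^n ≤ C x for all x ∈ [0,M]; (iii) A ρ∞^γ is differentiable on (0,M) with d/dx (A ρ∞(x)^γ) = −G x / r∞(x)^(2n−2) < 0, so ρ∞ is strictly decreasing on (0,M). -/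
open MeasureTheory intervalIntegral Set

/-- A continuous positive function on a compact interval has a reciprocal whose primitive grows
at least and at most linearly. -/
theorem exists_linear_bounds_integral_inv {ρ : ℝ → ℝ} {M : ℝ} (hM : 0 < M)
    (hcont : ContinuousOn ρ (Set.Icc 0 M)) (hpos : ∀ x ∈ Set.Icc (0 : ℝ) M, 0 < ρ x) :
    ∃ a b : ℝ, 0 < a ∧ 0 < b ∧ ∀ x ∈ Set.Icc (0 : ℝ) M,
      a * x ≤ (∫ z in (0 : ℝ)..x, (ρ z)⁻¹) ∧ (∫ z in (0 : ℝ)..x, (ρ z)⁻¹) ≤ b * x := by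
  have hne : (Set.Icc (0 : ℝ) M).Nonempty := ⟨0, le_rfl, hM.le⟩
  have hinv : ContinuousOn (fun z => (ρ z)⁻¹) (Set.Icc 0 M) :=
    hcont.inv₀ fun x hx => (hpos x hx).ne'
  obtain ⟨p, hp, hpmin⟩ := isCompact_Icc.exists_isMinOn hne hinv
  obtain ⟨q, hq, hqmax⟩ := isCompact_Icc.exists_isMaxOn hne hinv
  refine ⟨(ρ p)⁻¹, (ρ q)⁻¹, inv_pos.2 (hpos p hp), inv_pos.2 (hpos q hq), fun x hx => ?_⟩
  have hsub : Set.Icc 0 x ⊆ Set.Icc 0 M := Set.Icc_subset_Icc_right hx.2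
  have hint : IntervalIntegrable (fun z => (ρ z)⁻¹) volume 0 x :=
    (hinv.mono hsub).intervalIntegrable_of_Icc hx.1
  have hconst (c : ℝ) : ∫ _ in (0 : ℝ)..x, c = c * x := by
    simp [mul_comm]
  constructor
  · rw [← hconst]
    exact intervalIntegral.integral_mono_on hx.1 intervalIntegrable_const hint
      fun z hz => hpmin (hsub hz)
  · rw [← hconst]
    exact intervalIntegral.integral_mono_on hx.1 hint intervalIntegrable_const
      fun z hz => hqmax (hsub hz)

/-- The derivative of an integral with respect to its lower limit, for an integrand continuous
on `(0, M]`. -/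
theorem hasDerivAt_integral_left_of_continuousOn_Ioc {f : ℝ → ℝ} {M x : ℝ}
    (hf : ContinuousOn f (Set.Ioc 0 M)) (hx : x ∈ Set.Ioo 0 M) :
    HasDerivAt (fun y => ∫ t in y..M, f t) (-f x) x := by
  have hsub : Set.Icc x M ⊆ Set.Ioc 0 M := fun z hz => ⟨hx.1.trans_le hz.1, hz.2⟩
  have hIoo : ContinuousOn f (Set.Ioo 0 M) := hf.mono Set.Ioo_subset_Ioc_self
  exact intervalIntegral.integral_hasDerivAt_left
    ((hf.mono hsub).intervalIntegrable_of_Icc hx.2.le)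
    (hIoo.stronglyMeasurableAtFilter isOpen_Ioo x hx)
    (hIoo.continuousAt (isOpen_Ioo.mem_nhds hx))

/-- Basic properties of the stationary density profile: if `ρ∞` is continuous, positive
and satisfies `A ρ∞(x)^γ = P∞ + ∫_x^M G y / r∞(y)^(2n−2) dy` with
`r∞(x) = (n ∫_0^x ρ∞⁻¹)^(1/n)`, then (i) `(P∞/A)^(1/γ) ≤ ρ∞ ≤ max ρ∞`,
(ii) `C⁻¹ x ≤ r∞(x)ⁿ ≤ C x`, and (iii) `(A ρ∞^γ)' = −G x / r∞^(2n−2) < 0` on `(0,M)`,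
so `ρ∞` is strictly decreasing. -/
theorem stationary_profile_properties
    (n : ℕ) (hn : 2 ≤ n) (A G Pinf M γ : ℝ)
    (hA : 0 < A) (hG : 0 < G) (hPinf : 0 < Pinf) (hM : 0 < M) (hγ : 1 < γ)
    (ρ : ℝ → ℝ)
    (hρcont : ContinuousOn ρ (Set.Icc 0 M))
    (hρpos : ∀ x ∈ Set.Icc (0 : ℝ) M, 0 < ρ x)
    (hρeq : ∀ x ∈ Set.Icc (0 : ℝ) M,
      A * ρ x ^ γ = Pinf +
        ∫ y in x..M,
          G * y / (((n : ℝ) * ∫ z in (0 : ℝ)..y, (ρ z)⁻¹) ^ ((1 : ℝ) / (n : ℝ))) ^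
            (2 * n - 2)) :
    (∀ x ∈ Set.Icc (0 : ℝ) M,
      (Pinf / A) ^ (1 / γ) ≤ ρ x ∧ ρ x ≤ sSup (ρ '' Set.Icc 0 M)) ∧
    (∃ C : ℝ, 1 ≤ C ∧ ∀ x ∈ Set.Icc (0 : ℝ) M,
      C⁻¹ * x ≤ ((((n : ℝ) * ∫ z in (0 : ℝ)..x, (ρ z)⁻¹) ^ ((1 : ℝ) / (n : ℝ))) ^ n) ∧
        ((((n : ℝ) * ∫ z in (0 : ℝ)..x, (ρ z)⁻¹) ^ ((1 : ℝ) / (n : ℝ))) ^ n) ≤ C * x) ∧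
    ((∀ x ∈ Set.Ioo (0 : ℝ) M,
      HasDerivAt (fun y => A * ρ y ^ γ)
        (-(G * x /
          (((n : ℝ) * ∫ z in (0 : ℝ)..x, (ρ z)⁻¹) ^ ((1 : ℝ) / (n : ℝ))) ^ (2 * n - 2))) x ∧
      -(G * x /
          (((n : ℝ) * ∫ z in (0 : ℝ)..x, (ρ z)⁻¹) ^ ((1 : ℝ) / (n : ℝ))) ^ (2 * n - 2)) < 0) ∧
      StrictAntiOn ρ (Set.Ioo 0 M)) := by
  have hn0 : (0 : ℝ) < n := by
    exact_mod_cast (by omega : 0 < n)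
  have hγ0 : 0 < γ := by linarith
  obtain ⟨a, b, ha, hb, hab⟩ := exists_linear_bounds_integral_inv hM hρcont hρpos
  set I : ℝ → ℝ := fun x => ∫ z in (0 : ℝ)..x, (ρ z)⁻¹ with hI
  set f : ℝ → ℝ := fun y =>
    G * y / (((n : ℝ) * I y) ^ ((1 : ℝ) / (n : ℝ))) ^ (2 * n - 2) with hf
  have hIpos : ∀ x ∈ Set.Ioc (0 : ℝ) M, 0 < (n : ℝ) * I x := fun x hx =>
    mul_pos hn0 ((mul_pos ha hx.1).trans_le (hab x ⟨hx.1.le, hx.2⟩).1)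
  have hfpos : ∀ x ∈ Set.Ioc (0 : ℝ) M, 0 < f x := fun x hx =>
    div_pos (mul_pos hG hx.1) (pow_pos (Real.rpow_pos_of_pos (hIpos x hx) _) _)
  have hIcont : ContinuousOn I (Set.Icc 0 M) := by
    have hint : IntegrableOn (fun z => (ρ z)⁻¹) (Set.uIcc 0 M) := by
      rw [Set.uIcc_of_le hM.le]
      exact (hρcont.inv₀ fun x hx => (hρpos x hx).ne').integrableOn_Icc
    simpa only [Set.uIcc_of_le hM.le] using
      intervalIntegral.continuousOn_primitive_interval hint
  have hfcont : ContinuousOn f (Set.Ioc 0 M) := by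
    refine (by fun_prop : Continuous fun y : ℝ => G * y).continuousOn.div
      (((continuousOn_const.mul (hIcont.mono Set.Ioc_subset_Icc_self)).rpow_const
        fun x hx => Or.inl (hIpos x hx).ne').pow _)
      fun x hx => (pow_pos (Real.rpow_pos_of_pos (hIpos x hx) _) _).ne'
  have hderiv : ∀ x ∈ Set.Ioo (0 : ℝ) M, HasDerivAt (fun y => A * ρ y ^ γ) (-f x) x := by
    intro x hx
    refine ((hasDerivAt_integral_left_of_continuousOn_Ioc hfcont hx).const_add
      Pinf).congr_of_eventuallyEq ?_
    filter_upwards [isOpen_Ioo.mem_nhds hx] with y hy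
    exact hρeq y (Set.Ioo_subset_Icc_self hy)
  refine ⟨fun x hx => ⟨?_, ?_⟩, ?_, fun x hx => ⟨hderiv x hx, ?_⟩, ?_⟩
  · have hnn : 0 ≤ ∫ y in x..M, f y := by
      refine intervalIntegral.integral_nonneg hx.2 fun y hy => ?_
      rcases (hx.1.trans hy.1).eq_or_lt with rfl | h
      · simp [hf]
      · exact (hfpos y ⟨h, hy.2⟩).le
    have hle : Pinf / A ≤ ρ x ^ γ := by
      rw [div_le_iff₀' hA, hρeq x hx]
      exact le_add_of_nonneg_right hnn
    rw [one_div]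
    exact (Real.rpow_inv_le_iff_of_pos (div_pos hPinf hA).le (hρpos x hx).le hγ0).2 hle
  · exact le_csSup (isCompact_Icc.image_of_continuousOn hρcont).bddAbove
      (Set.mem_image_of_mem ρ hx)
  · refine ⟨max 1 (max (n * b) (n * a)⁻¹), le_max_left _ _, fun x hx => ?_⟩
    obtain ⟨hlo, hhi⟩ := hab x hx
    have hI0 : 0 ≤ (n : ℝ) * I x :=
      mul_nonneg hn0.le ((mul_nonneg ha.le hx.1).trans hlo)
    have hpow : (((n : ℝ) * I x) ^ ((1 : ℝ) / (n : ℝ))) ^ n = n * I x := by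
      rw [one_div]
      exact Real.rpow_inv_natCast_pow hI0 (by omega)
    have hna : 0 < n * a := mul_pos hn0 ha
    rw [hpow]
    constructor
    · have hC : (max 1 (max (n * b) (n * a)⁻¹))⁻¹ ≤ n * a :=
        inv_le_of_inv_le₀ hna ((le_max_right _ _).trans (le_max_right _ _))
      calc _ ≤ n * a * x := mul_le_mul_of_nonneg_right hC hx.1
        _ = n * (a * x) := mul_assoc _ _ _
        _ ≤ n * I x := mul_le_mul_of_nonneg_left hlo hn0.le
    · calc (n : ℝ) * I x ≤ n * (b * x) := mul_le_mul_of_nonneg_left hhi hn0.le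
        _ = n * b * x := (mul_assoc _ _ _).symm
        _ ≤ _ := mul_le_mul_of_nonneg_right
          ((le_max_left _ _).trans (le_max_right _ _)) hx.1
  · exact neg_neg_of_pos (hfpos x (Set.Ioo_subset_Ioc_self hx))
  · have hanti : StrictAntiOn (fun y => A * ρ y ^ γ) (Set.Ioo 0 M) := by
      refine strictAntiOn_of_deriv_neg (convex_Ioo 0 M)
        (fun x hx => (hderiv x hx).continuousAt.continuousWithinAt) fun x hx => ?_
      rw [interior_Ioo] at hx
      rw [(hderiv x hx).deriv]
      exact neg_neg_of_pos (hfpos x (Set.Ioo_subset_Ioc_self hx))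
    intro x hx y hy hxy
    exact (Real.rpow_lt_rpow_iff (hρpos y (Set.Ioo_subset_Icc_self hy)).le
      (hρpos x (Set.Ioo_subset_Icc_self hx)).le hγ0).1
      (lt_of_mul_lt_mul_left (hanti hx hy hxy) hA.le)
end

section
/- Let n ≥ 2 be an integer, A, G, P∞, M > 0, γ > 0, and let δ > (P∞/A)^(1/γ). For every continuous f : [0,M] → ℝ with (P∞/A)^(1/γ) ≤ f(x) ≤ δ for all x, define r_f(x) = (n ∫_0^x f(y)^(−1) dy)^(1/n) and I(f)(x) = ((P∞ + ∫_x^M G y / r_f(y)^(2n−2) dy)/A)^(1/γ). Then for all x ∈ [0,M]: P∞ ≤ A·(I(f)(x))^γ ≤ P∞ + (G/2)·δ^((2n−2)/n)·n^((2−n)/n)·M^(2/n). -/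
open MeasureTheory intervalIntegral Set

/-- The integral of the reciprocal of a continuous function with values in `(0, δ]` over `[0, y]`
is at least `y / δ`. -/
theorem div_le_integral_inv_of_le {f : ℝ → ℝ} {y δ : ℝ} (hy : 0 ≤ y)
    (hf : ContinuousOn f (Set.Icc 0 y)) (hpos : ∀ z ∈ Set.Icc 0 y, 0 < f z)
    (hle : ∀ z ∈ Set.Icc 0 y, f z ≤ δ) :
    y / δ ≤ ∫ z in (0 : ℝ)..y, (f z)⁻¹ := by
  have hint : IntervalIntegrable (fun z => (f z)⁻¹) volume 0 y := by
    apply ContinuousOn.intervalIntegrable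
    rw [Set.uIcc_of_le hy]
    exact hf.inv₀ fun z hz => (hpos z hz).ne'
  calc y / δ = ∫ _z in (0 : ℝ)..y, δ⁻¹ := by
        rw [intervalIntegral.integral_const, smul_eq_mul, sub_zero, div_eq_mul_inv]
    _ ≤ _ := intervalIntegral.integral_mono_on hy (by simp) hint
        fun z hz => inv_anti₀ (hpos z hz) (hle z hz)

/-- If `y / δ ≤ F`, then `G y / r ^ (2n - 2)` with `r = (n F)^(1/n)` is at most a constant times
`y ^ ((2 - n) / n)`. -/
theorem mul_div_rpow_pow_le {n : ℕ} (hn : 2 ≤ n) {G δ y F : ℝ} (hG : 0 ≤ G) (hδ : 0 < δ)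
    (hy : 0 < y) (hF : y / δ ≤ F) :
    G * y / (((n : ℝ) * F) ^ ((1 : ℝ) / (n : ℝ))) ^ (2 * n - 2) ≤
      G * δ ^ ((2 * (n : ℝ) - 2) / (n : ℝ)) * (n : ℝ) ^ (-((2 * (n : ℝ) - 2) / (n : ℝ))) *
        y ^ ((2 - (n : ℝ)) / (n : ℝ)) := by
  have hn0 : (0 : ℝ) < n := by exact_mod_cast (by omega : 0 < n)
  set p : ℝ := (2 * (n : ℝ) - 2) / (n : ℝ) with hp
  have hp0 : 0 ≤ p := by
    have : (2 : ℝ) ≤ n := by exact_mod_cast hn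
    exact div_nonneg (by linarith) hn0.le
  have hq : (2 - (n : ℝ)) / (n : ℝ) = 1 - p := by rw [hp]; field_simp; ring
  have hFpos : 0 < F := (div_pos hy hδ).trans_le hF
  have hpow : (((n : ℝ) * F) ^ ((1 : ℝ) / (n : ℝ))) ^ (2 * n - 2) = ((n : ℝ) * F) ^ p := by
    rw [← Real.rpow_natCast, ← Real.rpow_mul (by positivity), Nat.cast_sub (by omega), hp]
    push_cast
    congr 1
    ring
  have hlow : ((n : ℝ) * (y / δ)) ^ p ≤ ((n : ℝ) * F) ^ p := by gcongr
  rw [hpow, hq]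
  calc G * y / ((n : ℝ) * F) ^ p ≤ G * y / ((n : ℝ) * (y / δ)) ^ p := by gcongr
    _ = _ := by
      rw [Real.mul_rpow hn0.le (by positivity), Real.div_rpow hy.le hδ.le, Real.rpow_neg hn0.le,
        Real.rpow_sub hy, Real.rpow_one]
      field_simp

/-- The fixed-point operator `I(f)(x) = ((P∞ + ∫_x^M G y / r_f(y)^(2n−2) dy)/A)^(1/γ)`
with `r_f(x) = (n ∫_0^x f⁻¹)^(1/n)` satisfies, for every continuous
`f : [0,M] → [(P∞/A)^(1/γ), δ]`,
`P∞ ≤ A (I(f)(x))^γ ≤ P∞ + (G/2) δ^((2n−2)/n) n^((2−n)/n) M^(2/n)` on `[0,M]`. -/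
theorem fixed_point_operator_bounds
    (n : ℕ) (hn : 2 ≤ n) (A G Pinf M γ δ : ℝ)
    (hA : 0 < A) (hG : 0 < G) (hPinf : 0 < Pinf) (hM : 0 < M) (hγ : 0 < γ)
    (hδ : (Pinf / A) ^ (1 / γ) < δ)
    (f : ℝ → ℝ) (hfcont : ContinuousOn f (Set.Icc 0 M))
    (hfbd : ∀ x ∈ Set.Icc (0 : ℝ) M, (Pinf / A) ^ (1 / γ) ≤ f x ∧ f x ≤ δ) :
    ∀ x ∈ Set.Icc (0 : ℝ) M,
      Pinf ≤ A *
        (((Pinf + ∫ y in x..M,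
            G * y / (((n : ℝ) * ∫ z in (0 : ℝ)..y, (f z)⁻¹) ^ ((1 : ℝ) / (n : ℝ))) ^
              (2 * n - 2)) / A) ^ (1 / γ)) ^ γ ∧
      A * (((Pinf + ∫ y in x..M,
            G * y / (((n : ℝ) * ∫ z in (0 : ℝ)..y, (f z)⁻¹) ^ ((1 : ℝ) / (n : ℝ))) ^
              (2 * n - 2)) / A) ^ (1 / γ)) ^ γ ≤
        Pinf + G / 2 * δ ^ ((2 * (n : ℝ) - 2) / (n : ℝ)) *
          (n : ℝ) ^ ((2 - (n : ℝ)) / (n : ℝ)) * M ^ ((2 : ℝ) / (n : ℝ)) := by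
  have hn2 : (2 : ℝ) ≤ n := by exact_mod_cast hn
  have hn0 : (0 : ℝ) < n := by linarith
  have hc : 0 < (Pinf / A) ^ (1 / γ) := by positivity
  have hδ0 : 0 < δ := hc.trans hδ
  intro x hx
  have hF : ∀ y ∈ Set.Icc (0 : ℝ) M, y / δ ≤ ∫ z in (0 : ℝ)..y, (f z)⁻¹ := fun y hy =>
    have hsub : Set.Icc 0 y ⊆ Set.Icc 0 M := Set.Icc_subset_Icc_right hy.2
    div_le_integral_inv_of_le hy.1 (hfcont.mono hsub)
      (fun z hz => hc.trans_le (hfbd z (hsub hz)).1) (fun z hz => (hfbd z (hsub hz)).2)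
  set g : ℝ → ℝ := fun y =>
    G * y / (((n : ℝ) * ∫ z in (0 : ℝ)..y, (f z)⁻¹) ^ ((1 : ℝ) / (n : ℝ))) ^ (2 * n - 2) with hg
  have hg0 : ∀ y ∈ Set.Icc x M, 0 ≤ g y := by
    intro y hy
    have hy0 : 0 ≤ y := hx.1.trans hy.1
    have : 0 ≤ ∫ z in (0 : ℝ)..y, (f z)⁻¹ := (div_nonneg hy0 hδ0.le).trans (hF y ⟨hy0, hy.2⟩)
    simp only [hg]
    positivity
  have hI0 : 0 ≤ ∫ y in x..M, g y := intervalIntegral.integral_nonneg hx.2 hg0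
  have hcancel : A * (((Pinf + ∫ y in x..M, g y) / A) ^ (1 / γ)) ^ γ =
      Pinf + ∫ y in x..M, g y := by
    rw [← Real.rpow_mul (by positivity), one_div_mul_cancel hγ.ne', Real.rpow_one]
    field_simp
  rw [hcancel]
  refine ⟨by linarith, ?_⟩
  set p : ℝ := (2 * (n : ℝ) - 2) / (n : ℝ) with hp
  set q : ℝ := (2 - (n : ℝ)) / (n : ℝ) with hq
  have hq1 : q + 1 = 2 / n := by rw [hq]; field_simp; ring
  have hqneg : -1 < q := by
    have : 0 < 2 / (n : ℝ) := by positivity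
    linarith
  set C : ℝ := G * δ ^ p * (n : ℝ) ^ (-p) with hC
  have hC0 : 0 ≤ C := by positivity
  have hmono : ∫ y in x..M, g y ≤ ∫ y in x..M, C * y ^ q := by
    rw [intervalIntegral.integral_of_le hx.2, intervalIntegral.integral_of_le hx.2]
    refine integral_mono_of_nonneg ?_ ?_ ?_
    · filter_upwards [ae_restrict_mem measurableSet_Ioc] with y hy
      exact hg0 y ⟨hy.1.le, hy.2⟩
    · exact (intervalIntegrable_iff_integrableOn_Ioc_of_le hx.2).1
        ((intervalIntegrable_rpow' hqneg).const_mul C)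
    · filter_upwards [ae_restrict_mem measurableSet_Ioc] with y hy
      have hy0 : 0 < y := hx.1.trans_lt hy.1
      exact mul_div_rpow_pow_le hn hG.le hδ0 hy0 (hF y ⟨hy0.le, hy.2⟩)
  have hnq : (n : ℝ) ^ q = n * (n : ℝ) ^ (-p) := by
    have : q = 1 + -p := by rw [hq, hp]; field_simp; ring
    rw [this, Real.rpow_add hn0, Real.rpow_one]
  have hx0 : 0 ≤ x ^ (2 / (n : ℝ)) := Real.rpow_nonneg hx.1 _
  have hval : ∫ y in x..M, C * y ^ q ≤ G / 2 * δ ^ p * (n : ℝ) ^ q * M ^ (2 / (n : ℝ)) := by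
    rw [intervalIntegral.integral_const_mul, integral_rpow (Or.inl hqneg), hq1]
    calc C * ((M ^ (2 / (n : ℝ)) - x ^ (2 / (n : ℝ))) / (2 / n))
        ≤ C * (M ^ (2 / (n : ℝ)) / (2 / n)) := by gcongr; linarith
      _ = _ := by
        rw [hnq, hC]
        field_simp
  linarith
end
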